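/- In dimension 9, every finite set S of points on the unit sphere of EuclideanSpace ℝ (Fin 9) (i.e., ‖x‖ = 1 for all x ∈ S) such that any two distinct points of S are at Euclidean distance at least 1 has cardinality at most 364; that is, the kissing number in dimension 9 is at most 364. -/

import Mathlib

namespace Kiss9
open MvPolynomial

/-! ## Fischer inner product and zonal harmonics -/

noncomputable def wt {m : ℕ} (α : Fin m →₀ ℕ) : ℝ := ∏ i, ((α i).factorial : ℝ)

noncomputable def fis (m : ℕ) :
    MvPolynomial (Fin m) ℝ →ₗ[ℝ] MvPolynomial (Fin m) ℝ →ₗ[ℝ] ℝ :=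
  (MvPolynomial.basisMonomials (Fin m) ℝ).constr ℝ (fun α => wt α • lcoeff ℝ α)

lemma fis_monomial {m : ℕ} (α : Fin m →₀ ℕ) (a : ℝ) (g : MvPolynomial (Fin m) ℝ) :
    fis m (monomial α a) g = a * (wt α * coeff α g) := by
  have h1 : (monomial α a : MvPolynomial (Fin m) ℝ) = a • (basisMonomials (Fin m) ℝ α) := by
    simp [smul_monomial]
  rw [h1, map_smul, fis, Module.Basis.constr_basis]
  simp

lemma fis_self {m : ℕ} (f : MvPolynomial (Fin m) ℝ) : 0 ≤ fis m f f := by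
  have h : fis m f f = ∑ α ∈ f.support, fis m (monomial α (coeff α f)) f := by
    have h2 : fis m f = fis m (∑ α ∈ f.support, monomial α (coeff α f)) :=
      congrArg _ f.as_sum
    rw [h2, map_sum, LinearMap.sum_apply]
  rw [h]
  refine Finset.sum_nonneg fun α _ => ?_
  rw [fis_monomial]
  have : 0 ≤ wt α := Finset.prod_nonneg fun i _ => by positivity
  nlinarith [mul_nonneg this (mul_self_nonneg (coeff α f))]

lemma wt_add {m : ℕ} (α : Fin m →₀ ℕ) (i : Fin m) :
    wt (α + Finsupp.single i 1) = wt α * ((α i : ℝ) + 1) := by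
  unfold wt
  rw [← Finset.mul_prod_erase _ _ (Finset.mem_univ i),
    ← Finset.mul_prod_erase _ (fun j => ((α j).factorial : ℝ)) (Finset.mem_univ i)]
  have : ∏ x ∈ Finset.univ.erase i, ((((α + Finsupp.single i 1 : Fin m →₀ ℕ)) x).factorial : ℝ)
      = ∏ x ∈ Finset.univ.erase i, ((α x).factorial : ℝ) := by
    refine Finset.prod_congr rfl fun x hx => ?_
    have : x ≠ i := Finset.ne_of_mem_erase hx
    simp [Finsupp.single_apply, this.symm]
  rw [this]
  simp [Nat.factorial_succ]
  ring

lemma fis_X_mul {m : ℕ} (i : Fin m) (f g : MvPolynomial (Fin m) ℝ) :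
    fis m (X i * f) g = fis m f (pderiv i g) := by
  induction f using MvPolynomial.induction_on' with
  | monomial u a =>
    rw [X, monomial_mul, fis_monomial, fis_monomial, coeff_pderiv, add_comm _ u, wt_add]
    ring
  | add p q hp hq => rw [mul_add, map_add, map_add, LinearMap.add_apply, LinearMap.add_apply, hp, hq]

noncomputable def lin {m : ℕ} (x : Fin m → ℝ) : MvPolynomial (Fin m) ℝ := ∑ i, C (x i) * X i
noncomputable def quad (m : ℕ) : MvPolynomial (Fin m) ℝ := ∑ i, X i * X i
noncomputable def dd {m : ℕ} (x : Fin m → ℝ) (g : MvPolynomial (Fin m) ℝ) :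
    MvPolynomial (Fin m) ℝ := ∑ i, C (x i) * pderiv i g
noncomputable def lap {m : ℕ} (g : MvPolynomial (Fin m) ℝ) :
    MvPolynomial (Fin m) ℝ := ∑ i, pderiv i (pderiv i g)

lemma fis_C_mul {m : ℕ} (a : ℝ) (f g : MvPolynomial (Fin m) ℝ) :
    fis m (C a * f) g = a * fis m f g := by
  rw [C_mul', map_smul]; simp

lemma fis_C_mul' {m : ℕ} (a : ℝ) (f g : MvPolynomial (Fin m) ℝ) :
    fis m f (C a * g) = a * fis m f g := by
  rw [C_mul', map_smul]; simp

lemma fis_lin_mul {m : ℕ} (x : Fin m → ℝ) (f g : MvPolynomial (Fin m) ℝ) :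
    fis m (lin x * f) g = fis m f (dd x g) := by
  unfold lin dd
  rw [Finset.sum_mul, map_sum, LinearMap.sum_apply, map_sum]
  refine Finset.sum_congr rfl fun i _ => ?_
  rw [mul_assoc, fis_C_mul, fis_C_mul', fis_X_mul]

lemma fis_quad_mul {m : ℕ} (f g : MvPolynomial (Fin m) ℝ) :
    fis m (quad m * f) g = fis m f (lap g) := by
  unfold quad lap
  rw [Finset.sum_mul, map_sum, LinearMap.sum_apply, map_sum]
  refine Finset.sum_congr rfl fun i _ => ?_
  rw [mul_assoc, fis_X_mul, fis_X_mul]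

lemma dd_add {m : ℕ} (x : Fin m → ℝ) (f g : MvPolynomial (Fin m) ℝ) :
    dd x (f + g) = dd x f + dd x g := by
  simp [dd, mul_add, Finset.sum_add_distrib]

lemma dd_sub {m : ℕ} (x : Fin m → ℝ) (f g : MvPolynomial (Fin m) ℝ) :
    dd x (f - g) = dd x f - dd x g := by
  simp [dd, mul_sub, Finset.sum_sub_distrib]

lemma dd_mul {m : ℕ} (x : Fin m → ℝ) (f g : MvPolynomial (Fin m) ℝ) :
    dd x (f * g) = dd x f * g + f * dd x g := by
  simp only [dd, Finset.sum_mul, Finset.mul_sum, ← Finset.sum_add_distrib]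
  refine Finset.sum_congr rfl fun i _ => ?_
  rw [pderiv_mul]; ring

lemma dd_C {m : ℕ} (x : Fin m → ℝ) (a : ℝ) : dd x (C a) = 0 := by
  simp [dd]

lemma pderiv_lin {m : ℕ} (y : Fin m → ℝ) (i : Fin m) : pderiv i (lin y) = C (y i) := by
  simp only [lin, map_sum, pderiv_C_mul, pderiv_X]
  rw [Finset.sum_eq_single i]
  · simp [C_mul']
  · intro j _ hj
    simp [Pi.single_apply, hj.symm]
  · simp

lemma pderiv_quad {m : ℕ} (i : Fin m) : pderiv i (quad m) = 2 * X i := by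
  simp only [quad, map_sum, pderiv_mul, pderiv_X]
  rw [Finset.sum_eq_single i]
  · simp; ring
  · intro j _ hj
    simp [Pi.single_apply, hj.symm]
  · simp

lemma dd_lin {m : ℕ} (x y : Fin m → ℝ) : dd x (lin y) = C (∑ i, x i * y i) := by
  simp [dd, pderiv_lin, map_sum]

lemma dd_quad {m : ℕ} (x : Fin m → ℝ) : dd x (quad m) = 2 * lin x := by
  simp only [dd, pderiv_quad, lin, Finset.mul_sum]
  exact Finset.sum_congr rfl fun i _ => by ring

lemma lap_add {m : ℕ} (f g : MvPolynomial (Fin m) ℝ) : lap (f + g) = lap f + lap g := by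
  simp [lap, Finset.sum_add_distrib]

lemma lap_sub {m : ℕ} (f g : MvPolynomial (Fin m) ℝ) : lap (f - g) = lap f - lap g := by
  simp [lap, Finset.sum_sub_distrib]

lemma lap_C_mul {m : ℕ} (a : ℝ) (f : MvPolynomial (Fin m) ℝ) : lap (C a * f) = C a * lap f := by
  simp [lap, Finset.mul_sum, pderiv_C_mul, C_mul']

lemma lap_lin_mul {m : ℕ} (y : Fin m → ℝ) (f : MvPolynomial (Fin m) ℝ) :
    lap (lin y * f) = 2 * dd y f + lin y * lap f := by
  simp only [lap, dd, Finset.mul_sum, ← Finset.sum_add_distrib]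
  refine Finset.sum_congr rfl fun i _ => ?_
  rw [pderiv_mul, map_add, pderiv_mul, pderiv_mul, pderiv_lin, pderiv_C]
  ring

lemma lap_quad_mul {m k : ℕ} (f : MvPolynomial (Fin m) ℝ) (hf : f.IsHomogeneous k) :
    lap (quad m * f) = (2 * m + 4 * k : ℝ) • f + quad m * lap f := by
  have h : lap (quad m * f) = (∑ i : Fin m, 2 * f) + 4 * (∑ i, X i * pderiv i f)
      + quad m * lap f := by
    simp only [lap, Finset.mul_sum, ← Finset.sum_add_distrib]
    refine Finset.sum_congr rfl fun i _ => ?_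
    rw [pderiv_mul, map_add, pderiv_mul, pderiv_mul, pderiv_quad, pderiv_mul, pderiv_X_self]
    have : pderiv i (2 : MvPolynomial (Fin m) ℝ) = 0 := by
      rw [show (2 : MvPolynomial (Fin m) ℝ) = C 2 from (map_ofNat C 2).symm, pderiv_C]
    rw [this]; ring
  rw [h, hf.sum_X_mul_pderiv]
  congr 1
  simp only [Finset.sum_const, Finset.card_univ, Fintype.card_fin, add_smul, mul_smul]
  simp only [nsmul_eq_mul, smul_eq_C_mul, map_ofNat, map_natCast]
  ring

/-- scaled Gegenbauer polynomials, homogenised -/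
def geg {R : Type*} [CommRing R] (m : ℕ) (s r : R) : ℕ → R
  | 0 => 1
  | 1 => (m - 2 : ℤ) * s
  | (k + 2) => (2 * (k + 1) + m - 2 : ℤ) * s * geg m s r (k + 1)
      - ((k + 1) * (k + 1 + m - 3) : ℤ) * r * geg m s r k

section zonal
variable {m : ℕ} (y : Fin m → ℝ)

noncomputable def zon (m : ℕ) (y : Fin m → ℝ) (k : ℕ) : MvPolynomial (Fin m) ℝ :=
  geg m (lin y) (C (∑ i, y i * y i) * quad m) k

lemma lin_hom : (lin y).IsHomogeneous 1 := by
  refine IsHomogeneous.sum _ _ _ fun i _ => ?_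
  simpa using (isHomogeneous_C (Fin m) (y i)).mul (isHomogeneous_X ℝ i)

lemma quad_hom : (quad m).IsHomogeneous 2 := by
  refine IsHomogeneous.sum _ _ _ fun i _ => ?_
  simpa using (isHomogeneous_X ℝ i).mul (isHomogeneous_X ℝ i)

lemma intc (m : ℕ) (z : ℤ) : ((z : MvPolynomial (Fin m) ℝ)) = C (z : ℝ) := by simp

lemma zon_hom (k : ℕ) : (zon m y k).IsHomogeneous k ∧ (zon m y (k+1)).IsHomogeneous (k+1) := by
  induction k with
  | zero =>
    constructor
    · unfold zon; rw [geg]; exact isHomogeneous_one _ _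
    · unfold zon; rw [zero_add, geg, intc]
      have := (isHomogeneous_C (Fin m) ((m - 2 : ℤ) : ℝ)).mul (lin_hom y)
      rw [zero_add] at this
      exact this
  | succ k ih =>
    refine ⟨ih.2, ?_⟩
    unfold zon at ih ⊢
    rw [geg]
    refine IsHomogeneous.sub ?_ ?_
    · rw [intc]
      have := ((isHomogeneous_C (Fin m) ((2 * (k + 1) + m - 2 : ℤ) : ℝ)).mul (lin_hom y)).mul ih.2
      rw [show 0 + 1 + (k + 1) = k + 1 + 1 by ring] at this
      exact this
    · rw [intc]
      have := ((isHomogeneous_C (Fin m) (((k + 1) * (k + 1 + m - 3) : ℤ) : ℝ)).mul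
        ((isHomogeneous_C (Fin m) (∑ i, y i * y i)).mul (quad_hom (m := m)))).mul ih.1
      rw [show 0 + (0 + 2) + k = k + 1 + 1 by ring] at this
      exact this

lemma zon_dd (k : ℕ) :
    dd y (zon m y (k+1)) = (((k + 1) * (k + 1 + m - 3) : ℤ) : MvPolynomial (Fin m) ℝ) *
        C (∑ i, y i * y i) * zon m y k ∧
    dd y (zon m y (k+2)) = (((k + 2) * (k + 2 + m - 3) : ℤ) : MvPolynomial (Fin m) ℝ) *
        C (∑ i, y i * y i) * zon m y (k+1) := by
  have dint : ∀ z : ℤ, dd y (z : MvPolynomial (Fin m) ℝ) = 0 := fun z => by rw [intc, dd_C]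
  have hone : dd y (1 : MvPolynomial (Fin m) ℝ) = 0 := by simpa using dint 1
  induction k with
  | zero =>
    have h1 : dd y (zon m y (0+1)) = (((0 + 1) * (0 + 1 + m - 3) : ℤ) : MvPolynomial (Fin m) ℝ) *
        C (∑ i, y i * y i) * zon m y 0 := by
      simp only [zon, geg, dd_mul, dint, dd_lin]
      push_cast; ring
    refine ⟨by simpa using h1, ?_⟩
    simp only [zon, geg, dd_mul, dd_sub, dint, dd_lin, dd_C, dd_quad, hone]
    push_cast; ring
  | succ k ih =>
    refine ⟨ih.2, ?_⟩
    have e : zon m y (k+1+2) = ((2 * (k + 1 + 1) + m - 2 : ℤ) : MvPolynomial (Fin m) ℝ) * lin y *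
        zon m y (k+2) - (((k + 1 + 1) * (k + 1 + 1 + m - 3) : ℤ) : MvPolynomial (Fin m) ℝ) *
        (C (∑ i, y i * y i) * quad m) * zon m y (k+1) := by
      simp only [zon]; rw [geg]; push_cast; ring
    have e2 : zon m y (k+2) = ((2 * (k + 1) + m - 2 : ℤ) : MvPolynomial (Fin m) ℝ) * lin y *
        zon m y (k+1) - (((k + 1) * (k + 1 + m - 3) : ℤ) : MvPolynomial (Fin m) ℝ) *
        (C (∑ i, y i * y i) * quad m) * zon m y k := by
      simp only [zon]; rw [geg]
    have := ih.1
    rw [e, dd_sub, dd_mul, dd_mul, dd_mul, dd_mul, dd_mul, ih.1, ih.2, dint, dint, dd_C, dd_lin,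
      dd_quad]
    have e3 := e2
    rw [show zon m y (k+1+1) = zon m y (k+2) from rfl]
    push_cast at e3 ⊢
    linear_combination (exp := 1) (C (∑ i, y i * y i)) *
      (((k : MvPolynomial (Fin m) ℝ) + 2) * (k + 2 + m - 3)) * (-e3)

lemma zon_lap (k : ℕ) : lap (zon m y k) = 0 ∧ lap (zon m y (k+1)) = 0 := by
  induction k with
  | zero =>
    constructor
    · simp [zon, geg, lap]
    · simp only [zon, geg, intc, lap_C_mul]
      have := lap_lin_mul y 1
      rw [mul_one] at this
      rw [this]; simp [dd, lap]
  | succ k ih =>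
    refine ⟨ih.2, ?_⟩
    have e2 : zon m y (k+1+1) = C ((2 * (k + 1) + m - 2 : ℤ) : ℝ) * (lin y *
        zon m y (k+1)) - C (((k + 1) * (k + 1 + m - 3) : ℤ) : ℝ) *
        (C (∑ i, y i * y i) * (quad m * zon m y k)) := by
      simp only [zon]; rw [geg]; simp only [intc]; ring
    rw [e2, lap_sub, lap_C_mul, lap_C_mul, lap_C_mul, lap_lin_mul,
      lap_quad_mul _ (zon_hom y k).1, ih.1, ih.2, (zon_dd y k).1]
    simp only [smul_eq_C_mul, map_add, map_mul, map_natCast, map_ofNat, map_sub, map_intCast]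
    push_cast
    ring

/-- leading coefficient -/
def ldc (m : ℕ) : ℕ → ℝ
  | 0 => 1
  | k + 1 => ((2 * k + m - 2 : ℤ) : ℝ) * ldc m k

lemma ldc_pos (hm : 3 ≤ m) (k : ℕ) : 0 < ldc m k := by
  induction k with
  | zero => exact one_pos
  | succ k ih =>
    have : (0:ℝ) < ((2 * k + m - 2 : ℤ) : ℝ) := by
      exact_mod_cast (by omega : (0:ℤ) < 2 * k + m - 2)
    exact mul_pos this ih

lemma zon_lead (k : ℕ) : ∃ R : MvPolynomial (Fin m) ℝ,
    zon m y k = C (ldc m k) * lin y ^ k + quad m * R := by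
  suffices h : ∀ k, (∃ R : MvPolynomial (Fin m) ℝ, 
    zon m y k = C (ldc m k) * lin y ^ k + quad m * R) ∧ (∃ R : MvPolynomial (Fin m) ℝ,
    zon m y (k+1) = C (ldc m (k+1)) * lin y ^ (k+1) + quad m * R) from (h k).1
  intro k
  induction k with
  | zero =>
    refine ⟨⟨0, by simp [zon, geg, ldc]⟩, ⟨0, ?_⟩⟩
    simp only [zon, geg, ldc, intc]
    simp
  | succ k ih =>
    obtain ⟨h0, h1⟩ := ih
    refine ⟨h1, ?_⟩
    obtain ⟨R, h⟩ := h1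
    refine ⟨C ((2 * (k + 1) + m - 2 : ℤ) : ℝ) * lin y * R -
      C (((k + 1) * (k + 1 + m - 3) : ℤ) : ℝ) * C (∑ i, y i * y i) * zon m y k, ?_⟩
    have e2 : zon m y (k+1+1) = C ((2 * (k + 1) + m - 2 : ℤ) : ℝ) * lin y *
        zon m y (k+1) - C (((k + 1) * (k + 1 + m - 3) : ℤ) : ℝ) *
        (C (∑ i, y i * y i) * quad m) * zon m y k := by
      simp only [zon]; rw [geg]; simp only [intc]
    have e4 : ldc m (k+1+1) = ((2 * (k + 1) + m - 2 : ℤ) : ℝ) * ldc m (k+1) := by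
      rw [ldc]; push_cast; ring
    rw [e2, h, e4, map_mul]; ring

end zonal

lemma fis_lin_pow {m : ℕ} (x : Fin m → ℝ) (k : ℕ) : ∀ (g : MvPolynomial (Fin m) ℝ),
    g.IsHomogeneous k → fis m (lin x ^ k) g = (k.factorial : ℝ) * eval x g := by
  induction k with
  | zero =>
    intro g hg
    have hg' : g = C (coeff 0 g) := by
      have := (totalDegree_eq_zero_iff_eq_C (p := g)).1 (Nat.le_zero.1 hg.totalDegree_le)
      exact this
    rw [pow_zero, show (1 : MvPolynomial (Fin m) ℝ) = monomial 0 1 from rfl, fis_monomial, hg']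
    simp [wt]
  | succ k ih =>
    intro g hg
    rw [pow_succ', fis_lin_mul, ih]
    · have h := congrArg (eval x) hg.sum_X_mul_pderiv
      simp only [map_sum, map_mul, eval_X, nsmul_eq_mul, map_natCast] at h
      simp only [dd, map_sum, map_mul, eval_C]
      rw [h, Nat.factorial_succ]; push_cast; ring
    · refine IsHomogeneous.sum _ _ _ fun i _ => ?_
      simpa using (isHomogeneous_C (Fin m) (x i)).mul hg.pderiv

lemma eval_zon {m : ℕ} (x y : Fin m → ℝ) (k : ℕ) : eval x (zon m y k) =
    geg m (∑ i, y i * x i) ((∑ i, y i * y i) * ∑ i, x i * x i) k := by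
  suffices h : eval x (zon m y k) =
    geg m (∑ i, y i * x i) ((∑ i, y i * y i) * ∑ i, x i * x i) k ∧ eval x (zon m y (k+1)) =
    geg m (∑ i, y i * x i) ((∑ i, y i * y i) * ∑ i, x i * x i) (k+1) from h.1
  have hl : eval x (lin y) = ∑ i, y i * x i := by simp [lin]
  have hq : eval x (quad m) = ∑ i, x i * x i := by simp [quad]
  induction k with
  | zero => constructor <;> simp [zon, geg, hl]
  | succ k ih =>
    refine ⟨ih.2, ?_⟩
    obtain ⟨h1, h2⟩ := ih
    unfold zon at h1 h2 ⊢
    rw [geg, geg, ← h1, ← h2]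
    simp only [map_sub, map_mul, hl, hq, eval_C, map_intCast]

theorem geg_psd {m : ℕ} (hm : 3 ≤ m) {ι : Type*} (S : Finset ι) (v : ι → Fin m → ℝ)
    (φ : ι → ℝ) (k : ℕ) :
    0 ≤ ∑ a ∈ S, ∑ b ∈ S, φ a * φ b *
      geg m (∑ i, v a i * v b i) ((∑ i, v a i * v a i) * ∑ i, v b i * v b i) k := by
  have key : ∀ a b, fis m (zon m (v b) k) (zon m (v a) k) = (ldc m k * k.factorial) *
      geg m (∑ i, v a i * v b i) ((∑ i, v a i * v a i) * ∑ i, v b i * v b i) k := by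
    intro a b
    obtain ⟨R, h⟩ := zon_lead (v b) k
    rw [h, map_add, LinearMap.add_apply, fis_C_mul, fis_quad_mul, (zon_lap (v a) k).1,
      fis_lin_pow _ _ _ (zon_hom (v a) k).1, eval_zon]
    simp; ring
  have h0 := fis_self (∑ a ∈ S, C (φ a) * zon m (v a) k)
  have hpos : 0 < ldc m k * k.factorial := mul_pos (ldc_pos hm k) (by positivity)
  have h1 : fis m (∑ a ∈ S, C (φ a) * zon m (v a) k) (∑ a ∈ S, C (φ a) * zon m (v a) k) =
      (ldc m k * k.factorial) * ∑ a ∈ S, ∑ b ∈ S, φ a * φ b *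
      geg m (∑ i, v a i * v b i) ((∑ i, v a i * v a i) * ∑ i, v b i * v b i) k := by
    rw [map_sum]
    simp only [map_sum, LinearMap.sum_apply, fis_C_mul, fis_C_mul', key, Finset.mul_sum]
    refine Finset.sum_congr rfl fun a _ => Finset.sum_congr rfl fun b _ => ?_
    ring
  rw [h1] at h0
  exact nonneg_of_mul_nonneg_right h0 hpos


/-! ## The three-point bound -/

abbrev E9 := EuclideanSpace ℝ (Fin 9)

lemma psd9 (S : Finset E9) (hS : ∀ x ∈ S, ‖x‖ = 1) (k : ℕ) :
    0 ≤ ∑ x ∈ S, ∑ y ∈ S, geg 9 (inner ℝ x y) 1 k := by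
  have h := geg_psd (m := 9) (by norm_num) S (fun x i => x i) (fun _ => 1) k
  have hi : ∀ x y : E9, ∑ i, x i * y i = inner ℝ x y := by
    intro x y
    rw [PiLp.inner_apply]
    refine Finset.sum_congr rfl fun i _ => ?_
    simp [mul_comm]
  refine le_of_le_of_eq h (Finset.sum_congr rfl fun x hx => Finset.sum_congr rfl fun y hy => ?_)
  rw [hi, hi, hi, real_inner_self_eq_norm_sq, real_inner_self_eq_norm_sq, hS x hx, hS y hy]
  norm_num

lemma exists_proj (x : E9) (hx : ‖x‖ = 1) : ∃ v : E9 → Fin 8 → ℝ, ∀ y z : E9,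
    ∑ i, v y i * v z i = inner ℝ y z - inner ℝ x y * inner ℝ x z := by
  have hx0 : x ≠ 0 := by intro h; rw [h] at hx; simp at hx
  haveI : Fact (Module.finrank ℝ E9 = 8 + 1) := ⟨by simp⟩
  have hfr : Module.finrank ℝ (ℝ ∙ x)ᗮ = 8 := Submodule.finrank_orthogonal_span_singleton hx0
  let b := (stdOrthonormalBasis ℝ (ℝ ∙ x)ᗮ).reindex (finCongr hfr)
  have hmem : ∀ y : E9, y - (inner ℝ x y : ℝ) • x ∈ (ℝ ∙ x)ᗮ := by
    intro y
    rw [Submodule.mem_orthogonal_singleton_iff_inner_right, inner_sub_right, inner_smul_right,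
      real_inner_self_eq_norm_sq, hx]
    ring
  let p : E9 → (ℝ ∙ x)ᗮ := fun y => ⟨_, hmem y⟩
  refine ⟨fun y i => inner ℝ (p y) (b i), fun y z => ?_⟩
  have h1 := b.sum_inner_mul_inner (p y) (p z)
  have h2 : ∀ i, inner ℝ (b i) (p z) = inner ℝ (p z) (b i) := fun i => real_inner_comm _ _
  simp only [h2] at h1
  rw [h1]
  show inner ℝ (y - (inner ℝ x y : ℝ) • x) (z - (inner ℝ x z : ℝ) • x) = _
  simp only [inner_sub_left, inner_sub_right, inner_smul_left, inner_smul_right,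
    real_inner_self_eq_norm_sq, hx, real_inner_comm x y]
  simp

lemma psd8 (S : Finset E9) (hS : ∀ x ∈ S, ‖x‖ = 1) (x : E9) (hx : ‖x‖ = 1) (φ : ℝ → ℝ) (k : ℕ) :
    0 ≤ ∑ y ∈ S, ∑ z ∈ S, φ (inner ℝ x y) * φ (inner ℝ x z) *
      geg 8 (inner ℝ y z - inner ℝ x y * inner ℝ x z)
        ((1 - inner ℝ x y ^ 2) * (1 - inner ℝ x z ^ 2)) k := by
  obtain ⟨v, hv⟩ := exists_proj x hx
  have h := geg_psd (m := 8) (by norm_num) S v (fun y => φ (inner ℝ x y)) k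
  refine le_of_le_of_eq h (Finset.sum_congr rfl fun y hy => Finset.sum_congr rfl fun z hz => ?_)
  rw [hv, hv, hv, real_inner_self_eq_norm_sq, real_inner_self_eq_norm_sq, hS y hy, hS z hz]
  congr 2
  ring

lemma gram_det (x y z : E9) (hx : ‖x‖ = 1) (hy : ‖y‖ = 1) (hz : ‖z‖ = 1) :
    0 ≤ 1 + 2 * inner ℝ x y * inner ℝ x z * inner ℝ y z
      - inner ℝ x y ^ 2 - inner ℝ x z ^ 2 - inner ℝ y z ^ 2 := by
  obtain ⟨v, hv⟩ := exists_proj x hx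
  have h := Finset.sum_mul_sq_le_sq_mul_sq Finset.univ (v y) (v z)
  simp only [pow_two (v y _), pow_two (v z _), hv, real_inner_self_eq_norm_sq, hy, hz] at h
  nlinarith [h]

theorem three_point (S : Finset E9) (hS : ∀ x ∈ S, ‖x‖ = 1)
    (hd : ∀ x ∈ S, ∀ y ∈ S, x ≠ y → 1 ≤ dist x y)
    (f : ℝ → ℝ → ℝ → ℝ) (A : ℝ → ℝ) (W : ℝ) (hW : 0 < W)
    (hf : ∀ x ∈ S, 0 ≤ ∑ y ∈ S, ∑ z ∈ S, f (inner ℝ x y) (inner ℝ x z) (inner ℝ y z))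
    (hsym : ∀ u v t, f u v t = f v u t)
    (hA : 0 ≤ ∑ x ∈ S, ∑ y ∈ S, A (inner ℝ x y))
    (pair : ∀ u ∈ Set.Icc (-1 : ℝ) (1/2), A u + f u u 1 + 2 * f 1 u u ≤ -W)
    (triple : ∀ u ∈ Set.Icc (-1 : ℝ) (1/2), ∀ v ∈ Set.Icc (-1 : ℝ) (1/2),
      ∀ t ∈ Set.Icc (-1 : ℝ) (1/2), 0 ≤ 1 + 2 * u * v * t - u^2 - v^2 - t^2 →
      f u v t + f u t v + f v t u ≤ 0)
    (bd : W + A 1 + f 1 1 1 < 365 * W) : S.card ≤ 364 := by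
  classical
  have hin : ∀ x ∈ S, ∀ y ∈ S, x ≠ y → inner ℝ x y ∈ Set.Icc (-1 : ℝ) (1/2) := by
    intro x hx y hy hxy
    have h1 := hd x hx y hy hxy
    have h2 : dist x y ^ 2 = 2 - 2 * inner ℝ x y := by
      rw [dist_eq_norm, norm_sub_sq_real, hS x hx, hS y hy]; ring
    have h3 := abs_real_inner_le_norm x y
    rw [hS x hx, hS y hy, one_mul, abs_le] at h3
    exact ⟨h3.1, by nlinarith⟩
  have h11 : ∀ x ∈ S, inner ℝ x x = (1 : ℝ) := by
    intro x hx; rw [real_inner_self_eq_norm_sq, hS x hx]; norm_num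
  set T : E9 → E9 → E9 → ℝ := fun x y z => f (inner ℝ x y) (inner ℝ x z) (inner ℝ y z) with hT
  set F : E9 → E9 → E9 → ℝ := fun x y z => T x y z + T y x z + T z x y with hF
  set P : E9 → E9 → ℝ := fun x y => f (inner ℝ x y) (inner ℝ x y) 1 +
    2 * f 1 (inner ℝ x y) (inner ℝ x y) with hP
  have c : ∀ x y : E9, inner ℝ y x = (inner ℝ x y : ℝ) := fun x y => real_inner_comm _ _
  have hpt : ∀ x ∈ S, ∀ y ∈ S, ∀ z ∈ S, F x y z ≤
      (if x = y then P x z else 0) + (if x = z then P x y else 0) + (if y = z then P x y else 0)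
      - (if x = y then (if x = z then 2 * P x x else 0) else 0) := by
    intro x hx y hy z hz
    by_cases hxy : x = y
    · subst hxy
      by_cases hxz : x = z
      · subst hxz
        simp only [hF, hT, hP, h11 x hx, if_true]
        linarith
      · simp only [hF, hT, hP, h11 x hx, if_true, hxz, if_false, c x z,
          hsym (inner ℝ x z) 1]
        linarith
    · by_cases hxz : x = z
      · subst hxz
        simp only [hF, hT, hP, h11 x hx, h11 y hy, if_true, hxy, Ne.symm hxy, if_false, c x y,
          hsym (inner ℝ x y) 1]
        linarith
      · by_cases hyz : y = z
        · subst hyz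
          simp only [hF, hT, hP, h11 x hx, h11 y hy, if_true, hxy, if_false, c x y,
            hsym (inner ℝ x y) 1]
          linarith
        · simp only [hF, hT, hP, hxy, hxz, hyz, if_false, c x y, c x z, c y z]
          have := triple _ (hin x hx y hy hxy) _ (hin x hx z hz hxz) _ (hin y hy z hz hyz)
            (gram_det x y z (hS x hx) (hS y hy) (hS z hz))
          linarith
  have hsum : ∑ x ∈ S, ∑ y ∈ S, ∑ z ∈ S, F x y z ≤
      3 * ∑ x ∈ S, ∑ y ∈ S, P x y - 2 * ∑ x ∈ S, P x x := by
    refine le_of_le_of_eq (Finset.sum_le_sum fun x hx => Finset.sum_le_sum fun y hy =>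
      Finset.sum_le_sum fun z hz => hpt x hx y hy z hz) ?_
    simp only [Finset.sum_add_distrib, Finset.sum_sub_distrib]
    have e1 : ∑ x ∈ S, ∑ y ∈ S, ∑ z ∈ S, (if x = y then P x z else 0)
        = ∑ x ∈ S, ∑ y ∈ S, P x y := by
      refine Finset.sum_congr rfl fun x hx => ?_
      rw [Finset.sum_comm]
      refine Finset.sum_congr rfl fun z hz => ?_
      rw [Finset.sum_ite_eq, if_pos hx]
    have e2 : ∑ x ∈ S, ∑ y ∈ S, ∑ z ∈ S, (if x = z then P x y else 0)
        = ∑ x ∈ S, ∑ y ∈ S, P x y := by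
      refine Finset.sum_congr rfl fun x hx => Finset.sum_congr rfl fun z hz => ?_
      rw [Finset.sum_ite_eq, if_pos hx]
    have e3 : ∑ x ∈ S, ∑ y ∈ S, ∑ z ∈ S, (if y = z then P x y else 0)
        = ∑ x ∈ S, ∑ y ∈ S, P x y := by
      refine Finset.sum_congr rfl fun x hx => Finset.sum_congr rfl fun y hy => ?_
      rw [Finset.sum_ite_eq, if_pos hy]
    have e4 : ∑ x ∈ S, ∑ y ∈ S, ∑ z ∈ S, (if x = y then (if x = z then 2 * P x x else 0) else 0)
        = 2 * ∑ x ∈ S, P x x := by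
      rw [Finset.mul_sum]
      refine Finset.sum_congr rfl fun x hx => ?_
      rw [Finset.sum_comm]
      simp only [Finset.sum_ite_eq, if_pos hx]
    rw [e1, e2, e3, e4]; ring
  have hFT : ∑ x ∈ S, ∑ y ∈ S, ∑ z ∈ S, F x y z = 3 * ∑ x ∈ S, ∑ y ∈ S, ∑ z ∈ S, T x y z := by
    simp only [hF, Finset.sum_add_distrib]
    have e1 : ∑ x ∈ S, ∑ y ∈ S, ∑ z ∈ S, T y x z = ∑ x ∈ S, ∑ y ∈ S, ∑ z ∈ S, T x y z :=
      Finset.sum_comm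
    have e2 : ∑ x ∈ S, ∑ y ∈ S, ∑ z ∈ S, T z x y = ∑ x ∈ S, ∑ y ∈ S, ∑ z ∈ S, T x y z := by
      rw [← e1]
      refine (Finset.sum_congr rfl fun x _ => Finset.sum_comm).trans ?_
      rw [Finset.sum_comm, ← e1]
    rw [e1, e2]; ring
  have hT0 : 0 ≤ ∑ x ∈ S, ∑ y ∈ S, ∑ z ∈ S, T x y z := Finset.sum_nonneg hf
  have hPA : ∑ x ∈ S, ∑ y ∈ S, (P x y + A (inner ℝ x y)) ≤
      ∑ x ∈ S, ∑ y ∈ S, (-W + if x = y then (W + A 1 + 3 * f 1 1 1) else 0) := by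
    refine Finset.sum_le_sum fun x hx => Finset.sum_le_sum fun y hy => ?_
    by_cases hxy : x = y
    · subst hxy
      simp only [hP, h11 x hx, if_true]; linarith
    · simp only [hP, if_neg hxy]
      have := pair _ (hin x hx y hy hxy)
      linarith
  have hPxx : ∑ x ∈ S, P x x = S.card * (3 * f 1 1 1) := by
    rw [← nsmul_eq_mul, ← Finset.sum_const]
    refine Finset.sum_congr rfl fun x hx => ?_
    simp only [hP, h11 x hx]; ring
  have hR : ∑ x ∈ S, ∑ y ∈ S, (-W + if x = y then (W + A 1 + 3 * f 1 1 1) else 0)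
      = S.card * (S.card * (-W) + (W + A 1 + 3 * f 1 1 1)) := by
    rw [← nsmul_eq_mul, ← Finset.sum_const]
    refine Finset.sum_congr rfl fun x hx => ?_
    rw [Finset.sum_add_distrib, Finset.sum_ite_eq, if_pos hx, Finset.sum_const, nsmul_eq_mul]
  simp only [Finset.sum_add_distrib (f := fun y => P _ y)] at hPA
  rw [Finset.sum_add_distrib, hR] at hPA
  by_contra hcon
  have hc : (365 : ℝ) ≤ S.card := by
    have : 365 ≤ S.card := by omega
    exact_mod_cast this
  have h5 : 0 ≤ (S.card : ℝ) * (S.card * (-W) + (W + A 1 + 3 * f 1 1 1)) -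
      2 * f 1 1 1 * S.card := by
    nlinarith [hsum, hFT, hT0, hPA, hPxx, hA]
  have h6 : (S.card : ℝ) * (S.card * (-W) + (W + A 1 + f 1 1 1)) < 0 := by
    apply mul_neg_of_pos_of_neg <;> nlinarith
  nlinarith
end Kiss9

namespace Kiss9
open Finset

/-- packed digits -/
def pack (w N : ℕ) (f : ℕ → ℕ) : ℕ := ∑ i ∈ range N, f i * 2 ^ (w * i)

lemma pack_congr {w N : ℕ} {f g : ℕ → ℕ} (h : ∀ i < N, f i = g i) : pack w N f = pack w N g :=
  sum_congr rfl fun i hi => by rw [h i (mem_range.1 hi)]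

lemma pack_succ (w N : ℕ) (f : ℕ → ℕ) :
    pack w (N + 1) f = 2 ^ w * pack w N (fun i => f (i + 1)) + f 0 := by
  unfold pack
  rw [sum_range_succ', mul_sum]
  simp only [mul_zero, pow_zero, mul_one, mul_add, pow_add]
  congr 1
  exact sum_congr rfl fun i _ => by ring

lemma pack_add (w N : ℕ) (f g : ℕ → ℕ) :
    pack w N f + pack w N g = pack w N (fun i => f i + g i) := by
  unfold pack; rw [← sum_add_distrib]; exact sum_congr rfl fun i _ => by ring

lemma pack_mul (w N c : ℕ) (f : ℕ → ℕ) : c * pack w N f = pack w N (fun i => c * f i) := by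
  unfold pack; rw [mul_sum]; exact sum_congr rfl fun i _ => by ring

lemma and_lemma (w a m q M : ℕ) (ha : a < 2 ^ w) (hm : m < 2 ^ w) :
    (2 ^ w * q + a) &&& (2 ^ w * M + m) = 2 ^ w * (q &&& M) + (a &&& m) := by
  apply Nat.eq_of_testBit_eq
  intro j
  rw [Nat.testBit_and, Nat.testBit_two_pow_mul_add _ ha, Nat.testBit_two_pow_mul_add _ hm,
    Nat.testBit_two_pow_mul_add _ (lt_of_le_of_lt Nat.and_le_left ha)]
  split <;> simp [Nat.testBit_and]

lemma pack_and (w N : ℕ) : ∀ (f g : ℕ → ℕ) (_ : ∀ i < N, f i < 2 ^ w) (_ : ∀ i < N, g i < 2 ^ w),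
    pack w N f &&& pack w N g = pack w N (fun i => f i &&& g i) := by
  induction N with
  | zero => intro f g _ _; simp [pack]
  | succ N ih =>
    intro f g hf hg
    rw [pack_succ, pack_succ, pack_succ, and_lemma _ _ _ _ _ (hf 0 (by omega)) (hg 0 (by omega)),
      ih _ _ (fun i hi => hf _ (by omega)) (fun i hi => hg _ (by omega))]

lemma pack_lt (w N : ℕ) : ∀ (f : ℕ → ℕ) (_ : ∀ i < N, f i < 2 ^ w), pack w N f < 2 ^ (w * N) := by
  induction N with
  | zero => intro f _; simp [pack]
  | succ N ih =>
    intro f hf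
    rw [pack_succ]
    have h1 := ih (fun i => f (i+1)) (fun i hi => hf _ (by omega))
    have h2 := hf 0 (by omega)
    have : 2 ^ (w * (N+1)) = 2 ^ w * 2 ^ (w * N) := by rw [← pow_add]; congr 1; ring
    rw [this]
    nlinarith [Nat.mul_le_mul_left (2 ^ w) (Nat.succ_le_of_lt h1)]

lemma pack_eq_zero {w N : ℕ} {f : ℕ → ℕ} (h : pack w N f = 0) : ∀ i < N, f i = 0 := by
  intro i hi
  have := (sum_eq_zero_iff.1 h) i (mem_range.2 hi)
  simpa using this

lemma pack_append (w N M : ℕ) (f : ℕ → ℕ) :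
    pack w (N + M) f = pack w N f + 2 ^ (w * N) * pack w M (fun i => f (N + i)) := by
  unfold pack
  rw [sum_range_add, mul_sum]
  congr 1
  exact sum_congr rfl fun i _ => by rw [mul_add, pow_add]; ring

/-- digit masks -/
lemma pack_lower (w N p : ℕ) (hp : p ≤ N) :
    pack w N (fun i => if i < p then 2 ^ w - 1 else 0) = 2 ^ (w * p) - 1 := by
  obtain ⟨M, rfl⟩ := Nat.exists_eq_add_of_le hp
  rw [pack_append]
  have h0 : pack w M (fun i => if p + i < p then 2 ^ w - 1 else 0) = 0 := by
    unfold pack; apply sum_eq_zero; intro i _; simp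
  rw [h0, mul_zero, add_zero, pack_congr (g := fun _ => 2 ^ w - 1) (fun i hi => by simp [hi])]
  clear h0 hp
  induction p with
  | zero => simp [pack]
  | succ p ih =>
    rw [pack_append, ih]
    simp only [pack, range_one, sum_singleton, mul_zero, pow_zero, mul_one]
    have e : 2 ^ (w * (p+1)) = 2 ^ (w * p) * 2 ^ w := by rw [← pow_add]; congr 1
    rw [e]
    have h1 : 1 ≤ 2 ^ (w * p) := Nat.one_le_two_pow
    have h2 : 1 ≤ 2 ^ w := Nat.one_le_two_pow
    zify [h1, h2, Nat.mul_le_mul h1 h2]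
    ring

lemma pack_rep (w n H : ℕ) (g : ℕ → ℕ) :
    pack w (n * H) (fun i => g (i % n)) = pack w n g * ∑ h ∈ range H, (2 ^ (w * n)) ^ h := by
  induction H with
  | zero => simp [pack]
  | succ H ih =>
    rw [mul_add, mul_one, pack_append, ih, sum_range_succ, mul_add]
    congr 1
    rw [pack_congr (f := fun i => g ((n * H + i) % n)) (g := g)]
    · rw [← pow_mul, mul_assoc]; ring
    · intro i hi; simp [Nat.mod_eq_of_lt hi]

/-- mask: digits all ones for `a ≤ (i/s)%n < b` -/
def pmask (w s n N a b : ℕ) : ℕ :=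
  Nat.mul (Nat.sub (Nat.pow 2 (w*(s*b))) (Nat.pow 2 (w*(s*a))))
   (Nat.div (Nat.sub (Nat.pow 2 (w*N)) 1) (Nat.sub (Nat.pow 2 (w*(s*n))) 1))

lemma pmask_eq (w s n H a b : ℕ) (hw : 0 < w) (hs : 0 < s) (hn : 0 < n) (hab : a ≤ b) (hb : b ≤ n) :
    pmask w s n (s*n*H) a b =
      pack w (s*n*H) (fun i => if a ≤ (i / s) % n ∧ (i / s) % n < b then 2 ^ w - 1 else 0) := by
  have h1 : pack w (s*n*H) (fun i => if a ≤ (i / s) % n ∧ (i / s) % n < b then 2 ^ w - 1 else 0)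
     = pack w (s*n*H) (fun i => (fun j => if s * a ≤ j ∧ j < s * b then 2 ^ w - 1 else 0) (i % (s*n))) := by
    apply pack_congr
    intro i _
    have e : (i / s) % n = (i % (s*n)) / s := by rw [Nat.mod_mul_right_div_self]
    simp only [e, Nat.le_div_iff_mul_le hs, Nat.div_lt_iff_lt_mul hs, mul_comm s]
  rw [h1, pack_rep w (s*n) H (fun j => if s * a ≤ j ∧ j < s * b then 2 ^ w - 1 else 0)]
  have h2 : pack w (s*n) (fun j => if s * a ≤ j ∧ j < s * b then 2 ^ w - 1 else 0)
      = 2 ^ (w * (s*b)) - 2 ^ (w * (s*a)) := by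
    have := pack_add w (s*n) (fun j => if s * a ≤ j ∧ j < s * b then 2 ^ w - 1 else 0)
      (fun j => if j < s * a then 2 ^ w - 1 else 0)
    rw [pack_lower w (s*n) (s*a) (Nat.mul_le_mul_left _ (hab.trans hb))] at this
    have h3 : pack w (s*n) (fun j => (if s * a ≤ j ∧ j < s * b then 2 ^ w - 1 else 0) +
        (if j < s * a then 2 ^ w - 1 else 0)) = 2 ^ (w * (s*b)) - 1 := by
      rw [← pack_lower w (s*n) (s*b) (Nat.mul_le_mul_left _ hb)]
      apply pack_congr
      intro i _
      have : s * a ≤ s * b := Nat.mul_le_mul_left _ hab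
      by_cases h4 : i < s * a
      · simp [h4, not_le.2 h4, h4.trans_le this]
      · simp [h4, not_lt.1 h4]
    rw [h3] at this
    have h5 : 1 ≤ 2 ^ (w * (s*a)) := Nat.one_le_two_pow
    omega
  have h3 : ∑ h ∈ range H, (2 ^ (w * (s * n))) ^ h = (2 ^ (w * (s*n*H)) - 1) / (2 ^ (w*(s*n)) - 1) := by
    rw [Nat.geomSum_eq]
    · rw [← pow_mul]; congr 3; ring
    · calc 2 = 2 ^ 1 := rfl
        _ ≤ _ := Nat.pow_le_pow_right (by norm_num) (Nat.mul_pos hw (Nat.mul_pos hs hn))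
  rw [h2, h3]
  rfl

def ones (w N : ℕ) : ℕ := Nat.div (Nat.sub (Nat.pow 2 (w*N)) 1) (Nat.sub (Nat.pow 2 w) 1)
lemma ones_eq (w N : ℕ) (hw : 0 < w) : ones w N = pack w N (fun _ => 1) := by
  unfold ones pack
  have := Nat.geomSum_eq (m := 2 ^ w) (by calc 2 = 2 ^ 1 := rfl
        _ ≤ _ := Nat.pow_le_pow_right (by norm_num) hw) N
  simp only [one_mul, pow_mul]
  rw [this, ← pow_mul]; rfl

lemma pack_mask (w N : ℕ) (f : ℕ → ℕ) (hf : ∀ i < N, f i < 2 ^ w) (P : ℕ → Prop) [DecidablePred P] :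
    pack w N f &&& pack w N (fun i => if P i then 2 ^ w - 1 else 0)
      = pack w N (fun i => if P i then f i else 0) := by
  have h1 : 1 ≤ 2 ^ w := Nat.one_le_two_pow
  rw [pack_and _ _ _ _ hf (fun i _ => by split <;> omega)]
  apply pack_congr
  intro i hi
  split
  · rw [Nat.and_two_pow_sub_one_eq_mod, Nat.mod_eq_of_lt (hf i hi)]
  · simp

/-- left shift by s digits when top s digits vanish -/
lemma pack_shl (w N s : ℕ) (f : ℕ → ℕ) (hs : s ≤ N) (h0 : ∀ i < N, N - s ≤ i → f i = 0) :
    pack w N f * 2 ^ (w * s) = pack w N (fun i => if i < s then 0 else f (i - s)) := by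
  obtain ⟨M, rfl⟩ := Nat.exists_eq_add_of_le hs
  rw [pack_append w s M (fun i => if i < s then 0 else f (i - s))]
  rw [pack_congr (f := fun i => if i < s then 0 else f (i - s)) (N := s) (g := fun _ => 0) (fun i hi => by simp [hi])]
  have h1 : pack w (s + M) f = pack w M f := by
    rw [add_comm s M, pack_append]
    have : pack w s (fun i => f (M + i)) = 0 := by
      unfold pack; apply sum_eq_zero; intro i hi
      show f (M + i) * _ = 0
      rw [h0 _ (by have := mem_range.1 hi; omega) (by omega)]; simp
    simp [this]
  rw [h1]
  have h2 : pack w s (fun _ => 0) = 0 := by simp [pack]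
  rw [h2, zero_add, mul_comm]
  congr 1
  apply pack_congr; intro i _; simp

lemma pack_shr (w N s : ℕ) (f : ℕ → ℕ) (hs : s ≤ N) (h0 : ∀ i < s, f i = 0) :
    pack w N f / 2 ^ (w * s) = pack w N (fun i => if i + s < N then f (i + s) else 0) := by
  obtain ⟨M, rfl⟩ := Nat.exists_eq_add_of_le hs
  rw [pack_append w s M f, pack_congr (f := f) (g := fun _ => 0) (fun i hi => by simp [h0 i hi])]
  have h2 : pack w s (fun _ => 0) = 0 := by simp [pack]
  rw [h2, zero_add, Nat.mul_div_cancel_left _ (by positivity), add_comm s M, pack_append]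
  have : pack w s (fun i => if M + i + s < M + s then f (M + i + s) else 0) = 0 := by
    unfold pack; apply sum_eq_zero; intro i hi; simp
  rw [this, mul_zero, add_zero]
  apply pack_congr; intro i hi
  simp [hi, add_comm]
end Kiss9
namespace Kiss9
open Finset

noncomputable def force {α : Type} (x : ℕ) (k : ℕ → α) : α :=
  Nat.rec (motive := fun _ => α) (k 0) (fun n _ => k (Nat.succ n)) x
lemma force_eq {α : Type} (x : ℕ) (k : ℕ → α) : force x k = k x := by cases x <;> rfl

def stepL (sh X a b : ℕ) : ℕ := Nat.add (Nat.add X (Nat.land X b)) (Nat.shiftLeft (Nat.land X a) sh)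
def stepR (sh X a b : ℕ) : ℕ := Nat.add (Nat.add X (Nat.land X b)) (Nat.shiftRight (Nat.land X a) sh)
lemma stepL_def (sh X a b : ℕ) : stepL sh X a b = (X + (X &&& b)) + ((X &&& a) <<< sh) := rfl
lemma stepR_def (sh X a b : ℕ) : stepR sh X a b = (X + (X &&& b)) + ((X &&& a) >>> sh) := rfl
/-- left masks: `ρ = r-1`, `k` steps remaining -/
def masksL (w s n N : ℕ) : ℕ → ℕ → List (ℕ × ℕ)
  | _, 0 => []
  | r, k+1 => (pmask w s n N r (n-1), pmask w s n N 0 (r+1)) :: masksL w s n N (r+1) k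
def masksR (w s n N : ℕ) : ℕ → ℕ → List (ℕ × ℕ)
  | _, 0 => []
  | r, k+1 => (pmask w s n N 1 (n-r), pmask w s n N (n-1-r) n) :: masksR w s n N (r+1) k
def foldL (sh : ℕ) : List (ℕ × ℕ) → ℕ → ℕ
  | [], X => X
  | (p :: l), X => foldL sh l (stepL sh X p.1 p.2)
def foldR (sh : ℕ) : List (ℕ × ℕ) → ℕ → ℕ
  | [], X => X
  | (p :: l), X => foldR sh l (stepR sh X p.1 p.2)

def flatL (s n r : ℕ) (f : ℕ → ℕ) (i : ℕ) : ℕ :=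
  f i + (if 0 ≤ (i / s) % n ∧ (i / s) % n < r + 1 then f i else 0) +
   (if i < s then 0 else if r ≤ ((i - s) / s) % n ∧ ((i - s) / s) % n < n - 1 then f (i - s) else 0)
def flatR (s n N r : ℕ) (f : ℕ → ℕ) (i : ℕ) : ℕ :=
  f i + (if n - 1 - r ≤ (i / s) % n ∧ (i / s) % n < n then f i else 0) +
   (if i + s < N then if 1 ≤ ((i + s) / s) % n ∧ ((i + s) / s) % n < n - r then f (i + s) else 0 else 0)

lemma top_div {s n H i : ℕ} (hs : 0 < s) (hn : 0 < n) (h1 : i < s*n*H) (h2 : s*n*H - s ≤ i) :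
    (i / s) % n = n - 1 := by
  have hH : 0 < H := by
    rcases Nat.eq_zero_or_pos H with h | h
    · subst h; simp at h1
    · exact h
  obtain ⟨H, rfl⟩ : ∃ H', H = H' + 1 := ⟨H - 1, by omega⟩
  obtain ⟨n, rfl⟩ : ∃ n', n = n' + 1 := ⟨n - 1, by omega⟩
  have : i / s = n + (n+1) * H := by
    have e : s * (n+1) * (H+1) = (n + (n+1)*H) * s + s := by ring
    rw [Nat.div_eq_iff hs]
    omega
  rw [this]; simp

lemma stepL_eq (w s n H r : ℕ) (hw : 0 < w) (hs : 0 < s) (hr : r + 1 < n) (hH : 0 < H)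
    (f : ℕ → ℕ) (hf : ∀ i < s*n*H, f i < 2 ^ w) :
    stepL (w*s) (pack w (s*n*H) f) (pmask w s n (s*n*H) r (n-1)) (pmask w s n (s*n*H) 0 (r+1))
     = pack w (s*n*H) (flatL s n r f) := by
  have hN : s ≤ s*n*H := by
    rw [mul_assoc]; exact Nat.le_mul_of_pos_right _ (Nat.mul_pos (by omega) hH)
  rw [stepL_def, pmask_eq _ _ _ _ _ _ hw hs (by omega) (by omega) (by omega),
    pmask_eq _ _ _ _ _ _ hw hs (by omega) (by omega) (by omega), pack_mask _ _ _ hf,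
    pack_mask _ _ _ hf, Nat.shiftLeft_eq, pack_shl, pack_add, pack_add]
  · rfl
  · exact hN
  · intro i hi h2
    rw [top_div hs (by omega) hi h2]; simp

lemma stepR_eq (w s n H r : ℕ) (hw : 0 < w) (hs : 0 < s) (hr : r + 1 < n) (hH : 0 < H)
    (f : ℕ → ℕ) (hf : ∀ i < s*n*H, f i < 2 ^ w) :
    stepR (w*s) (pack w (s*n*H) f) (pmask w s n (s*n*H) 1 (n-r)) (pmask w s n (s*n*H) (n-1-r) n)
     = pack w (s*n*H) (flatR s n (s*n*H) r f) := by
  have hN : s ≤ s*n*H := by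
    rw [mul_assoc]; exact Nat.le_mul_of_pos_right _ (Nat.mul_pos (by omega) hH)
  rw [stepR_def, pmask_eq _ _ _ _ _ _ hw hs (by omega) (by omega) (by omega),
    pmask_eq _ _ _ _ _ _ hw hs (by omega) (by omega) (by omega), pack_mask _ _ _ hf,
    pack_mask _ _ _ hf, Nat.shiftRight_eq_div_pow, pack_shr, pack_add, pack_add]
  · rfl
  · exact hN
  · intro i hi
    simp [Nat.div_eq_of_lt hi]

def iterL (s n : ℕ) : ℕ → ℕ → (ℕ → ℕ) → (ℕ → ℕ)
  | _, 0, f => f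
  | r, k+1, f => iterL s n (r+1) k (flatL s n r f)
def iterR (s n N : ℕ) : ℕ → ℕ → (ℕ → ℕ) → (ℕ → ℕ)
  | _, 0, f => f
  | r, k+1, f => iterR s n N (r+1) k (flatR s n N r f)

lemma flatL_le (s n r : ℕ) (hs : 0 < s) (hn : 0 < n) (N : ℕ) (f : ℕ → ℕ) (K : ℕ) (hf : ∀ i < N, f i ≤ K) :
    ∀ i < N, flatL s n r f i ≤ 2 * K := by
  intro i hi
  unfold flatL
  have h1 := hf i hi
  by_cases his : i < s
  · simp only [his, if_true]; split <;> omega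
  · have h2 := hf (i - s) (by omega)
    have e : i / s = (i - s) / s + 1 := by
      conv_lhs => rw [show i = (i - s) + s by omega]
      rw [Nat.add_div_right _ hs]
    simp only [his, if_false]
    by_cases h3 : r ≤ ((i - s) / s) % n ∧ ((i - s) / s) % n < n - 1
    · have e2 : (i / s) % n = ((i - s) / s) % n + 1 := by
        rw [e, Nat.add_mod_eq_ite]
        rcases Nat.lt_or_ge 1 n with h | h
        · rw [Nat.mod_eq_of_lt h, if_neg (by omega)]
        · omega
      rw [if_pos h3, if_neg (by omega)]; omega
    · rw [if_neg h3]; split <;> omega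

lemma flatR_le (s n N r : ℕ) (hs : 0 < s) (hn : 0 < n) (f : ℕ → ℕ) (K : ℕ) (hf : ∀ i < N, f i ≤ K) :
    ∀ i < N, flatR s n N r f i ≤ 2 * K := by
  intro i hi
  unfold flatR
  have h1 := hf i hi
  by_cases his : i + s < N
  · have h2 := hf (i + s) his
    simp only [his, if_true]
    have e : (i + s) / s = i / s + 1 := Nat.add_div_right _ hs
    by_cases h3 : 1 ≤ ((i + s) / s) % n ∧ ((i + s) / s) % n < n - r
    · have e2 : ((i + s) / s) % n = (i / s) % n + 1 := by
        rw [e, Nat.add_mod_eq_ite] at h3 ⊢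
        have h4 := Nat.mod_lt (i / s) hn
        rcases Nat.lt_or_ge 1 n with h | h
        · rw [Nat.mod_eq_of_lt h] at h3 ⊢
          split at h3
          · omega
          · rename_i h5; rw [if_neg h5]
        · have : n = 1 := by omega
          subst this; simp at h3; omega
      rw [if_pos h3, if_neg (by omega)]; omega
    · rw [if_neg h3]; split <;> omega
  · simp only [his, if_false]; split <;> omega

lemma foldL_eq (w s n H : ℕ) (hw : 0 < w) (hs : 0 < s) (hH : 0 < H) (k : ℕ) :
    ∀ (r K : ℕ) (f : ℕ → ℕ), r + 1 + k = n → (∀ i < s*n*H, f i ≤ K) → 2 ^ k * K < 2 ^ w →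
    foldL (w*s) (masksL w s n (s*n*H) r k) (pack w (s*n*H) f) = pack w (s*n*H) (iterL s n r k f) ∧
    ∀ i < s*n*H, iterL s n r k f i ≤ 2 ^ k * K := by
  induction k with
  | zero => intro r K f _ hf _; simp [foldL, masksL, iterL]; simpa using hf
  | succ k ih =>
    intro r K f hr hf hK
    have hK' : 2 ^ k * (2 * K) < 2 ^ w := by rw [← mul_assoc, ← pow_succ]; exact hK
    have hK1 : K < 2 ^ w := lt_of_le_of_lt (Nat.le_mul_of_pos_left _ (by positivity)) hK
    have := ih (r+1) (2*K) (flatL s n r f) (by omega)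
      (flatL_le s n r hs (by omega) _ f K hf) hK'
    refine ⟨?_, ?_⟩
    · simp only [masksL, foldL, iterL]
      rw [stepL_eq w s n H r hw hs (by omega) hH f (fun i hi => lt_of_le_of_lt (hf i hi) hK1)]
      exact this.1
    · intro i hi; have := this.2 i hi; rw [← mul_assoc, ← pow_succ] at this; exact this

lemma foldR_eq (w s n H : ℕ) (hw : 0 < w) (hs : 0 < s) (hH : 0 < H) (k : ℕ) :
    ∀ (r K : ℕ) (f : ℕ → ℕ), r + 1 + k = n → (∀ i < s*n*H, f i ≤ K) → 2 ^ k * K < 2 ^ w →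
    foldR (w*s) (masksR w s n (s*n*H) r k) (pack w (s*n*H) f)
      = pack w (s*n*H) (iterR s n (s*n*H) r k f) ∧
    ∀ i < s*n*H, iterR s n (s*n*H) r k f i ≤ 2 ^ k * K := by
  induction k with
  | zero => intro r K f _ hf _; simp [foldR, masksR, iterR]; simpa using hf
  | succ k ih =>
    intro r K f hr hf hK
    have hK' : 2 ^ k * (2 * K) < 2 ^ w := by rw [← mul_assoc, ← pow_succ]; exact hK
    have hK1 : K < 2 ^ w := lt_of_le_of_lt (Nat.le_mul_of_pos_left _ (by positivity)) hK
    have := ih (r+1) (2*K) (flatR s n (s*n*H) r f) (by omega)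
      (flatR_le s n _ r hs (by omega) f K hf) hK'
    refine ⟨?_, ?_⟩
    · simp only [masksR, foldR, iterR]
      rw [stepR_eq w s n H r hw hs (by omega) hH f (fun i hi => lt_of_le_of_lt (hf i hi) hK1)]
      exact this.1
    · intro i hi; have := this.2 i hi; rw [← mul_assoc, ← pow_succ] at this; exact this

def rnd (m low X : ℕ) : ℕ :=
  Nat.shiftRight (Nat.sub (Nat.add X low) (Nat.land (Nat.add X low) low)) m

lemma rnd_def (m low X : ℕ) : rnd m low X = ((X + low) - ((X + low) &&& low)) >>> m := rfl
lemma rnd_eq (w N m K : ℕ) (hw : 0 < w) (f : ℕ → ℕ) (hf : ∀ i < N, f i ≤ 2 ^ m * K)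
    (hK : 2 ^ m * (K + 1) ≤ 2 ^ w) :
    rnd m (Nat.mul (Nat.sub (Nat.pow 2 m) 1) (ones w N)) (pack w N f)
      = pack w N (fun i => (f i + (2 ^ m - 1)) / 2 ^ m) ∧
    ∀ i < N, (f i + (2 ^ m - 1)) / 2 ^ m ≤ K := by
  have h1 : 1 ≤ 2 ^ m := Nat.one_le_two_pow
  constructor
  · have e : Nat.mul (Nat.sub (Nat.pow 2 m) 1) (ones w N) = pack w N (fun _ => 2 ^ m - 1) := by
      rw [ones_eq _ _ hw]
      show (2 ^ m - 1) * _ = _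
      rw [pack_mul]; simp
    rw [rnd_def, e, pack_add, pack_and]
    · simp only [Nat.and_two_pow_sub_one_eq_mod]
      have e2 : pack w N (fun i => f i + (2 ^ m - 1)) =
          2 ^ m * pack w N (fun i => (f i + (2 ^ m - 1)) / 2 ^ m) +
            pack w N (fun i => (f i + (2 ^ m - 1)) % 2 ^ m) := by
        rw [pack_mul, pack_add]
        apply pack_congr; intro i _
        exact (Nat.div_add_mod _ _).symm
      rw [e2, Nat.add_sub_cancel, Nat.shiftRight_eq_div_pow, Nat.mul_div_cancel_left _ (by positivity)]
    · intro i hi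
      have := hf i hi
      rw [mul_add] at hK; omega
    · intro i hi
      have : 2 ^ m ≤ 2 ^ w := le_trans (Nat.le_mul_of_pos_right _ (by omega)) hK
      omega
  · intro i hi
    rw [← Nat.lt_succ_iff, Nat.div_lt_iff_lt_mul (by positivity)]
    have := hf i hi
    rw [Nat.succ_mul, mul_comm K]; omega
end Kiss9
namespace Kiss9
open Finset

lemma idx_div {s n lo c hi : ℕ} (h1 : lo < s) (h2 : c < n) : ((lo + s * (c + n * hi)) / s) % n = c := by
  have hs : 0 < s := by omega
  rw [Nat.add_mul_div_left _ _ hs, Nat.div_eq_of_lt h1, zero_add, Nat.add_mul_mod_self_left,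
    Nat.mod_eq_of_lt h2]

lemma idx_lt {s n H lo c hi : ℕ} (h1 : lo < s) (h2 : c < n) (h3 : hi < H) :
    lo + s * (c + n * hi) < s * n * H := by
  have a : c + n * hi + 1 ≤ n * H := by nlinarith
  have : s * (c + n * hi + 1) ≤ s * (n * H) := Nat.mul_le_mul_left _ a
  rw [mul_assoc]; nlinarith

lemma flatL_idx {s n r lo c hi : ℕ} (f : ℕ → ℕ) (h1 : lo < s) (h2 : c < n) :
    flatL s n r f (lo + s * (c + n * hi)) =
      f (lo + s * (c + n * hi)) + if c < r + 1 then f (lo + s * (c + n * hi))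
        else f (lo + s * (c - 1 + n * hi)) := by
  unfold flatL
  rw [idx_div h1 h2]
  rcases Nat.eq_zero_or_pos c with h0 | h0
  · subst h0
    have hr0 : 0 < r + 1 := by omega
    simp only [le_refl, true_and, hr0, if_true]
    rcases Nat.eq_zero_or_pos hi with h3 | h3
    · subst h3; simp only [mul_zero, add_zero, h1, if_true]
    · obtain ⟨k, rfl⟩ : ∃ k, hi = k + 1 := ⟨hi - 1, by omega⟩
      obtain ⟨m, rfl⟩ : ∃ m, n = m + 1 := ⟨n - 1, by omega⟩
      have e : lo + s * (0 + (m+1) * (k+1)) - s = lo + s * (m + (m+1) * k) := by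
        have : lo + s * (0 + (m+1) * (k+1)) = lo + s * (m + (m+1) * k) + s := by ring
        omega
      rw [e, idx_div h1 (by omega)]
      simp
  · obtain ⟨c, rfl⟩ : ∃ k, c = k + 1 := ⟨c - 1, by omega⟩
    have e0 : lo + s * (c + 1 + n * hi) = lo + s * (c + n * hi) + s := by ring
    have e : lo + s * (c + 1 + n * hi) - s = lo + s * (c + n * hi) := by omega
    rw [e, idx_div h1 (by omega), if_neg (by omega : ¬ lo + s * (c + 1 + n * hi) < s)]
    simp only [Nat.zero_le, true_and, Nat.add_sub_cancel]
    by_cases h3 : c + 1 < r + 1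
    · rw [if_pos h3, if_neg (by omega), if_pos h3]; omega
    · rw [if_neg h3, if_pos (by omega), if_neg h3]; omega

lemma flatR_idx {s n H r lo c hi : ℕ} (f : ℕ → ℕ) (hr : r + 1 < n) (h1 : lo < s) (h2 : c < n) (h3 : hi < H) :
    flatR s n (s*n*H) r f (lo + s * (c + n * hi)) =
      f (lo + s * (c + n * hi)) + if n - 1 - r ≤ c then f (lo + s * (c + n * hi))
        else f (lo + s * (c + 1 + n * hi)) := by
  unfold flatR
  rw [idx_div h1 h2]
  have e0 : lo + s * (c + n * hi) + s = lo + s * (c + 1 + n * hi) := by ring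
  simp only [h2, and_true, e0]
  rcases Nat.lt_or_ge (c+1) n with h4 | h4
  · rw [if_pos (idx_lt h1 h4 h3), idx_div h1 h4]
    by_cases h5 : n - 1 - r ≤ c
    · rw [if_pos h5, if_neg (by omega), if_pos h5]; omega
    · rw [if_neg h5, if_pos (by omega), if_neg h5]; omega
  · have : c + 1 = n := by omega
    have e : c + 1 + n * hi = 0 + n * (hi + 1) := by rw [this]; ring
    have e2 : ((lo + s * (c + 1 + n * hi)) / s) % n = 0 := by
      rw [e]; exact idx_div h1 (by omega)
    have h6 : n - 1 - r ≤ c := by omega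
    simp only [e2, h6, if_true]; simp

open Polynomial in
noncomputable def Lf (m : ℕ) (b : ℕ → ℝ) : ℝ[X] →ₗ[ℝ] ℝ where
  toFun p := ∑ i ∈ range (m+1), p.coeff i * b i
  map_add' p q := by simp [add_mul, sum_add_distrib]
  map_smul' c p := by simp [mul_sum, mul_assoc]

lemma Lf_X (m : ℕ) (b : ℕ → ℝ) (i : ℕ) (hi : i < m + 1) : Lf m b (Polynomial.X ^ i) = b i := by
  simp [Lf, Polynomial.coeff_X_pow, hi]

noncomputable def hh : Polynomial ℝ := Polynomial.C (1/2) * (1 + Polynomial.X)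

lemma hh_two (L : Polynomial ℝ →ₗ[ℝ] ℝ) (p : Polynomial ℝ) :
    L p + L (p * Polynomial.X) = 2 * L (p * hh) := by
  have : p * hh = (1/2 : ℝ) • (p + p * Polynomial.X) := by
    rw [hh, Polynomial.smul_eq_C_mul]; ring
  rw [this, map_smul, map_add, smul_eq_mul]; ring

/-- Bernstein weights -/
noncomputable def Bw (n i : ℕ) (x : ℝ) : ℝ := ((n-1).choose i : ℝ) * x ^ i * (1 - x) ^ (n - 1 - i)

lemma Bw_nonneg (n i : ℕ) {x : ℝ} (h0 : 0 ≤ x) (h1 : x ≤ 1) : 0 ≤ Bw n i x := by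
  unfold Bw; have : 0 ≤ 1 - x := by linarith
  positivity

open Polynomial in
lemma Lf_pow (n : ℕ) (hn : 0 < n) (L : ℝ[X] →ₗ[ℝ] ℝ) (x : ℝ) (p q : ℝ[X]) :
    L ((C (1 - x) * p + C x * q) ^ (n-1)) = ∑ c ∈ range n, Bw n c x * L (p ^ (n-1-c) * q ^ c) := by
  obtain ⟨m, rfl⟩ : ∃ m, n = m + 1 := ⟨n - 1, by omega⟩
  rw [add_comm, add_pow, map_sum]
  apply sum_congr rfl
  intro c hc
  have : (C x * q) ^ c * (C (1 - x) * p) ^ (m + 1 - 1 - c) * ((m + 1 - 1).choose c : ℝ[X])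
    = (Bw (m+1) c x) • (p ^ (m + 1 -1-c) * q ^ c) := by
    rw [smul_eq_C_mul, Bw]
    simp only [mul_pow, map_mul, map_pow, map_natCast]
    ring
  rw [this, map_smul, smul_eq_mul]

lemma iterL_inv (s n H : ℕ) (L : ℕ → ℕ → Polynomial ℝ →ₗ[ℝ] ℝ) (k : ℕ) : ∀ (r : ℕ) (f : ℕ → ℕ),
    r + 1 + k = n →
    (∀ lo < s, ∀ c < n, ∀ hi < H, (f (lo + s * (c + n * hi)) : ℝ) =
      2 ^ r * L lo hi (hh ^ (min c r) * Polynomial.X ^ (c - min c r))) →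
    (∀ lo < s, ∀ c < n, ∀ hi < H, (iterL s n r k f (lo + s * (c + n * hi)) : ℝ) =
      2 ^ (n-1) * L lo hi (hh ^ c)) := by
  induction k with
  | zero =>
    intro r f hr hf lo h1 c h2 hi h3
    have := hf lo h1 c h2 hi h3
    rw [min_eq_left (by omega), Nat.sub_self, pow_zero, mul_one] at this
    rw [show n - 1 = r by omega]
    exact this
  | succ k ih =>
    intro r f hr hf
    apply ih (r+1) _ (by omega)
    intro lo h1 c h2 hi h3
    rw [flatL_idx f h1 h2]
    have e1 := hf lo h1 c h2 hi h3
    by_cases h4 : c < r + 1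
    · rw [if_pos h4]
      rw [min_eq_left (by omega)] at e1 ⊢
      push_cast; rw [e1, pow_succ]; ring
    · rw [if_neg h4]
      have e2 := hf lo h1 (c-1) (by omega) hi h3
      rw [min_eq_right (by omega)] at e1 e2 ⊢
      push_cast; rw [e1, e2]
      have := hh_two (L lo hi) (hh ^ r * Polynomial.X ^ (c - 1 - r))
      have a1 : hh ^ r * Polynomial.X ^ (c - 1 - r) * Polynomial.X = hh ^ r * Polynomial.X ^ (c - r) := by
        rw [mul_assoc, ← pow_succ]; congr 2; omega
      have a2 : hh ^ r * Polynomial.X ^ (c - 1 - r) * hh = hh ^ (r+1) * Polynomial.X ^ (c - (r+1)) := by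
        rw [show c - (r+1) = c - 1 - r by omega]; ring
      rw [a1, a2] at this
      rw [pow_succ (2:ℝ)]; linear_combination (2:ℝ)^r * this

lemma iterR_inv (s n H : ℕ) (L : ℕ → ℕ → Polynomial ℝ →ₗ[ℝ] ℝ) (k : ℕ) : ∀ (r : ℕ) (f : ℕ → ℕ),
    r + 1 + k = n →
    (∀ lo < s, ∀ c < n, ∀ hi < H, (f (lo + s * (c + n * hi)) : ℝ) =
      2 ^ r * L lo hi (Polynomial.X ^ c * hh ^ (min (n-1-c) r))) →
    (∀ lo < s, ∀ c < n, ∀ hi < H, (iterR s n (s*n*H) r k f (lo + s * (c + n * hi)) : ℝ) =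
      2 ^ (n-1) * L lo hi (Polynomial.X ^ c * hh ^ (n-1-c))) := by
  induction k with
  | zero =>
    intro r f hr hf lo h1 c h2 hi h3
    have := hf lo h1 c h2 hi h3
    rw [min_eq_left (by omega)] at this
    conv_rhs => rw [show 2 ^ (n - 1) = (2:ℝ) ^ r by congr 1; omega]
    exact this
  | succ k ih =>
    intro r f hr hf
    apply ih (r+1) _ (by omega)
    intro lo h1 c h2 hi h3
    rw [flatR_idx f (by omega) h1 h2 h3]
    have e1 := hf lo h1 c h2 hi h3
    by_cases h4 : n - 1 - r ≤ c
    · rw [if_pos h4]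
      rw [min_eq_left (by omega)] at e1 ⊢
      push_cast; rw [e1, pow_succ]; ring
    · rw [if_neg h4]
      have e2 := hf lo h1 (c+1) (by omega) hi h3
      rw [min_eq_right (by omega)] at e1 e2 ⊢
      push_cast; rw [e1, e2]
      have := hh_two (L lo hi) (Polynomial.X ^ c * hh ^ r)
      have a1 : Polynomial.X ^ c * hh ^ r * Polynomial.X = Polynomial.X ^ (c+1) * hh ^ r := by ring
      have a2 : Polynomial.X ^ c * hh ^ r * hh = Polynomial.X ^ c * hh ^ (r+1) := by ring
      rw [a1, a2] at this
      rw [pow_succ (2:ℝ)]; linear_combination (2:ℝ)^r * this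

open Polynomial in
lemma axisL (s n H : ℕ) (hn : 0 < n) (f : ℕ → ℕ) (x : ℝ) {lo hi : ℕ} (h1 : lo < s) (h3 : hi < H) :
    ∑ c ∈ range n, Bw n c x * (iterL s n 0 (n-1) f (lo + s * (c + n * hi)) : ℝ)
      = 2 ^ (n-1) * ∑ c ∈ range n, Bw n c (x/2) * (f (lo + s * (c + n * hi)) : ℝ) := by
  set L : ℕ → ℕ → ℝ[X] →ₗ[ℝ] ℝ := fun lo hi => Lf (n-1) (fun c => (f (lo + s * (c + n * hi)) : ℝ)) with hL
  have key := iterL_inv s n H L (n-1) 0 f (by omega) (by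
    intro lo _ c h2 hi _
    simp only [Nat.min_zero, pow_zero, one_mul, Nat.sub_zero]
    exact (Lf_X (n-1) (fun c => (f (lo + s * (c + n * hi)) : ℝ)) c (by omega)).symm)
  have e1 := Lf_pow n hn (L lo hi) x 1 hh
  have e2 := Lf_pow n hn (L lo hi) (x/2) 1 X
  have e3 : C (1 - x) * 1 + C x * hh = C (1 - x/2) * 1 + C (x/2) * (X : ℝ[X]) := by
    have a1 : C (x/2) = C x * C (1/2 : ℝ) := by rw [← C_mul]; congr 1; ring
    have a2 : (2 : ℝ[X]) * C (1/2 : ℝ) = 1 := by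
      rw [show (2 : ℝ[X]) = C 2 from rfl, ← C_mul, ← C_1]; congr 1; norm_num
    rw [hh, C_sub, C_sub, a1, C_1]
    linear_combination (C x) * a2
  rw [e3, e2] at e1
  have e4 : ∑ c ∈ range n, Bw n c (x/2) * (f (lo + s * (c + n * hi)) : ℝ)
      = ∑ c ∈ range n, Bw n c (x/2) * L lo hi (1 ^ (n-1-c) * X ^ c) := by
    apply sum_congr rfl; intro c hc
    rw [one_pow, one_mul, hL, Lf_X _ _ _ (by have := mem_range.1 hc; omega)]
  rw [e4, e1, mul_sum]
  apply sum_congr rfl; intro c hc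
  rw [key lo h1 c (mem_range.1 hc) hi h3, one_pow, one_mul]; ring

open Polynomial in
lemma axisR (s n H : ℕ) (hn : 0 < n) (f : ℕ → ℕ) (x : ℝ) {lo hi : ℕ} (h1 : lo < s) (h3 : hi < H) :
    ∑ c ∈ range n, Bw n c x * (iterR s n (s*n*H) 0 (n-1) f (lo + s * (c + n * hi)) : ℝ)
      = 2 ^ (n-1) * ∑ c ∈ range n, Bw n c ((1+x)/2) * (f (lo + s * (c + n * hi)) : ℝ) := by
  set L : ℕ → ℕ → ℝ[X] →ₗ[ℝ] ℝ := fun lo hi => Lf (n-1) (fun c => (f (lo + s * (c + n * hi)) : ℝ)) with hL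
  have key := iterR_inv s n H L (n-1) 0 f (by omega) (by
    intro lo _ c h2 hi _
    simp only [Nat.min_zero, pow_zero, one_mul, mul_one]
    exact (Lf_X (n-1) (fun c => (f (lo + s * (c + n * hi)) : ℝ)) c (by omega)).symm)
  have e1 := Lf_pow n hn (L lo hi) x hh X
  have e2 := Lf_pow n hn (L lo hi) ((1+x)/2) 1 X
  have e3 : C (1 - x) * hh + C x * (X : ℝ[X]) = C (1 - (1+x)/2) * 1 + C ((1+x)/2) * (X : ℝ[X]) := by
    have a1 : C ((1+x)/2) = (1 + C x) * C (1/2 : ℝ) := by rw [← C_1, ← C_add, ← C_mul]; congr 1; ring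
    have a2 : (2 : ℝ[X]) * C (1/2 : ℝ) = 1 := by
      rw [show (2 : ℝ[X]) = C 2 from rfl, ← C_mul, ← C_1]; congr 1; norm_num
    rw [hh, C_sub, C_sub, a1, C_1]
    linear_combination (1 - C x * X) * a2
  rw [e3, e2] at e1
  have e4 : ∑ c ∈ range n, Bw n c ((1+x)/2) * (f (lo + s * (c + n * hi)) : ℝ)
      = ∑ c ∈ range n, Bw n c ((1+x)/2) * L lo hi (1 ^ (n-1-c) * X ^ c) := by
    apply sum_congr rfl; intro c hc
    rw [one_pow, one_mul, hL, Lf_X _ _ _ (by have := mem_range.1 hc; omega)]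
  rw [e4, e1, mul_sum]
  apply sum_congr rfl; intro c hc
  rw [key lo h1 c (mem_range.1 hc) hi h3, mul_comm (X ^ c)]; ring
end Kiss9
namespace Kiss9
open Finset

noncomputable def ev (n0 n1 n2 : ℕ) (f : ℕ → ℝ) (x y z : ℝ) : ℝ :=
  ∑ k ∈ range n2, ∑ j ∈ range n1, ∑ i ∈ range n0,
    Bw n0 i x * Bw n1 j y * Bw n2 k z * f (i + n0 * (j + n1 * k))

lemma ev_mono {n0 n1 n2 : ℕ} {f g : ℕ → ℝ} {x y z : ℝ} (hx : x ∈ Set.Icc (0:ℝ) 1)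
    (hy : y ∈ Set.Icc (0:ℝ) 1) (hz : z ∈ Set.Icc (0:ℝ) 1)
    (h : ∀ i < n0 * n1 * n2, f i ≤ g i) : ev n0 n1 n2 f x y z ≤ ev n0 n1 n2 g x y z := by
  unfold ev
  refine sum_le_sum fun k hk => sum_le_sum fun j hj => sum_le_sum fun i hi => ?_
  apply mul_le_mul_of_nonneg_left
  · apply h
    have := idx_lt (H := n2) (mem_range.1 hi) (mem_range.1 hj) (mem_range.1 hk)
    exact this
  · exact mul_nonneg (mul_nonneg (Bw_nonneg _ _ hx.1 hx.2) (Bw_nonneg _ _ hy.1 hy.2)) (Bw_nonneg _ _ hz.1 hz.2)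

lemma Bw_sum (n : ℕ) (hn : 0 < n) (x : ℝ) : ∑ i ∈ range n, Bw n i x = 1 := by
  obtain ⟨m, rfl⟩ : ∃ m, n = m + 1 := ⟨n - 1, by omega⟩
  have := add_pow x (1 - x) m
  simp only [add_sub_cancel, one_pow] at this
  rw [this]
  exact sum_congr rfl fun i _ => by simp only [Bw, Nat.add_sub_cancel]; ring

lemma ev_const {n0 n1 n2 : ℕ} (h0 : 0 < n0) (h1 : 0 < n1) (h2 : 0 < n2) (c x y z : ℝ) :
    ev n0 n1 n2 (fun _ => c) x y z = c := by
  unfold ev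
  have : ∀ k j i : ℕ, Bw n0 i x * Bw n1 j y * Bw n2 k z * c = Bw n2 k z * (Bw n1 j y * (Bw n0 i x * c)) := by
    intros; ring
  simp only [this, ← mul_sum, ← sum_mul, Bw_sum _ h0, Bw_sum _ h1, Bw_sum _ h2, one_mul]

lemma ev_div {n0 n1 n2 : ℕ} (f : ℕ → ℝ) (c x y z : ℝ) :
    ev n0 n1 n2 (fun i => f i / c) x y z = ev n0 n1 n2 f x y z / c := by
  unfold ev
  simp only [sum_div, mul_div_assoc]

/-- axis 0 -/
lemma ev_axis0 {n0 n1 n2 : ℕ} (f g : ℕ → ℝ) (x x' y z c : ℝ)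
    (h : ∀ hi < n1 * n2, ∑ i ∈ range n0, Bw n0 i x * g (0 + 1 * (i + n0 * hi)) =
      c * ∑ i ∈ range n0, Bw n0 i x' * f (0 + 1 * (i + n0 * hi))) :
    ev n0 n1 n2 g x y z = c * ev n0 n1 n2 f x' y z := by
  unfold ev
  rw [mul_sum]; refine sum_congr rfl fun k hk => ?_
  rw [mul_sum]; refine sum_congr rfl fun j hj => ?_
  have hj' := mem_range.1 hj
  have hk' := mem_range.1 hk
  have := h (j + n1 * k) (by nlinarith)
  simp only [zero_add, one_mul] at this
  have e : ∀ (x : ℝ) (f : ℕ → ℝ), ∑ i ∈ range n0, Bw n0 i x * Bw n1 j y * Bw n2 k z * f (i + n0 * (j + n1 * k))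
    = Bw n1 j y * Bw n2 k z * ∑ i ∈ range n0, Bw n0 i x * f (i + n0 * (j + n1 * k)) := by
    intro x f; rw [mul_sum]; exact sum_congr rfl fun i _ => by ring
  rw [e, e, this]; ring

lemma ev_axis1 {n0 n1 n2 : ℕ} (f g : ℕ → ℝ) (x y y' z c : ℝ)
    (h : ∀ lo < n0, ∀ hi < n2, ∑ j ∈ range n1, Bw n1 j y * g (lo + n0 * (j + n1 * hi)) =
      c * ∑ j ∈ range n1, Bw n1 j y' * f (lo + n0 * (j + n1 * hi))) :
    ev n0 n1 n2 g x y z = c * ev n0 n1 n2 f x y' z := by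
  unfold ev
  rw [mul_sum]; refine sum_congr rfl fun k hk => ?_
  rw [sum_comm, sum_comm (s := range n1), mul_sum]
  refine sum_congr rfl fun i hi => ?_
  have := h i (mem_range.1 hi) k (mem_range.1 hk)
  have e : ∀ (y : ℝ) (f : ℕ → ℝ), ∑ j ∈ range n1, Bw n0 i x * Bw n1 j y * Bw n2 k z * f (i + n0 * (j + n1 * k))
    = Bw n0 i x * Bw n2 k z * ∑ j ∈ range n1, Bw n1 j y * f (i + n0 * (j + n1 * k)) := by
    intro x f; rw [mul_sum]; exact sum_congr rfl fun i _ => by ring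
  rw [e, e, this]; ring

lemma ev_axis2 {n0 n1 n2 : ℕ} (f g : ℕ → ℝ) (x y z z' c : ℝ)
    (h : ∀ lo < n0 * n1, ∑ k ∈ range n2, Bw n2 k z * g (lo + n0 * n1 * (k + n2 * 0)) =
      c * ∑ k ∈ range n2, Bw n2 k z' * f (lo + n0 * n1 * (k + n2 * 0))) :
    ev n0 n1 n2 g x y z = c * ev n0 n1 n2 f x y z' := by
  unfold ev
  rw [sum_comm, sum_comm (s := range n2), mul_sum]
  refine sum_congr rfl fun j hj => ?_
  rw [sum_comm, sum_comm (s := range n2), mul_sum]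
  refine sum_congr rfl fun i hi => ?_
  have hj' := mem_range.1 hj
  have hi' := mem_range.1 hi
  have := h (i + n0 * j) (by nlinarith)
  have e0 : ∀ k, i + n0 * j + n0 * n1 * (k + n2 * 0) = i + n0 * (j + n1 * k) := by intro k; ring
  simp only [e0] at this
  have e : ∀ (z : ℝ) (f : ℕ → ℝ), ∑ k ∈ range n2, Bw n0 i x * Bw n1 j y * Bw n2 k z * f (i + n0 * (j + n1 * k))
    = Bw n0 i x * Bw n1 j y * ∑ k ∈ range n2, Bw n2 k z * f (i + n0 * (j + n1 * k)) := by
    intro x f; rw [mul_sum]; exact sum_congr rfl fun i _ => by ring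
  rw [e, e, this]; ring

/-- `X` represents an upper bound for `P` on the unit cube -/
def Rep (w kk n0 n1 n2 : ℕ) (P : ℝ → ℝ → ℝ → ℝ) (X : ℕ) : Prop :=
  ∃ f : ℕ → ℕ, X = pack w (n0 * n1 * n2) f ∧ (∀ i < n0 * n1 * n2, f i ≤ 2 ^ (kk+1) - 1) ∧
    ∀ x ∈ Set.Icc (0:ℝ) 1, ∀ y ∈ Set.Icc (0:ℝ) 1, ∀ z ∈ Set.Icc (0:ℝ) 1,
      P x y z + 2 ^ kk ≤ ev n0 n1 n2 (fun i => (f i : ℝ)) x y z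

lemma leaf_sound {w kk n0 n1 n2 : ℕ} (hw : kk < w) (h0 : 0 < n0) (h1 : 0 < n1) (h2 : 0 < n2)
    {P : ℝ → ℝ → ℝ → ℝ} {X : ℕ} (h : Rep w kk n0 n1 n2 P X)
    (hX : Nat.land X (Nat.mul (Nat.pow 2 kk) (ones w (n0*n1*n2))) = 0) :
    ∀ x ∈ Set.Icc (0:ℝ) 1, ∀ y ∈ Set.Icc (0:ℝ) 1, ∀ z ∈ Set.Icc (0:ℝ) 1, P x y z ≤ -1 := by
  obtain ⟨f, rfl, hf, hP⟩ := h
  have e : Nat.mul (Nat.pow 2 kk) (ones w (n0*n1*n2)) = pack w (n0*n1*n2) (fun _ => 2 ^ kk) := by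
    rw [ones_eq _ _ (by omega)]
    show (2 ^ kk) * _ = _
    rw [pack_mul]; simp
  have hk : 2 ^ (kk+1) ≤ 2 ^ w := Nat.pow_le_pow_right (by norm_num) hw
  have hp : 0 < 2 ^ (kk+1) := by positivity
  have hX' : pack w (n0*n1*n2) f &&& pack w (n0*n1*n2) (fun _ => 2 ^ kk) = 0 := by rw [← e]; exact hX
  rw [pack_and _ _ _ _ (fun i hi => by have := hf i hi; omega)
    (fun i _ => Nat.pow_lt_pow_right (by norm_num) hw)] at hX'
  have h3 := pack_eq_zero hX'
  have h4 : ∀ i < n0*n1*n2, f i + 1 ≤ 2 ^ kk := by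
    intro i hi
    have a := h3 i hi
    have b := hf i hi
    simp only [Nat.and_two_pow] at a
    rcases Nat.lt_or_ge (f i) (2 ^ kk) with h5 | h5
    · exact h5
    · exfalso
      have : (f i).testBit kk = true := by
        rw [Nat.testBit_eq_decide_div_mod_eq]
        have : f i / 2 ^ kk = 1 := by
          rw [Nat.div_eq_iff (by positivity)]
          rw [pow_succ] at b hp; omega
        simp [this]
      rw [this] at a; simp at a
  intro x hx y hy z hz
  have := hP x hx y hy z hz
  have h5 : ev n0 n1 n2 (fun i => (f i : ℝ)) x y z ≤ ev n0 n1 n2 (fun _ => (2:ℝ) ^ kk - 1) x y z :=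
    ev_mono hx hy hz fun i hi => by
      have : ((f i + 1 : ℕ) : ℝ) ≤ ((2 ^ kk : ℕ) : ℝ) := by exact_mod_cast h4 i hi
      push_cast at this; linarith
  rw [ev_const h0 h1 h2] at h5
  linarith

structure Ax where
  sh : ℕ
  m : ℕ
  low : ℕ
  L : List (ℕ × ℕ)
  R : List (ℕ × ℕ)

def axOf (w s n N : ℕ) : Ax :=
  ⟨w * s, n - 1, Nat.mul (Nat.sub (Nat.pow 2 (n-1)) 1) (ones w N), masksL w s n N 0 (n-1), masksR w s n N 0 (n-1)⟩

def doL (A : Ax) (X : ℕ) : ℕ := rnd A.m A.low (foldL A.sh A.L X)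
def doR (A : Ax) (X : ℕ) : ℕ := rnd A.m A.low (foldR A.sh A.R X)

lemma round_up {m a : ℕ} : (a : ℝ) / 2 ^ m ≤ (((a + (2 ^ m - 1)) / 2 ^ m : ℕ) : ℝ) := by
  rw [div_le_iff₀ (by positivity)]
  have h := Nat.div_add_mod (a + (2 ^ m - 1)) (2 ^ m)
  have h2 := Nat.mod_lt (a + (2 ^ m - 1)) (show 0 < 2 ^ m by positivity)
  have : a ≤ (a + (2 ^ m - 1)) / 2 ^ m * 2 ^ m := by rw [mul_comm]; omega
  exact_mod_cast this

/-- generic half step -/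
lemma half_sound {w kk n0 n1 n2 s n H : ℕ} (hN : s * n * H = n0 * n1 * n2) (hs : 0 < s) (hn : 0 < n) (hH : 0 < H)
    (hw : n + kk ≤ w) {P P' : ℝ → ℝ → ℝ → ℝ} {X : ℕ} (h : Rep w kk n0 n1 n2 P X) (b : Bool)
    (hc : ∀ f : ℕ → ℕ, ∀ x ∈ Set.Icc (0:ℝ) 1, ∀ y ∈ Set.Icc (0:ℝ) 1, ∀ z ∈ Set.Icc (0:ℝ) 1,
      ∃ x' ∈ Set.Icc (0:ℝ) 1, ∃ y' ∈ Set.Icc (0:ℝ) 1, ∃ z' ∈ Set.Icc (0:ℝ) 1, P' x y z = P x' y' z' ∧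
      ev n0 n1 n2 (fun i => ((cond b (iterR s n (s*n*H) 0 (n-1) f) (iterL s n 0 (n-1) f)) i : ℝ)) x y z
       = 2 ^ (n-1) * ev n0 n1 n2 (fun i => (f i : ℝ)) x' y' z') :
    Rep w kk n0 n1 n2 P' (cond b (doR (axOf w s n (n0*n1*n2)) X) (doL (axOf w s n (n0*n1*n2)) X)) := by
  obtain ⟨f, rfl, hf, hP⟩ := h
  have hp : 1 ≤ 2 ^ (kk+1) := Nat.one_le_two_pow
  have hK : 2 ^ (n-1) * (2 ^ (kk+1) - 1 + 1) ≤ 2 ^ w := by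
    rw [Nat.sub_add_cancel hp, ← pow_add]
    exact Nat.pow_le_pow_right (by norm_num) (by omega)
  have hK1 : 2 ^ (n-1) * (2 ^ (kk+1) - 1) < 2 ^ w := by
    refine lt_of_lt_of_le ?_ hK
    exact Nat.mul_lt_mul_of_pos_left (by omega) (by positivity)
  rw [← hN] at hf ⊢
  set g := cond b (iterR s n (s*n*H) 0 (n-1) f) (iterL s n 0 (n-1) f) with hg
  have key : (cond b (doR (axOf w s n (s*n*H)) (pack w (s*n*H) f)) (doL (axOf w s n (s*n*H)) (pack w (s*n*H) f)))
      = rnd (n-1) (Nat.mul (Nat.sub (Nat.pow 2 (n-1)) 1) (ones w (s*n*H))) (pack w (s*n*H) g) ∧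
      ∀ i < s*n*H, g i ≤ 2 ^ (n-1) * (2 ^ (kk+1) - 1) := by
    cases b
    · have := foldL_eq w s n H (by omega) hs hH (n-1) 0 (2 ^ (kk+1) - 1) f (by omega) hf hK1
      refine ⟨?_, this.2⟩
      simp only [cond_false, doL, axOf, this.1, hg]
    · have := foldR_eq w s n H (by omega) hs hH (n-1) 0 (2 ^ (kk+1) - 1) f (by omega) hf hK1
      refine ⟨?_, this.2⟩
      simp only [cond_true, doR, axOf, this.1, hg]
  have r := rnd_eq w (s*n*H) (n-1) (2 ^ (kk+1) - 1) (by omega) g key.2 hK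
  refine ⟨fun i => (g i + (2 ^ (n-1) - 1)) / 2 ^ (n-1), ?_, ?_, ?_⟩
  · rw [key.1, r.1, hN]
  · rw [← hN]; exact r.2
  · intro x hx y hy z hz
    obtain ⟨x', hx', y', hy', z', hz', e1, e2⟩ := hc f x hx y hy z hz
    have h1 := hP x' hx' y' hy' z' hz'
    have h2 : ev n0 n1 n2 (fun i => (g i : ℝ) / 2 ^ (n-1)) x y z ≤
       ev n0 n1 n2 (fun i => (((g i + (2 ^ (n-1) - 1)) / 2 ^ (n-1) : ℕ) : ℝ)) x y z :=
      ev_mono hx hy hz fun i _ => round_up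
    rw [ev_div, e2, mul_div_cancel_left₀ _ (by positivity)] at h2
    rw [e1]; linarith

lemma half_mem {x : ℝ} (hx : x ∈ Set.Icc (0:ℝ) 1) (b : Bool) :
    (cond b ((1+x)/2) (x/2)) ∈ Set.Icc (0:ℝ) 1 := by
  cases b <;> simp only [cond_true, cond_false] <;> constructor <;> linarith [hx.1, hx.2]

variable {w kk n0 n1 n2 : ℕ}
lemma half0 (h0 : 0 < n0) (h1 : 0 < n1) (h2 : 0 < n2)
    (hw : n0 + kk ≤ w) {P : ℝ → ℝ → ℝ → ℝ} {X : ℕ} (h : Rep w kk n0 n1 n2 P X) (b : Bool) :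
    Rep w kk n0 n1 n2 (fun x y z => P (cond b ((1+x)/2) (x/2)) y z)
      (cond b (doR (axOf w 1 n0 (n0*n1*n2)) X) (doL (axOf w 1 n0 (n0*n1*n2)) X)) := by
  refine half_sound (s := 1) (n := n0) (H := n1*n2) (by ring) (by norm_num) h0 (by positivity) hw h b ?_
  intro f x hx y hy z hz
  refine ⟨_, half_mem hx b, y, hy, z, hz, rfl, ?_⟩
  apply ev_axis0
  intro hi hhi
  cases b
  · exact axisL 1 n0 (n1*n2) h0 f x (by norm_num) hhi
  · exact axisR 1 n0 (n1*n2) h0 f x (by norm_num) hhi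

lemma half1 (h0 : 0 < n0) (h1 : 0 < n1) (h2 : 0 < n2)
    (hw : n1 + kk ≤ w) {P : ℝ → ℝ → ℝ → ℝ} {X : ℕ} (h : Rep w kk n0 n1 n2 P X) (b : Bool) :
    Rep w kk n0 n1 n2 (fun x y z => P x (cond b ((1+y)/2) (y/2)) z)
      (cond b (doR (axOf w n0 n1 (n0*n1*n2)) X) (doL (axOf w n0 n1 (n0*n1*n2)) X)) := by
  refine half_sound (s := n0) (n := n1) (H := n2) rfl h0 h1 h2 hw h b ?_
  intro f x hx y hy z hz
  refine ⟨x, hx, _, half_mem hy b, z, hz, rfl, ?_⟩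
  apply ev_axis1
  intro lo hlo hi hhi
  cases b
  · exact axisL n0 n1 n2 h1 f y hlo hhi
  · exact axisR n0 n1 n2 h1 f y hlo hhi

lemma half2 (h0 : 0 < n0) (h1 : 0 < n1) (h2 : 0 < n2)
    (hw : n2 + kk ≤ w) {P : ℝ → ℝ → ℝ → ℝ} {X : ℕ} (h : Rep w kk n0 n1 n2 P X) (b : Bool) :
    Rep w kk n0 n1 n2 (fun x y z => P x y (cond b ((1+z)/2) (z/2)))
      (cond b (doR (axOf w (n0*n1) n2 (n0*n1*n2)) X) (doL (axOf w (n0*n1) n2 (n0*n1*n2)) X)) := by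
  refine half_sound (s := n0*n1) (n := n2) (H := 1) (by ring) (by positivity) h2 (by norm_num) hw h b ?_
  intro f x hx y hy z hz
  refine ⟨x, hx, y, hy, _, half_mem hz b, rfl, ?_⟩
  apply ev_axis2
  intro lo hlo
  cases b
  · exact axisL (n0*n1) n2 1 h2 f z hlo (by norm_num)
  · exact axisR (n0*n1) n2 1 h2 f z hlo (by norm_num)
end Kiss9

namespace Kiss9
open Finset

noncomputable def bldL (w s n N : ℕ) (k : ℕ) : ℕ → (List (ℕ × ℕ) → Bool) → Bool :=
  Nat.rec (motive := fun _ => ℕ → (List (ℕ × ℕ) → Bool) → Bool) (fun _ c => c [])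
   (fun _ ih r c => force r fun r => force (pmask w s n N r (n-1)) fun a => force (pmask w s n N 0 (r+1)) fun b =>
      ih (r+1) fun l => c ((a, b) :: l)) k
noncomputable def bldR (w s n N : ℕ) (k : ℕ) : ℕ → (List (ℕ × ℕ) → Bool) → Bool :=
  Nat.rec (motive := fun _ => ℕ → (List (ℕ × ℕ) → Bool) → Bool) (fun _ c => c [])
   (fun _ ih r c => force r fun r => force (pmask w s n N 1 (n-r)) fun a => force (pmask w s n N (n-1-r) n) fun b =>
      ih (r+1) fun l => c ((a, b) :: l)) k
lemma bldL_eq (w s n N k : ℕ) : ∀ r c, bldL w s n N k r c = c (masksL w s n N r k) := by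
  induction k with
  | zero => intro r c; rfl
  | succ k ih =>
    intro r c
    show (force r fun r => force (pmask w s n N r (n-1)) fun a => force (pmask w s n N 0 (r+1)) fun b =>
      bldL w s n N k (r+1) fun l => c ((a, b) :: l)) = _
    simp only [force_eq, ih]; rfl
lemma bldR_eq (w s n N k : ℕ) : ∀ r c, bldR w s n N k r c = c (masksR w s n N r k) := by
  induction k with
  | zero => intro r c; rfl
  | succ k ih =>
    intro r c
    show (force r fun r => force (pmask w s n N 1 (n-r)) fun a => force (pmask w s n N (n-1-r) n) fun b =>
      bldR w s n N k (r+1) fun l => c ((a, b) :: l)) = _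
    simp only [force_eq, ih]; rfl

noncomputable def withAx (w s n N : ℕ) (c : Ax → Bool) : Bool :=
  force (w * s) fun sh => force (n - 1) fun m =>
  force (Nat.mul (Nat.sub (Nat.pow 2 m) 1) (ones w N)) fun low =>
  bldL w s n N m 0 fun l => bldR w s n N m 0 fun r => c ⟨sh, m, low, l, r⟩
lemma withAx_eq (w s n N : ℕ) (c : Ax → Bool) : withAx w s n N c = c (axOf w s n N) := by
  simp only [withAx, force_eq, bldL_eq, bldR_eq]; rfl

noncomputable def runL (sh : ℕ) (l : List (ℕ × ℕ)) : ℕ → (ℕ → Bool) → Bool :=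
  List.rec (motive := fun _ => ℕ → (ℕ → Bool) → Bool) (fun X c => c X)
    (fun p _ ih X c => force (stepL sh X p.1 p.2) fun Y => ih Y c) l
noncomputable def runR (sh : ℕ) (l : List (ℕ × ℕ)) : ℕ → (ℕ → Bool) → Bool :=
  List.rec (motive := fun _ => ℕ → (ℕ → Bool) → Bool) (fun X c => c X)
    (fun p _ ih X c => force (stepR sh X p.1 p.2) fun Y => ih Y c) l
lemma runL_eq (sh : ℕ) (l : List (ℕ × ℕ)) : ∀ X c, runL sh l X c = c (foldL sh l X) := by
  induction l with
  | nil => intro X c; rfl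
  | cons p l ih =>
    intro X c
    show (force (stepL sh X p.1 p.2) fun Y => runL sh l Y c) = _
    rw [force_eq, ih]; rfl
lemma runR_eq (sh : ℕ) (l : List (ℕ × ℕ)) : ∀ X c, runR sh l X c = c (foldR sh l X) := by
  induction l with
  | nil => intro X c; rfl
  | cons p l ih =>
    intro X c
    show (force (stepR sh X p.1 p.2) fun Y => runR sh l Y c) = _
    rw [force_eq, ih]; rfl
noncomputable def doH (A : Ax) (b : Bool) (X : ℕ) (c : ℕ → Bool) : Bool :=
  cond b (runR A.sh A.R X fun Y => force (rnd A.m A.low Y) c) (runL A.sh A.L X fun Y => force (rnd A.m A.low Y) c)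
lemma doH_eq (A : Ax) (b : Bool) (X : ℕ) (c : ℕ → Bool) : doH A b X c = c (cond b (doR A X) (doL A X)) := by
  cases b <;> simp only [doH, cond_true, cond_false, runL_eq, runR_eq, force_eq] <;> rfl

structure Bx where
  a0 : ℕ
  h0 : ℕ
  a1 : ℕ
  h1 : ℕ
  a2 : ℕ
  h2 : ℕ
noncomputable def forceB (B : Bx) (c : Bx → Bool) : Bool :=
  force B.a0 fun a0 => force B.h0 fun h0 => force B.a1 fun a1 => force B.h1 fun h1 =>
  force B.a2 fun a2 => force B.h2 fun h2 => c ⟨a0, h0, a1, h1, a2, h2⟩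
lemma forceB_eq (B : Bx) (c : Bx → Bool) : forceB B c = c B := by simp only [forceB, force_eq]

def pick {α : Type} (B : Bx) (x y z : α) : α :=
  cond (cond (Nat.ble B.h1 B.h0) (Nat.ble B.h2 B.h0) false) x (cond (Nat.ble B.h2 B.h1) y z)
lemma pick_cases {α : Type} (B : Bx) : (∀ x y z : α, pick B x y z = x) ∨ (∀ x y z : α, pick B x y z = y) ∨
    (∀ x y z : α, pick B x y z = z) := by
  unfold pick
  cases (cond (Nat.ble B.h1 B.h0) (Nat.ble B.h2 B.h0) false) <;> cases (Nat.ble B.h2 B.h1) <;> simp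
def hf (b : Bool) (a h : ℕ) : ℕ := cond b (Nat.add a (Nat.div h 2)) a
def child (b : Bool) (B : Bx) : Bx :=
  cond (cond (Nat.ble B.h1 B.h0) (Nat.ble B.h2 B.h0) false)
    ⟨hf b B.a0 B.h0, Nat.div B.h0 2, B.a1, B.h1, B.a2, B.h2⟩
    (cond (Nat.ble B.h2 B.h1)
    ⟨B.a0, B.h0, hf b B.a1 B.h1, Nat.div B.h1 2, B.a2, B.h2⟩
    ⟨B.a0, B.h0, B.a1, B.h1, hf b B.a2 B.h2, Nat.div B.h2 2⟩)
def evenB (h : ℕ) : Bool := Nat.beq (Nat.mul 2 (Nat.div h 2)) h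
def evOk (B : Bx) : Bool := cond (cond (Nat.ble B.h1 B.h0) (Nat.ble B.h2 B.h0) false) (evenB B.h0)
   (cond (Nat.ble B.h2 B.h1) (evenB B.h1) (evenB B.h2))
def selAx (B : Bx) (A0 A1 A2 : Ax) : Ax := cond (cond (Nat.ble B.h1 B.h0) (Nat.ble B.h2 B.h0) false) A0
   (cond (Nat.ble B.h2 B.h1) A1 A2)
def skipB (B : Bx) : Bool := cond (Nat.ble (Nat.add B.a1 B.h1) B.a0) true (Nat.ble (Nat.add B.a2 B.h2) B.a1)

def Good (Q : ℝ → ℝ → ℝ → ℝ) (wd : Bool) (B : Bx) : Prop :=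
  ∀ x ∈ Set.Icc (0:ℝ) 1, ∀ y ∈ Set.Icc (0:ℝ) 1, ∀ z ∈ Set.Icc (0:ℝ) 1,
    (wd = true → (B.a0 + B.h0 * x : ℝ) < B.a1 + B.h1 * y ∧ (B.a1 + B.h1 * y : ℝ) < B.a2 + B.h2 * z) →
    Q (B.a0 + B.h0 * x) (B.a1 + B.h1 * y) (B.a2 + B.h2 * z) < 0
def PB (Q : ℝ → ℝ → ℝ → ℝ) (B : Bx) : ℝ → ℝ → ℝ → ℝ := fun x y z =>
    Q (B.a0 + B.h0 * x) (B.a1 + B.h1 * y) (B.a2 + B.h2 * z)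

lemma evenB_eq {h : ℕ} (e : evenB h = true) : (h : ℝ) = 2 * (Nat.div h 2 : ℕ) := by
  have : 2 * (Nat.div h 2) = h := Nat.eq_of_beq_eq_true e
  exact_mod_cast this.symm
lemma hf_eq {h : ℕ} (e : evenB h = true) (b : Bool) (a : ℕ) (x : ℝ) :
    ((hf b a h : ℕ) : ℝ) + (Nat.div h 2 : ℕ) * x = a + h * (cond b ((1+x)/2) (x/2)) := by
  rw [evenB_eq e]
  have e2 : ∀ p q : ℕ, Nat.add p q = p + q := fun _ _ => rfl
  cases b <;> simp only [hf, cond_true, cond_false, e2] <;> push_cast <;> ring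

lemma comb (Q : ℝ → ℝ → ℝ → ℝ) (wd : Bool) (B : Bx) (he : evOk B = true)
    (h : ∀ b, Good Q wd (child b B)) : Good Q wd B := by
  have key : ∀ x ∈ Set.Icc (0:ℝ) 1, ∃ b : Bool, ∃ x' ∈ Set.Icc (0:ℝ) 1, x = cond b ((1+x')/2) (x'/2) := by
    intro x hx
    rcases le_total x (1/2) with h | h
    · exact ⟨false, 2*x, ⟨by linarith [hx.1], by linarith⟩, by simp only [cond_false]; ring⟩
    · exact ⟨true, 2*x-1, ⟨by linarith, by linarith [hx.2]⟩, by simp only [cond_true]; ring⟩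
  unfold Good at h ⊢
  unfold child at h
  unfold evOk at he
  intro x hx y hy z hz hwd
  cases h1 : (cond (Nat.ble B.h1 B.h0) (Nat.ble B.h2 B.h0) false) <;> simp only [h1, cond_true, cond_false] at h he
  · cases h2 : (Nat.ble B.h2 B.h1) <;> simp only [h2, cond_true, cond_false] at h he
    · obtain ⟨b, z', hz', rfl⟩ := key z hz
      have := h b x hx y hy z' hz'
      simp only [hf_eq he] at this
      exact this hwd
    · obtain ⟨b, z', hz', rfl⟩ := key y hy
      have := h b x hx z' hz' z hz
      simp only [hf_eq he] at this
      exact this hwd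
  · obtain ⟨b, z', hz', rfl⟩ := key x hx
    have := h b z' hz' y hy z hz
    simp only [hf_eq he] at this
    exact this hwd

structure Ctx where
  wd : Bool
  top : ℕ
  A0 : Ax
  A1 : Ax
  A2 : Ax
noncomputable def go (C : Ctx) (fuel : ℕ) : ℕ → Bx → Bool :=
  Nat.rec (motive := fun _ => ℕ → Bx → Bool) (fun _ _ => false)
   (fun _ ih X B => cond (cond C.wd (skipB B) false) true
     (cond (Nat.beq (Nat.land X C.top) 0) true
      (cond (evOk B)
        (doH (selAx B C.A0 C.A1 C.A2) false X fun Y => forceB (child false B) fun B0 =>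
          cond (ih Y B0)
           (doH (selAx B C.A0 C.A1 C.A2) true X fun Y => forceB (child true B) fun B1 => ih Y B1) false) false))) fuel
lemma go_succ (C : Ctx) (k X : ℕ) (B : Bx) : go C (k+1) X B = cond (cond C.wd (skipB B) false) true
     (cond (Nat.beq (Nat.land X C.top) 0) true
      (cond (evOk B)
        (doH (selAx B C.A0 C.A1 C.A2) false X fun Y => forceB (child false B) fun B0 =>
          cond (go C k Y B0)
           (doH (selAx B C.A0 C.A1 C.A2) true X fun Y => forceB (child true B) fun B1 => go C k Y B1) false) false)) := rfl

def ctxOf (w kk n0 n1 n2 : ℕ) (wd : Bool) : Ctx :=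
  ⟨wd, Nat.mul (Nat.pow 2 kk) (ones w (n0*n1*n2)), axOf w 1 n0 (n0*n1*n2), axOf w n0 n1 (n0*n1*n2), axOf w (n0*n1) n2 (n0*n1*n2)⟩

lemma child_rep {w kk n0 n1 n2 : ℕ} (h0 : 0 < n0) (h1 : 0 < n1) (h2 : 0 < n2)
    (w0 : n0 + kk ≤ w) (w1 : n1 + kk ≤ w) (w2 : n2 + kk ≤ w) (Q : ℝ → ℝ → ℝ → ℝ) (wd : Bool) (B : Bx)
    (he : evOk B = true) (X : ℕ) (b : Bool)
    (hR : Rep w kk n0 n1 n2 (PB Q B) X) :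
    Rep w kk n0 n1 n2 (PB Q (child b B))
     (cond b (doR (selAx B (ctxOf w kk n0 n1 n2 wd).A0 (ctxOf w kk n0 n1 n2 wd).A1 (ctxOf w kk n0 n1 n2 wd).A2) X)
      (doL (selAx B (ctxOf w kk n0 n1 n2 wd).A0 (ctxOf w kk n0 n1 n2 wd).A1 (ctxOf w kk n0 n1 n2 wd).A2) X)) := by
  unfold evOk at he
  unfold child selAx
  cases g1 : (cond (Nat.ble B.h1 B.h0) (Nat.ble B.h2 B.h0) false) <;> simp only [g1, cond_true, cond_false] at he ⊢
  · cases g2 : (Nat.ble B.h2 B.h1) <;> simp only [g2, cond_true, cond_false] at he ⊢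
    · have := half2 h0 h1 h2 w2 hR b
      unfold PB at this ⊢
      simp only [hf_eq he]
      exact this
    · have := half1 h0 h1 h2 w1 hR b
      unfold PB at this ⊢
      simp only [hf_eq he]
      exact this
  · have := half0 h0 h1 h2 w0 hR b
    unfold PB at this ⊢
    simp only [hf_eq he]
    exact this

lemma go_sound {w kk n0 n1 n2 : ℕ} (h0 : 0 < n0) (h1 : 0 < n1) (h2 : 0 < n2)
    (w0 : n0 + kk ≤ w) (w1 : n1 + kk ≤ w) (w2 : n2 + kk ≤ w) (Q : ℝ → ℝ → ℝ → ℝ) (wd : Bool) (c : ℝ) (hc : c < 1) (fuel : ℕ) :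
    ∀ (X : ℕ) (B : Bx), Rep w kk n0 n1 n2 (PB Q B) X → go (ctxOf w kk n0 n1 n2 wd) fuel X B = true →
      Good (fun x y z => Q x y z + c) wd B := by
  induction fuel with
  | zero => intro X B _ h; exact absurd h (by simp [go])
  | succ k ih =>
    intro X B hR h
    rw [go_succ] at h
    cases g1 : (cond (ctxOf w kk n0 n1 n2 wd).wd (skipB B) false) <;> rw [g1] at h
    · rw [cond_false] at h
      cases g2 : (Nat.beq (Nat.land X (ctxOf w kk n0 n1 n2 wd).top) 0) <;> rw [g2] at h
      · rw [cond_false] at h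
        cases g3 : evOk B <;> rw [g3] at h
        · simp at h
        · rw [cond_true] at h
          simp only [doH_eq, forceB_eq] at h
          have c0 := child_rep h0 h1 h2 w0 w1 w2 Q wd B g3 X false hR
          have c1 := child_rep h0 h1 h2 w0 w1 w2 Q wd B g3 X true hR
          cases g4 : (go (ctxOf w kk n0 n1 n2 wd) k
            (cond false (doR (selAx B (ctxOf w kk n0 n1 n2 wd).A0 (ctxOf w kk n0 n1 n2 wd).A1 (ctxOf w kk n0 n1 n2 wd).A2) X)
      (doL (selAx B (ctxOf w kk n0 n1 n2 wd).A0 (ctxOf w kk n0 n1 n2 wd).A1 (ctxOf w kk n0 n1 n2 wd).A2) X)) (child false B)) <;> rw [g4] at h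
          · simp at h
          · rw [cond_true] at h
            exact comb _ wd B g3 fun b => by
              cases b
              · exact ih _ _ c0 g4
              · exact ih _ _ c1 h
      · intro x hx y hy z hz _
        have := leaf_sound (by omega) h0 h1 h2 hR (Nat.eq_of_beq_eq_true g2) x hx y hy z hz
        unfold PB at this
        show _ + c < 0
        linarith
    · intro x hx y hy z hz hwd
      exfalso
      change (cond wd (skipB B) false) = true at g1
      cases wd
      · simp at g1
      · simp only [cond_true, skipB] at g1
        obtain ⟨k1, k2⟩ := hwd rfl
        have e2 : ∀ p q : ℕ, Nat.add p q = p + q := fun _ _ => rfl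
        have p0 : (0:ℝ) ≤ B.h0 * x := mul_nonneg (by positivity) hx.1
        have p1 : (0:ℝ) ≤ B.h1 * y := mul_nonneg (by positivity) hy.1
        have q1 : (B.h1 * y:ℝ) ≤ B.h1 := mul_le_of_le_one_right (by positivity) hy.2
        have q2 : (B.h2 * z:ℝ) ≤ B.h2 := mul_le_of_le_one_right (by positivity) hz.2
        cases g5 : (Nat.ble (Nat.add B.a1 B.h1) B.a0) <;> rw [g5] at g1
        · have := Nat.le_of_ble_eq_true g1
          rw [e2] at this
          have : ((B.a2 + B.h2 : ℕ) : ℝ) ≤ B.a1 := by exact_mod_cast this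
          push_cast at this; linarith
        · have := Nat.le_of_ble_eq_true g5
          rw [e2] at this
          have : ((B.a1 + B.h1 : ℕ) : ℝ) ≤ B.a0 := by exact_mod_cast this
          push_cast at this; linarith

noncomputable def withCtx (w kk n0 n1 n2 : ℕ) (wd : Bool) (c : Ctx → Bool) : Bool :=
  force (n0*n1*n2) fun N =>
  force (Nat.mul (Nat.pow 2 kk) (ones w N)) fun top =>
  withAx w 1 n0 N fun A0 => force n0 fun s1 => withAx w s1 n1 N fun A1 => force (n0*n1) fun s2 => withAx w s2 n2 N fun A2 =>
   c ⟨wd, top, A0, A1, A2⟩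
lemma withCtx_eq (w kk n0 n1 n2 : ℕ) (wd : Bool) (c : Ctx → Bool) :
    withCtx w kk n0 n1 n2 wd c = c (ctxOf w kk n0 n1 n2 wd) := by
  simp only [withCtx, force_eq, withAx_eq]; rfl
end Kiss9

namespace Kiss9

structure Ops (α : Type) where
  add : α → α → α
  sub : α → α → α
  mul : α → α → α
  lit : ℕ → α
  seq : α → (α → α) → α

section prog
variable {α : Type} (O : Ops α)
def horP (off : ℕ) (q : α) : List ℕ → α
  | [] => O.lit 0
  | c :: cs => O.seq (horP off q cs) fun h => O.add (O.sub (O.lit c) (O.lit off)) (O.mul q h)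
def phiP (off : ℕ) (q0 q1 : α) : List (List ℕ) → α
  | [] => O.lit 0
  | c :: cs => O.seq (horP O off q0 c) fun a => O.seq (horP O off q1 c) fun b =>
      O.seq (phiP off q0 q1 cs) fun s => O.add (O.mul a b) s
def nxtP (m : ℕ) (S R : α) (k : ℕ) (g g' : α) : α :=
  O.sub (O.mul (O.lit (2*k+m)) (O.mul S g')) (O.mul (O.lit ((k+1)*(k+m-2))) (O.mul R g))
def loopP (off m : ℕ) (q0 q1 c S R : α) : List (List (List ℕ)) → ℕ → α → α → α → α
  | [], _, _, _, acc => acc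
  | b :: l, k, g, g', acc => O.seq (phiP O off q0 q1 b) fun p =>
      O.seq (O.add (O.mul acc c) (O.mul g p)) fun acc' =>
      O.seq (nxtP O m S R k g g') fun g'' => loopP off m q0 q1 c S R l (k+1) g' g'' acc'
def loopA (m : ℕ) (c S R : α) : List ℕ → ℕ → α → α → α → α
  | [], _, _, _, acc => acc
  | b :: l, k, g, g', acc =>
      O.seq (O.add (O.mul acc c) (O.mul g (O.lit b))) fun acc' =>
      O.seq (nxtP O m S R k g g') fun g'' => loopA m c S R l (k+1) g' g'' acc'
def powP (a : α) : ℕ → α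
  | 0 => O.lit 1
  | k+1 => O.seq (powP a k) fun p => O.mul p a
def oneP (q : α) : α := O.add q (O.lit 1)
def twoP (q : α) : α := O.sub q (O.lit 2)
def zP (q : α) : α := O.mul (O.add q (O.lit 4)) (O.mul (O.lit 3) q)
def fP (off : ℕ) (D : List (List (List ℕ))) (q0 q1 q2 : α) : α :=
  O.seq (O.sub (O.mul (O.mul (O.lit 2) (twoP O q2)) (O.mul (oneP O q0) (oneP O q1)))
     (O.mul (oneP O q2) (O.mul (twoP O q0) (twoP O q1)))) fun S =>
  O.seq (O.mul (O.mul (zP O q0) (zP O q1)) (O.mul (oneP O q2) (oneP O q2))) fun R =>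
  O.seq (oneP O q2) fun c => O.seq (O.mul (O.lit 6) S) fun g' =>
  loopP O off 8 q0 q1 c S R D 0 (O.lit 1) g' (O.lit 0)
def triP (off : ℕ) (D : List (List (List ℕ))) (q0 q1 q2 : α) : α :=
  O.seq (fP O off D q0 q1 q2) fun x => O.seq (fP O off D q0 q2 q1) fun y =>
  O.seq (fP O off D q1 q2 q0) fun z => O.add x (O.add y z)
def detP (e Sd : ℕ) (q0 q1 q2 : α) : α :=
  O.seq (oneP O q0) fun a => O.seq (oneP O q1) fun b => O.seq (oneP O q2) fun c =>
  O.seq (twoP O q0) fun U => O.seq (twoP O q1) fun V => O.seq (twoP O q2) fun T =>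
  O.seq (O.mul a (O.mul b c)) fun abc =>
  O.mul (O.mul (O.lit Sd) (powP O abc e))
   (O.sub (O.mul abc (O.add (O.mul (O.lit 4) abc) (O.mul U (O.mul V T))))
     (O.add (O.mul (O.mul U U) (O.mul (O.mul b b) (O.mul c c)))
      (O.add (O.mul (O.mul V V) (O.mul (O.mul a a) (O.mul c c)))
        (O.mul (O.mul T T) (O.mul (O.mul a a) (O.mul b b))))))
def dltP (off : ℕ) (q : α) : List (List ℕ) → List ℕ → α
  | c :: cs, e :: es => O.seq (horP O off q c) fun a => O.seq (dltP off q cs es) fun s =>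
      O.add (O.mul (O.sub (O.lit e) (O.lit off)) a) s
  | _, _ => O.lit 0
def pairP (off Λ W d : ℕ) (D0 : List (List ℕ)) (D : List (List (List ℕ))) (dl al : List ℕ) (q : α) : α :=
  O.seq (oneP O q) fun a => O.seq (twoP O q) fun U => O.seq (zP O q) fun Z =>
  O.seq (O.mul Z Z) fun ZZ => O.seq (O.mul (O.lit 6) Z) fun g' =>
  O.seq (loopP O off 8 q q (O.lit 1) Z ZZ (D0 :: D) 0 (O.lit 1) g' (O.lit 0)) fun x =>
  O.seq (powP O a d) fun ad =>
  O.seq (O.mul (O.mul (O.lit 2) ad) (dltP O off q D0 dl)) fun y =>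
  O.seq (O.mul (O.lit 4) (O.mul a a)) fun R => O.seq (O.mul (O.lit 7) U) fun h' =>
  O.seq (loopA O 9 a U R al 0 (O.lit 1) h' (O.lit 0)) fun z =>
  O.add z (O.mul (O.lit Λ) (O.add (O.add x y) (O.mul (O.lit W) (O.mul ad ad))))
end prog

structure Rel {α β : Type} (O : Ops α) (O' : Ops β) (R : α → β → Prop) : Prop where
  add : ∀ a b c d, R a b → R c d → R (O.add a c) (O'.add b d)
  sub : ∀ a b c d, R a b → R c d → R (O.sub a c) (O'.sub b d)
  mul : ∀ a b c d, R a b → R c d → R (O.mul a c) (O'.mul b d)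
  lit : ∀ n, R (O.lit n) (O'.lit n)
  seq : ∀ x k, O.seq x k = k x
  seq' : ∀ x k, O'.seq x k = k x

section para
variable {α β : Type} {O : Ops α} {O' : Ops β} {R : α → β → Prop} (h : Rel O O' R)
include h
lemma horP_rel (off : ℕ) {q : α} {q' : β} (hq : R q q') (l : List ℕ) : R (horP O off q l) (horP O' off q' l) := by
  induction l with
  | nil => exact h.lit 0
  | cons c cs ih =>
    simp only [horP, h.seq, h.seq']
    exact h.add _ _ _ _ (h.sub _ _ _ _ (h.lit _) (h.lit _)) (h.mul _ _ _ _ hq ih)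
lemma phiP_rel (off : ℕ) {q r : α} {q' r' : β} (hq : R q q') (hr : R r r') (l : List (List ℕ)) :
    R (phiP O off q r l) (phiP O' off q' r' l) := by
  induction l with
  | nil => exact h.lit 0
  | cons c cs ih =>
    simp only [phiP, h.seq, h.seq']
    exact h.add _ _ _ _ (h.mul _ _ _ _ (horP_rel h off hq c) (horP_rel h off hr c)) ih
lemma nxtP_rel (m : ℕ) {S T : α} {S' T' : β} (hS : R S S') (hT : R T T') (k : ℕ) {g i : α} {g' i' : β}
    (hg : R g g') (hi : R i i') : R (nxtP O m S T k g i) (nxtP O' m S' T' k g' i') :=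
  h.sub _ _ _ _ (h.mul _ _ _ _ (h.lit _) (h.mul _ _ _ _ hS hi)) (h.mul _ _ _ _ (h.lit _) (h.mul _ _ _ _ hT hg))
lemma loopP_rel (off m : ℕ) {q r c S T : α} {q' r' c' S' T' : β} (hq : R q q') (hr : R r r') (hc : R c c')
    (hS : R S S') (hT : R T T') (l : List (List (List ℕ))) : ∀ (k : ℕ) (g i a : α) (g' i' a' : β),
    R g g' → R i i' → R a a' →
    R (loopP O off m q r c S T l k g i a) (loopP O' off m q' r' c' S' T' l k g' i' a') := by
  induction l with
  | nil => intro k g i a g' i' a' _ _ ha; exact ha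
  | cons b l ih =>
    intro k g i a g' i' a' hg hi ha
    simp only [loopP, h.seq, h.seq']
    exact ih _ _ _ _ _ _ _ hi (nxtP_rel h m hS hT k hg hi)
      (h.add _ _ _ _ (h.mul _ _ _ _ ha hc) (h.mul _ _ _ _ hg (phiP_rel h off hq hr b)))
lemma loopA_rel (m : ℕ) {c S T : α} {c' S' T' : β} (hc : R c c')
    (hS : R S S') (hT : R T T') (l : List ℕ) : ∀ (k : ℕ) (g i a : α) (g' i' a' : β),
    R g g' → R i i' → R a a' →
    R (loopA O m c S T l k g i a) (loopA O' m c' S' T' l k g' i' a') := by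
  induction l with
  | nil => intro k g i a g' i' a' _ _ ha; exact ha
  | cons b l ih =>
    intro k g i a g' i' a' hg hi ha
    simp only [loopA, h.seq, h.seq']
    exact ih _ _ _ _ _ _ _ hi (nxtP_rel h m hS hT k hg hi)
      (h.add _ _ _ _ (h.mul _ _ _ _ ha hc) (h.mul _ _ _ _ hg (h.lit b)))
lemma powP_rel {a : α} {a' : β} (ha : R a a') (k : ℕ) : R (powP O a k) (powP O' a' k) := by
  induction k with
  | zero => exact h.lit 1
  | succ k ih => simp only [powP, h.seq, h.seq']; exact h.mul _ _ _ _ ih ha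
lemma oneP_rel {q : α} {q' : β} (hq : R q q') : R (oneP O q) (oneP O' q') := h.add _ _ _ _ hq (h.lit 1)
lemma twoP_rel {q : α} {q' : β} (hq : R q q') : R (twoP O q) (twoP O' q') := h.sub _ _ _ _ hq (h.lit 2)
lemma zP_rel {q : α} {q' : β} (hq : R q q') : R (zP O q) (zP O' q') :=
  h.mul _ _ _ _ (h.add _ _ _ _ hq (h.lit 4)) (h.mul _ _ _ _ (h.lit 3) hq)
lemma fP_rel (off : ℕ) (D : List (List (List ℕ))) {q r s : α} {q' r' s' : β} (hq : R q q') (hr : R r r') (hs : R s s') :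
    R (fP O off D q r s) (fP O' off D q' r' s') := by
  simp only [fP, h.seq, h.seq']
  have hS := h.sub _ _ _ _ (h.mul _ _ _ _ (h.mul _ _ _ _ (h.lit 2) (twoP_rel h hs)) (h.mul _ _ _ _ (oneP_rel h hq) (oneP_rel h hr)))
     (h.mul _ _ _ _ (oneP_rel h hs) (h.mul _ _ _ _ (twoP_rel h hq) (twoP_rel h hr)))
  exact loopP_rel h off 8 hq hr (oneP_rel h hs) hS
    (h.mul _ _ _ _ (h.mul _ _ _ _ (zP_rel h hq) (zP_rel h hr)) (h.mul _ _ _ _ (oneP_rel h hs) (oneP_rel h hs)))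
    D 0 _ _ _ _ _ _ (h.lit 1) (h.mul _ _ _ _ (h.lit 6) hS) (h.lit 0)
lemma triP_rel (off : ℕ) (D : List (List (List ℕ))) {q r s : α} {q' r' s' : β} (hq : R q q') (hr : R r r') (hs : R s s') :
    R (triP O off D q r s) (triP O' off D q' r' s') := by
  simp only [triP, h.seq, h.seq']
  exact h.add _ _ _ _ (fP_rel h off D hq hr hs) (h.add _ _ _ _ (fP_rel h off D hq hs hr) (fP_rel h off D hr hs hq))
lemma detP_rel (e Sd : ℕ) {q r s : α} {q' r' s' : β} (hq : R q q') (hr : R r r') (hs : R s s') :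
    R (detP O e Sd q r s) (detP O' e Sd q' r' s') := by
  simp only [detP, h.seq, h.seq']
  have a := oneP_rel h hq
  have b := oneP_rel h hr
  have c := oneP_rel h hs
  have U := twoP_rel h hq
  have V := twoP_rel h hr
  have T := twoP_rel h hs
  have M : ∀ {a b c d}, R a b → R c d → R (O.mul a c) (O'.mul b d) := h.mul _ _ _ _
  have A : ∀ {a b c d}, R a b → R c d → R (O.add a c) (O'.add b d) := h.add _ _ _ _
  have abc := M a (M b c)
  exact M (M (h.lit Sd) (powP_rel h abc e)) (h.sub _ _ _ _ (M abc (A (M (h.lit 4) abc) (M U (M V T))))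
    (A (M (M U U) (M (M b b) (M c c))) (A (M (M V V) (M (M a a) (M c c))) (M (M T T) (M (M a a) (M b b))))))
lemma dltP_rel (off : ℕ) {q : α} {q' : β} (hq : R q q') (l : List (List ℕ)) : ∀ (e : List ℕ),
    R (dltP O off q l e) (dltP O' off q' l e) := by
  induction l with
  | nil => intro e; simp only [dltP]; exact h.lit 0
  | cons c cs ih =>
    intro e
    cases e with
    | nil => simp only [dltP]; exact h.lit 0
    | cons e es =>
      simp only [dltP, h.seq, h.seq']
      exact h.add _ _ _ _ (h.mul _ _ _ _ (h.sub _ _ _ _ (h.lit _) (h.lit _)) (horP_rel h off hq c)) (ih es)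
lemma pairP_rel (off Λ W d : ℕ) (D0 : List (List ℕ)) (D : List (List (List ℕ))) (dl al : List ℕ)
    {q : α} {q' : β} (hq : R q q') :
    R (pairP O off Λ W d D0 D dl al q) (pairP O' off Λ W d D0 D dl al q') := by
  simp only [pairP, h.seq, h.seq']
  have a := oneP_rel h hq
  have U := twoP_rel h hq
  have Z := zP_rel h hq
  have M : ∀ {a b c d}, R a b → R c d → R (O.mul a c) (O'.mul b d) := h.mul _ _ _ _
  have A : ∀ {a b c d}, R a b → R c d → R (O.add a c) (O'.add b d) := h.add _ _ _ _
  have ad := powP_rel h a d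
  refine A (loopA_rel h 9 a U (M (h.lit 4) (M a a)) al 0 _ _ _ _ _ _ (h.lit 1) (M (h.lit 7) U) (h.lit 0))
    (M (h.lit Λ) (A (A (loopP_rel h off 8 hq hq (h.lit 1) Z (M Z Z) _ 0 _ _ _ _ _ _ (h.lit 1) (M (h.lit 6) Z) (h.lit 0))
      (M (M (h.lit 2) ad) (dltP_rel h off hq _ _))) (M (h.lit W) (M ad ad))))
end para

/-! instances -/
open MvPolynomial
abbrev P3 := MvPolynomial (Fin 3) ℤ
noncomputable def OP : Ops P3 := ⟨(· + ·), (· - ·), (· * ·), fun n => (n : P3), fun x k => k x⟩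
noncomputable def OR : Ops ℝ := ⟨(· + ·), (· - ·), (· * ·), fun n => (n : ℝ), fun x k => k x⟩
noncomputable def OM (Mo : ℕ) : Ops ℕ :=
  ⟨fun a b => Nat.mod (Nat.add a b) Mo, fun a b => Nat.mod (Nat.add a (Nat.sub Mo b)) Mo,
   fun a b => Nat.mod (Nat.mul a b) Mo, fun n => Nat.mod n Mo, fun x k => force x k⟩
noncomputable def OB : Ops ℕ := ⟨Nat.add, Nat.add, Nat.mul, fun n => n, fun x k => force x k⟩
noncomputable def OD : Ops ℕ := ⟨Nat.max, Nat.max, Nat.add, fun _ => 0, fun x k => force x k⟩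

lemma rel_R (q : Fin 3 → ℝ) : Rel OP OR (fun p r => aeval q p = r) where
  add := by rintro a _ c _ rfl rfl; exact map_add _ _ _
  sub := by rintro a _ c _ rfl rfl; exact map_sub _ _ _
  mul := by rintro a _ c _ rfl rfl; exact map_mul _ _ _
  lit := fun n => map_natCast _ n
  seq := fun _ _ => rfl
  seq' := fun _ _ => rfl
lemma rel_M (Mo : ℕ) (hMo : 0 < Mo) (q : Fin 3 → ℤ) :
    Rel OP (OM Mo) (fun p r => r < Mo ∧ ((r : ℤ) : ZMod Mo) = ((eval q p : ℤ) : ZMod Mo)) where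
  add := by
    rintro a b c d ⟨h1, h2⟩ ⟨h3, h4⟩
    refine ⟨Nat.mod_lt _ hMo, ?_⟩
    show ((((b + d) % Mo : ℕ) : ℤ) : ZMod Mo) = ((eval q (a + c) : ℤ) : ZMod Mo)
    simp only [map_add, Int.cast_add, ← h2, ← h4]; simp
  sub := by
    rintro a b c d ⟨h1, h2⟩ ⟨h3, h4⟩
    refine ⟨Nat.mod_lt _ hMo, ?_⟩
    show ((((b + (Mo - d)) % Mo : ℕ) : ℤ) : ZMod Mo) = ((eval q (a - c) : ℤ) : ZMod Mo)
    simp only [map_sub, Int.cast_sub, ← h2, ← h4]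
    have : ((Mo - d : ℕ) : ZMod Mo) = - (d : ZMod Mo) := by
      rw [Nat.cast_sub h3.le]; simp
    simp [this, sub_eq_add_neg]
  mul := by
    rintro a b c d ⟨h1, h2⟩ ⟨h3, h4⟩
    refine ⟨Nat.mod_lt _ hMo, ?_⟩
    show ((((b * d) % Mo : ℕ) : ℤ) : ZMod Mo) = ((eval q (a * c) : ℤ) : ZMod Mo)
    simp only [map_mul, Int.cast_mul, ← h2, ← h4]; simp
  lit := fun n => by
    refine ⟨Nat.mod_lt _ hMo, ?_⟩
    show (((n % Mo : ℕ) : ℤ) : ZMod Mo) = ((eval q ((n:ℕ) : P3) : ℤ) : ZMod Mo)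
    simp
  seq := fun _ _ => rfl
  seq' := fun _ _ => force_eq _ _

def Maj (p : P3) (M : ℕ) : Prop :=
  ∃ N : MvPolynomial (Fin 3) ℕ, (∀ m, |coeff m p| ≤ ((coeff m N : ℕ) : ℤ)) ∧ eval (fun _ => 1) N ≤ M
lemma maj_coeff {p : P3} {M : ℕ} (h : Maj p M) (m : Fin 3 →₀ ℕ) : |coeff m p| ≤ M := by
  obtain ⟨N, h1, h2⟩ := h
  refine (h1 m).trans ?_
  have : coeff m N ≤ eval (fun _ => 1) N := by
    rw [eval_eq]
    simp only [one_pow, Finset.prod_const_one, mul_one]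
    by_cases hm : m ∈ N.support
    · exact Finset.single_le_sum (f := fun m => coeff m N) (fun _ _ => Nat.zero_le _) hm
    · simp [notMem_support_iff.mp hm]
  exact_mod_cast this.trans h2
lemma rel_B : Rel OP OB Maj where
  add := by
    rintro a b c d ⟨N, h1, h2⟩ ⟨N', h3, h4⟩
    refine ⟨N + N', fun m => ?_, ?_⟩
    · show |coeff m (a + c)| ≤ _
      rw [coeff_add, coeff_add]; push_cast
      exact (abs_add_le _ _).trans (add_le_add (h1 m) (h3 m))
    · rw [map_add]; exact add_le_add h2 h4
  sub := by
    rintro a b c d ⟨N, h1, h2⟩ ⟨N', h3, h4⟩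
    refine ⟨N + N', fun m => ?_, ?_⟩
    · show |coeff m (a - c)| ≤ _
      rw [coeff_sub, coeff_add]; push_cast
      exact (abs_sub _ _).trans (add_le_add (h1 m) (h3 m))
    · rw [map_add]; exact add_le_add h2 h4
  mul := by
    rintro a b c d ⟨N, h1, h2⟩ ⟨N', h3, h4⟩
    refine ⟨N * N', fun m => ?_, ?_⟩
    · show |coeff m (a * c)| ≤ _
      rw [coeff_mul, coeff_mul]; push_cast
      refine (Finset.abs_sum_le_sum_abs _ _).trans (Finset.sum_le_sum fun i _ => ?_)
      rw [abs_mul]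
      exact mul_le_mul (h1 _) (h3 _) (abs_nonneg _) (by positivity)
    · rw [map_mul]; exact Nat.mul_le_mul h2 h4
  lit := fun n => by
    refine ⟨(n : MvPolynomial (Fin 3) ℕ), fun m => ?_, by rw [map_natCast]; exact le_refl _⟩
    show |coeff m (n : P3)| ≤ _
    have e1 : ((n : ℕ) : P3) = C (n : ℤ) := by simp
    have e2 : ((n : ℕ) : MvPolynomial (Fin 3) ℕ) = C n := by simp
    rw [e1, e2, coeff_C, coeff_C]
    split <;> simp
  seq := fun _ _ => rfl
  seq' := fun _ _ => force_eq _ _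
lemma maj_X (i : Fin 3) : Maj (X i) 1 := by
  refine ⟨X i, fun m => ?_, by simp⟩
  rw [coeff_X, coeff_X]; split <;> simp
lemma rel_D (i : Fin 3) : Rel OP OD (fun p e => degreeOf i p ≤ e) where
  add := fun a b c d h1 h2 => (degreeOf_add_le i a c).trans (max_le_max h1 h2)
  sub := fun a b c d h1 h2 => (degreeOf_sub_le i a c).trans (max_le_max h1 h2)
  mul := fun a b c d h1 h2 => (degreeOf_mul_le i a c).trans (add_le_add h1 h2)
  lit := fun n => by
    show degreeOf i ((n:ℕ) : P3) ≤ 0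
    have e1 : ((n : ℕ) : P3) = C (n : ℤ) := by simp
    rw [e1, degreeOf_C]
  seq := fun _ _ => rfl
  seq' := fun _ _ => force_eq _ _
end Kiss9

namespace Kiss9

lemma geg_hom {R : Type*} [CommRing R] (m : ℕ) (l s r : R) (k : ℕ) :
    geg m (l*s) (l^2*r) k = l^k * geg m s r k := by
  induction k using Nat.twoStepInduction with
  | zero => simp [geg]
  | one => simp only [geg]; ring
  | more k h1 h2 => simp only [geg, h1, h2]; ring

/-! real side -/
noncomputable def hor (off : ℕ) (x : ℝ) : List ℕ → ℕ → ℝ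
  | [], _ => 0
  | c :: cs, e => ((c:ℝ) - off) * (1-x)^e + x * hor off x cs (e-1)
lemma hor_eq (off : ℕ) (x : ℝ) (hx : x < 1) (l : List ℕ) : ∀ e, l.length ≤ e + 1 →
    hor off x l e = (1-x)^e * horP OR off (x/(1-x)) l := by
  induction l with
  | nil => intro e _; simp [hor, horP, OR]
  | cons c cs ih =>
    intro e he
    have h1 : (1 - x) ≠ 0 := by linarith
    simp only [hor, horP]
    show _ = (1-x)^e * (((c:ℝ) - (off:ℝ)) + x/(1-x) * horP OR off (x/(1-x)) cs)
    cases e with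
    | zero =>
      have : cs = [] := by simpa using he
      subst this; simp [hor, horP, OR]
    | succ e =>
      rw [ih _ (by simp at he ⊢; omega)]
      simp only [Nat.add_sub_cancel, pow_succ]; field_simp
lemma hor_cont (off : ℕ) (l : List ℕ) : ∀ e, Continuous fun x => hor off x l e := by
  induction l with
  | nil => intro e; simpa [hor] using continuous_const
  | cons c cs ih => intro e; simp only [hor]; have := ih (e-1); fun_prop

noncomputable def phiS (off : ℕ) (x y : ℝ) (e : ℕ) : List (List ℕ) → ℝ
  | [] => 0
  | c :: cs => hor off x c e * hor off y c e + phiS off x y e cs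
def short (e : ℕ) (b : List (List ℕ)) : Bool := b.all fun c => decide (c.length ≤ e + 1)
lemma phiS_eq (off : ℕ) (x y : ℝ) (hx : x < 1) (hy : y < 1) (e : ℕ) (b : List (List ℕ)) (hb : short e b) :
    phiS off x y e b = (1-x)^e * (1-y)^e * phiP OR off (x/(1-x)) (y/(1-y)) b := by
  induction b with
  | nil => simp [phiS, phiP, OR]
  | cons c cs ih =>
    simp only [short, List.all_cons, Bool.and_eq_true, decide_eq_true_eq] at hb
    simp only [phiS]
    rw [ih hb.2, hor_eq off x hx c e hb.1, hor_eq off y hy c e hb.1]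
    show _ = (1-x)^e * (1-y)^e * (horP OR off (x/(1-x)) c * horP OR off (y/(1-y)) c + phiP OR off (x/(1-x)) (y/(1-y)) cs)
    ring
lemma phiS_cont (off e : ℕ) (b : List (List ℕ)) : Continuous fun p : ℝ × ℝ => phiS off p.1 p.2 e b := by
  induction b with
  | nil => simpa [phiS] using continuous_const
  | cons c cs ih =>
    simp only [phiS]
    have h1 := (hor_cont off c e).comp continuous_fst (X := ℝ × ℝ)
    have h2 := (hor_cont off c e).comp continuous_snd (X := ℝ × ℝ)
    exact (h1.mul h2).add ih

lemma geg_cont {X : Type*} [TopologicalSpace X] (m : ℕ) (s r : X → ℝ) (hs : Continuous s) (hr : Continuous r) (k : ℕ) :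
    Continuous fun x => geg m (s x) (r x) k := by
  induction k using Nat.twoStepInduction with
  | zero => simpa [geg] using continuous_const
  | one => simp only [geg]; fun_prop
  | more k h1 h2 => simp only [geg]; fun_prop

/-- polynomial part of the three point function: blocks `l`, starting at index `k`. -/
noncomputable def fsum (off d : ℕ) (u v t : ℝ) : List (List (List ℕ)) → ℕ → ℝ
  | [], _ => 0
  | b :: l, k => 4^k * geg 8 (t-u*v) ((1-u^2)*(1-v^2)) k * phiS off ((2*u+2)/3) ((2*v+2)/3) (d-k) b
      + fsum off d u v t l (k+1)
lemma fsum_cont (off d : ℕ) (l : List (List (List ℕ))) : ∀ k,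
    Continuous fun p : ℝ × ℝ × ℝ => fsum off d p.1 p.2.1 p.2.2 l k := by
  induction l with
  | nil => intro k; simpa [fsum] using continuous_const
  | cons b l ih =>
    intro k
    simp only [fsum]
    have h1 : Continuous fun p : ℝ × ℝ × ℝ => geg 8 (p.2.2-p.1*p.2.1) ((1-p.1^2)*(1-p.2.1^2)) k :=
      geg_cont 8 _ _ (by fun_prop) (by fun_prop) k
    have h2 : Continuous fun p : ℝ × ℝ × ℝ => phiS off ((2*p.1+2)/3) ((2*p.2.1+2)/3) (d-k) b :=
      (phiS_cont off (d-k) b).comp (g := fun p : ℝ × ℝ => phiS off p.1 p.2 (d-k) b)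
        (f := fun p : ℝ × ℝ × ℝ => ((2*p.1+2)/3, (2*p.2.1+2)/3)) (by fun_prop)
    have := ih (k+1)
    fun_prop

lemma loopP_eq (off m : ℕ) (hm : 2 ≤ m) (q0 q1 c S R : ℝ) (l : List (List (List ℕ))) : ∀ (k : ℕ) (acc : ℝ),
    loopP OR off m q0 q1 c S R l k (geg m S R k) (geg m S R (k+1)) acc = acc * c^l.length +
      loopP OR off m q0 q1 c S R l k (geg m S R k) (geg m S R (k+1)) 0 := by
  have hn : ∀ k, nxtP OR m S R k (geg m S R k) (geg m S R (k+1)) = geg m S R (k+2) := by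
    intro k
    show ((2*k+m : ℕ):ℝ) * (S * geg m S R (k+1)) - (((k+1)*(k+m-2) : ℕ) : ℝ) * (R * geg m S R k) = _
    rw [geg]
    have : ((k + m - 2 : ℕ) : ℝ) = k + m - 2 := by rw [Nat.cast_sub (by omega)]; push_cast; ring
    push_cast; rw [this]; ring
  induction l with
  | nil => intro k acc; simp [loopP]
  | cons b l ih =>
    intro k acc
    show loopP OR off m q0 q1 c S R l (k+1) (geg m S R (k+1)) (nxtP OR m S R k (geg m S R k) (geg m S R (k+1)))
      (acc * c + geg m S R k * phiP OR off q0 q1 b) = _ + loopP OR off m q0 q1 c S R l (k+1) (geg m S R (k+1))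
        (nxtP OR m S R k (geg m S R k) (geg m S R (k+1))) (0 * c + geg m S R k * phiP OR off q0 q1 b)
    rw [hn, ih, ih (k+1) (0 * c + _), List.length_cons]; ring

lemma loopP_cons (off m : ℕ) (hm : 2 ≤ m) (q0 q1 c S R : ℝ) (b : List (List ℕ)) (l : List (List (List ℕ))) (k : ℕ) :
    loopP OR off m q0 q1 c S R (b :: l) k (geg m S R k) (geg m S R (k+1)) 0 = geg m S R k * phiP OR off q0 q1 b * c^l.length +
      loopP OR off m q0 q1 c S R l (k+1) (geg m S R (k+1)) (geg m S R (k+2)) 0 := by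
  have hn : ∀ k, nxtP OR m S R k (geg m S R k) (geg m S R (k+1)) = geg m S R (k+2) := by
    intro k
    show ((2*k+m : ℕ):ℝ) * (S * geg m S R (k+1)) - (((k+1)*(k+m-2) : ℕ) : ℝ) * (R * geg m S R k) = _
    rw [geg]
    have : ((k + m - 2 : ℕ) : ℝ) = k + m - 2 := by rw [Nat.cast_sub (by omega)]; push_cast; ring
    push_cast; rw [this]; ring
  show loopP OR off m q0 q1 c S R l (k+1) (geg m S R (k+1)) (nxtP OR m S R k (geg m S R k) (geg m S R (k+1)))
      (0 * c + geg m S R k * phiP OR off q0 q1 b) = _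
  rw [hn, loopP_eq off m hm]; ring

def shortL (d : ℕ) : List (List (List ℕ)) → ℕ → Bool
  | [], k => decide (k = d+1)
  | b :: l, k => short (d-k) b && shortL d l (k+1)
lemma shortL_len (d : ℕ) (l : List (List (List ℕ))) : ∀ k, shortL d l k → l.length + k = d + 1 := by
  induction l with
  | nil => intro k h; simpa [shortL] using h
  | cons b l ih =>
    intro k h
    simp only [shortL, Bool.and_eq_true] at h
    have := ih _ h.2
    simp only [List.length_cons]; omega

lemma fP_aux (off d : ℕ) (x y z : ℝ) (hx : x < 1) (hy : y < 1) (hz : z < 1) (S R : ℝ) (l : List (List (List ℕ)))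
    (u v t : ℝ) (hu : u = (3*x-2)/2) (hv : v = (3*y-2)/2)
    (hS : (1-x)*(1-y)*(1-z)*S = 4*(t-u*v)) (hR : ((1-x)*(1-y)*(1-z))^2*R = 4^2*((1-u^2)*(1-v^2))) : ∀ k, shortL d l k →
    fsum off d u v t l k = ((1-x)*(1-y)*(1-z))^d *
     loopP OR off 8 (x/(1-x)) (y/(1-y)) (1/(1-z)) S R l k (geg 8 S R k) (geg 8 S R (k+1)) 0 := by
  induction l with
  | nil => intro k h; simp [loopP, fsum]
  | cons b l ih =>
    intro k h
    have hl := shortL_len d _ k h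
    simp only [shortL, Bool.and_eq_true] at h
    rw [loopP_cons _ _ (by norm_num), mul_add, ← ih (k+1) h.2]
    simp only [fsum]
    have e1 : (2*u+2)/3 = x := by rw [hu]; ring
    have e2 : (2*v+2)/3 = y := by rw [hv]; ring
    rw [e1, e2, phiS_eq off x y hx hy _ b h.1, ← geg_hom, ← hS, ← hR, geg_hom]
    simp only [List.length_cons] at hl
    have hd : d = k + l.length := by omega
    have hk : d - k = l.length := by omega
    rw [hk, hd]
    congr 1
    have h1 : (1 - z) ≠ 0 := by linarith
    simp only [pow_add, mul_pow, one_div, inv_pow]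
    field_simp

lemma S_eq (x y z : ℝ) (hx : x < 1) (hy : y < 1) (hz : z < 1) :
    (1-x)*(1-y)*(1-z)*((2*(z/(1-z)-2))*((x/(1-x)+1)*(y/(1-y)+1)) - (z/(1-z)+1)*((x/(1-x)-2)*(y/(1-y)-2)))
      = 4*((3*z-2)/2-(3*x-2)/2*((3*y-2)/2)) := by
  have h1 : (1 - x) ≠ 0 := by linarith
  have h2 : (1 - y) ≠ 0 := by linarith
  have h3 : (1 - z) ≠ 0 := by linarith
  field_simp; ring
lemma R_eq (x y z : ℝ) (hx : x < 1) (hy : y < 1) (hz : z < 1) :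
    ((1-x)*(1-y)*(1-z))^2*(((x/(1-x)+4)*(3*(x/(1-x)))*((y/(1-y)+4)*(3*(y/(1-y)))))*((z/(1-z)+1)*(z/(1-z)+1)))
      = 4^2*((1-((3*x-2)/2)^2)*(1-((3*y-2)/2)^2)) := by
  have h1 : (1 - x) ≠ 0 := by linarith
  have h2 : (1 - y) ≠ 0 := by linarith
  have h3 : (1 - z) ≠ 0 := by linarith
  field_simp; ring

lemma fP_eq (off d : ℕ) (D : List (List (List ℕ))) (hD : shortL d D 0) (x y z : ℝ) (hx : x < 1) (hy : y < 1) (hz : z < 1) :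
    ((1-x)*(1-y)*(1-z))^d * fP OR off D (x/(1-x)) (y/(1-y)) (z/(1-z)) =
      fsum off d ((3*x-2)/2) ((3*y-2)/2) ((3*z-2)/2) D 0 := by
  rw [fP_aux off d x y z hx hy hz _ _ D _ _ _ rfl rfl (S_eq x y z hx hy hz) (R_eq x y z hx hy hz) 0 hD]
  congr 1
  simp only [fP, OR, twoP, oneP, zP, geg]
  have h3 : (1 - z) ≠ 0 := by linarith
  have : z/(1-z) + 1 = 1/(1-z) := by field_simp; ring
  push_cast
  rw [this]

noncomputable def tri (off d : ℕ) (D : List (List (List ℕ))) (u v t : ℝ) : ℝ :=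
  fsum off d u v t D 0 + fsum off d u t v D 0 + fsum off d v t u D 0
lemma triP_eq (off d : ℕ) (D : List (List (List ℕ))) (hD : shortL d D 0) (x y z : ℝ) (hx : x < 1) (hy : y < 1) (hz : z < 1) :
    ((1-x)*(1-y)*(1-z))^d * triP OR off D (x/(1-x)) (y/(1-y)) (z/(1-z)) =
      tri off d D ((3*x-2)/2) ((3*y-2)/2) ((3*z-2)/2) := by
  show ((1-x)*(1-y)*(1-z))^d * (fP OR off D _ _ _ + (fP OR off D _ _ _ + fP OR off D _ _ _)) = _
  rw [tri, ← fP_eq off d D hD x y z hx hy hz, ← fP_eq off d D hD x z y hx hz hy, ← fP_eq off d D hD y z x hy hz hx]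
  ring
lemma powP_eq (a : ℝ) (k : ℕ) : powP OR a k = a^k := by
  induction k with
  | zero => simp [powP, OR]
  | succ k ih => rw [pow_succ, ← ih]; rfl
lemma detP_eq (e Sd : ℕ) (x y z : ℝ) (hx : x < 1) (hy : y < 1) (hz : z < 1) :
    ((1-x)*(1-y)*(1-z))^(e+2) * detP OR e Sd (x/(1-x)) (y/(1-y)) (z/(1-z)) =
     4 * Sd * (1+2*((3*x-2)/2)*((3*y-2)/2)*((3*z-2)/2)-((3*x-2)/2)^2-((3*y-2)/2)^2-((3*z-2)/2)^2) := by
  have h1 : (1 - x) ≠ 0 := by linarith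
  have h2 : (1 - y) ≠ 0 := by linarith
  have h3 : (1 - z) ≠ 0 := by linarith
  have g1 : x/(1-x) + 1 = (1-x)⁻¹ := by field_simp; ring
  have g2 : y/(1-y) + 1 = (1-y)⁻¹ := by field_simp; ring
  have g3 : z/(1-z) + 1 = (1-z)⁻¹ := by field_simp; ring
  have k1 : x/(1-x) - 2 = (3*x-2)*(1-x)⁻¹ := by field_simp; ring
  have k2 : y/(1-y) - 2 = (3*y-2)*(1-y)⁻¹ := by field_simp; ring
  have k3 : z/(1-z) - 2 = (3*z-2)*(1-z)⁻¹ := by field_simp; ring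
  have l1 : (1-x)*(1-x)⁻¹ = 1 := mul_inv_cancel₀ h1
  have l2 : (1-y)*(1-y)⁻¹ = 1 := mul_inv_cancel₀ h2
  have l3 : (1-z)*(1-z)⁻¹ = 1 := mul_inv_cancel₀ h3
  simp only [detP, twoP, oneP]
  simp only [OR]
  change _ * (_ * powP OR _ _ * _) = _
  rw [powP_eq]; push_cast
  rw [g1, g2, g3, k1, k2, k3]
  generalize (1-x)⁻¹ = a at *
  generalize (1-y)⁻¹ = b at *
  generalize (1-z)⁻¹ = c at *
  generalize 1-x = a' at *
  generalize 1-y = b' at *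
  generalize 1-z = c' at *
  have he : (a'*b'*c')^e * (a*(b*c))^e = 1 := by
    rw [← mul_pow]
    have : a'*b'*c'*(a*(b*c)) = 1 := by
      calc _ = (a'*a)*(b'*b)*(c'*c) := by ring
        _ = 1 := by rw [l1, l2, l3]; ring
    rw [this, one_pow]
  rw [pow_add]
  calc _ = ((a'*b'*c')^e * (a*(b*c))^e) * Sd * ((a'*a)^2*(b'*b)^2*(c'*c)^2) *
      (4+(3*x-2)*(3*y-2)*(3*z-2)-(3*x-2)^2-(3*y-2)^2-(3*z-2)^2) := by ring
    _ = _ := by rw [he, l1, l2, l3]; ring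
end Kiss9

namespace Kiss9
noncomputable def asum (u : ℝ) : List ℕ → ℕ → ℝ
  | [], _ => 0
  | b :: l, k => b * (2^k * geg 9 u 1 k) + asum u l (k+1)
noncomputable def dsum (off : ℕ) (x : ℝ) (e : ℕ) : List (List ℕ) → List ℕ → ℝ
  | c :: cs, q :: qs => ((q:ℝ) - off) * hor off x c e + dsum off x e cs qs
  | _, _ => 0
lemma asum_cont (l : List ℕ) : ∀ k, Continuous fun u => asum u l k := by
  induction l with
  | nil => intro k; simpa [asum] using continuous_const
  | cons b l ih =>
    intro k; simp only [asum]
    have h1 := ih (k+1)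
    have h2 : Continuous fun u : ℝ => geg 9 u 1 k := geg_cont 9 _ _ continuous_id continuous_const k
    fun_prop
lemma dsum_cont (off e : ℕ) (b : List (List ℕ)) : ∀ l : List ℕ, Continuous fun x => dsum off x e b l := by
  induction b with
  | nil => intro l; simpa [dsum] using continuous_const
  | cons c cs ih =>
    intro l
    cases l with
    | nil => simpa [dsum] using continuous_const
    | cons q qs =>
      simp only [dsum]
      have h1 := ih qs
      have h2 := hor_cont off c e
      fun_prop
lemma dsum_eq (off : ℕ) (x : ℝ) (hx : x < 1) (e : ℕ) (b : List (List ℕ)) : ∀ (_ : short e b) (l : List ℕ),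
    dsum off x e b l = (1-x)^e * dltP OR off (x/(1-x)) b l := by
  induction b with
  | nil => intro _ l; simp [dsum, dltP, OR]
  | cons c cs ih =>
    intro hb l
    simp only [short, List.all_cons, Bool.and_eq_true, decide_eq_true_eq] at hb
    cases l with
    | nil => simp [dsum, dltP, OR]
    | cons q qs =>
      simp only [dsum]
      rw [ih hb.2, hor_eq off x hx c e hb.1]
      show _ = (1-x)^e * (((q:ℝ) - off) * horP OR off (x/(1-x)) c + dltP OR off (x/(1-x)) cs qs)
      ring
lemma loopA_eq (c U : ℝ) (u : ℝ) (hU : U = 2 * c * u) (l : List ℕ) : ∀ (k : ℕ) (acc : ℝ),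
    c * loopA OR 9 c U (4*(c*c)) l k (geg 9 U (4*(c*c)) k) (geg 9 U (4*(c*c)) (k+1)) acc =
      c^l.length * (c * acc + c^k * asum u l k) := by
  have hn : ∀ k S R, nxtP OR 9 S R k (geg 9 S R k) (geg 9 S R (k+1)) = geg 9 S R (k+2) := by
    intro k S R
    show ((2*k+9 : ℕ):ℝ) * (S * geg 9 S R (k+1)) - (((k+1)*(k+9-2) : ℕ) : ℝ) * (R * geg 9 S R k) = _
    rw [geg]
    have : ((k + 9 - 2 : ℕ) : ℝ) = k + 7 := by rw [Nat.cast_sub (by omega)]; push_cast; ring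
    push_cast; push_cast at this; rw [this]; ring
  induction l with
  | nil => intro k acc; simp [loopA, asum]
  | cons b l ih =>
    intro k acc
    show c * loopA OR 9 c U (4*(c*c)) l (k+1) (geg 9 U (4*(c*c)) (k+1)) (nxtP OR 9 U (4*(c*c)) k _ _)
      (acc * c + geg 9 U (4*(c*c)) k * (b:ℝ)) = _
    rw [hn]
    have h1 := ih (k+1) (acc * c + geg 9 U (4*(c*c)) k * (b:ℝ))
    have h2 : geg 9 U (4*(c*c)) k = (2*c)^k * geg 9 u 1 k := by
      rw [← geg_hom, hU]; congr 1; ring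
    rw [h1, h2]
    simp only [asum, List.length_cons, mul_pow, pow_add, pow_one]; ring

noncomputable def pairR (off Λ W d : ℕ) (D0 : List (List ℕ)) (D : List (List (List ℕ))) (dl al : List ℕ) (u : ℝ) : ℝ :=
  asum u al 0 + Λ * (fsum off d u u 1 (D0 :: D) 0 + 2 * dsum off ((2*u+2)/3) d D0 dl + W)
lemma pairR_cont (off Λ W d : ℕ) (D0 : List (List ℕ)) (D : List (List (List ℕ))) (dl al : List ℕ) :
    Continuous fun u => pairR off Λ W d D0 D dl al u := by
  have h1 := asum_cont al 0
  have h2 : Continuous fun u : ℝ => fsum off d u u 1 (D0 :: D) 0 :=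
    (fsum_cont off d (D0 :: D) 0).comp (f := fun u : ℝ => (u, u, 1)) (by fun_prop)
  have h3 : Continuous fun u : ℝ => dsum off ((2*u+2)/3) d D0 dl :=
    (dsum_cont off d D0 dl).comp (f := fun u : ℝ => (2*u+2)/3) (by fun_prop)
  unfold pairR; fun_prop
lemma pairP_eq (off Λ W d : ℕ) (D0 : List (List ℕ)) (D : List (List (List ℕ))) (dl al : List ℕ)
    (hD : shortL d (D0 :: D) 0) (hal : al.length = 2*d+1) (x : ℝ) (hx : x < 1) :
    (1-x)^(2*d) * pairP OR off Λ W d D0 D dl al (x/(1-x)) = pairR off Λ W d D0 D dl al ((3*x-2)/2) := by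
  have h1 : (1 - x) ≠ 0 := by linarith
  have g1 : x/(1-x) + 1 = (1-x)⁻¹ := by field_simp; ring
  have k1 : x/(1-x) - 2 = 2*(1-x)⁻¹*((3*x-2)/2) := by field_simp; ring
  have e1 := fP_aux off d x x 0 hx hx (by norm_num) ((x/(1-x)+4)*(3*(x/(1-x))))
    (((x/(1-x)+4)*(3*(x/(1-x))))*((x/(1-x)+4)*(3*(x/(1-x))))) (D0 :: D) _ _ 1 rfl rfl
    (by field_simp; ring) (by field_simp; ring) 0 hD
  have e2 := loopA_eq ((1-x)⁻¹) (2*(1-x)⁻¹*((3*x-2)/2)) ((3*x-2)/2) rfl al 0 0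
  have hD0 : short d D0 := by
    simp only [shortL, Bool.and_eq_true] at hD; exact hD.1
  have e3 := dsum_eq off x hx d D0 hD0 dl
  simp only [pow_zero, one_mul, zero_add, hal] at e2
  have l1 : (1-x)*(1-x)⁻¹ = 1 := mul_inv_cancel₀ h1
  have l2 : (1-x)^(2*d) * ((1-x)⁻¹)^(2*d) = 1 := by rw [← mul_pow, l1, one_pow]
  have l3 : (1-x)^d * ((1-x)⁻¹)^d = 1 := by rw [← mul_pow, l1, one_pow]
  have e4 : (2*((3*x-2)/2)+2)/3 = x := by ring
  have p : pairP OR off Λ W d D0 D dl al (x/(1-x)) =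
     loopA OR 9 (1-x)⁻¹ (2*(1-x)⁻¹*((3*x-2)/2)) (4*((1-x)⁻¹*(1-x)⁻¹)) al 0 1 (7*(2*(1-x)⁻¹*((3*x-2)/2))) 0 +
     Λ * ((loopP OR off 8 (x/(1-x)) (x/(1-x)) 1 ((x/(1-x)+4)*(3*(x/(1-x))))
      (((x/(1-x)+4)*(3*(x/(1-x))))*((x/(1-x)+4)*(3*(x/(1-x))))) (D0 :: D) 0 1 (6*((x/(1-x)+4)*(3*(x/(1-x))))) 0 +
      2*((1-x)⁻¹)^d * dltP OR off (x/(1-x)) D0 dl) + W*(((1-x)⁻¹)^d*((1-x)⁻¹)^d)) := by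
    rw [← k1, ← g1, ← powP_eq]
    have : ∀ n, OR.lit n = (n:ℝ) := fun _ => rfl
    simp only [pairP, oneP, twoP, zP, this]
    simp only [OR]; push_cast; rfl
  rw [p, pairR, e1, e4, e3]
  have q1 : geg 8 ((x/(1-x)+4)*(3*(x/(1-x)))) (((x/(1-x)+4)*(3*(x/(1-x))))*((x/(1-x)+4)*(3*(x/(1-x))))) (0+1) =
     6*((x/(1-x)+4)*(3*(x/(1-x)))) := by simp only [geg]; norm_num
  have q2 : geg 9 (2*(1-x)⁻¹*((3*x-2)/2)) (4*((1-x)⁻¹*(1-x)⁻¹)) 1 = 7*(2*(1-x)⁻¹*((3*x-2)/2)) := by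
    simp only [geg]; norm_num
  rw [q1]
  rw [q2] at e2
  simp only [geg, sub_zero, div_one, mul_one] at e2 ⊢
  simp only [mul_zero, zero_add, pow_succ] at e2
  rw [mul_comm ((1-x)⁻¹ ^ (2*d)) ((1-x)⁻¹), mul_assoc ((1-x)⁻¹) ((1-x)⁻¹ ^ (2*d))] at e2
  have e2' := mul_left_cancel₀ (inv_ne_zero h1) e2
  rw [e2']
  have m2 : (1-x)^(2*d) = (1-x)^d * (1-x)^d := by rw [two_mul, pow_add]
  have m3 : ((1-x)*(1-x))^d = (1-x)^d * (1-x)^d := by rw [mul_pow]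
  rw [mul_add, ← mul_assoc, l2, m3, m2]
  generalize ((1-x)⁻¹)^d = b at *
  generalize (1-x)^d = a at *
  linear_combination (Λ * W * (a*b+1) + 2 * Λ * a * dltP OR off (x/(1-x)) D0 dl) * l3
end Kiss9

namespace Kiss9
noncomputable def ph0 (off d : ℕ) (c : List ℕ) (q : ℕ) (u : ℝ) : ℝ :=
  if u = 1 then (q:ℝ) - off else hor off ((2*u+2)/3) c d
noncomputable def phi0 (off d : ℕ) (u v : ℝ) : List (List ℕ) → List ℕ → ℝ
  | c :: cs, q :: qs => ph0 off d c q u * ph0 off d c q v + phi0 off d u v cs qs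
  | _, _ => 0
noncomputable def fF (off d : ℕ) (D0 : List (List ℕ)) (D : List (List (List ℕ))) (dl : List ℕ) (u v t : ℝ) : ℝ :=
  phi0 off d u v D0 dl + fsum off d u v t D 1

lemma phi0_psd (S : Finset E9) (hS : ∀ x ∈ S, ‖x‖ = 1) (x : E9) (hx : ‖x‖ = 1) (off d : ℕ) (b : List (List ℕ)) :
    ∀ l : List ℕ, 0 ≤ ∑ y ∈ S, ∑ z ∈ S, phi0 off d (inner ℝ x y) (inner ℝ x z) b l := by
  induction b with
  | nil => intro l; simp [phi0]
  | cons c cs ih =>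
    intro l
    cases l with
    | nil => simp [phi0]
    | cons q qs =>
      simp only [phi0, Finset.sum_add_distrib]
      have := psd8 S hS x hx (ph0 off d c q) 0
      simp only [geg, mul_one] at this
      exact add_nonneg this (ih qs)
lemma phiS_psd (S : Finset E9) (hS : ∀ x ∈ S, ‖x‖ = 1) (x : E9) (hx : ‖x‖ = 1) (off e k : ℕ) (b : List (List ℕ)) :
    0 ≤ ∑ y ∈ S, ∑ z ∈ S, 4^k * geg 8 (inner ℝ y z - inner ℝ x y * inner ℝ x z)
        ((1 - inner ℝ x y ^ 2) * (1 - inner ℝ x z ^ 2)) k *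
        phiS off ((2*inner ℝ x y+2)/3) ((2*inner ℝ x z+2)/3) e b := by
  induction b with
  | nil => simp [phiS]
  | cons c cs ih =>
    simp only [phiS, mul_add, Finset.sum_add_distrib]
    refine add_nonneg ?_ ih
    have := mul_nonneg (by positivity : (0:ℝ) ≤ 4^k) (psd8 S hS x hx (fun u => hor off ((2*u+2)/3) c e) k)
    refine le_of_le_of_eq this ?_
    simp only [Finset.mul_sum]
    refine Finset.sum_congr rfl fun y _ => Finset.sum_congr rfl fun z _ => ?_
    ring
lemma fsum_psd (S : Finset E9) (hS : ∀ x ∈ S, ‖x‖ = 1) (x : E9) (hx : ‖x‖ = 1) (off d : ℕ) (l : List (List (List ℕ))) :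
    ∀ k, 0 ≤ ∑ y ∈ S, ∑ z ∈ S, fsum off d (inner ℝ x y) (inner ℝ x z) (inner ℝ y z) l k := by
  induction l with
  | nil => intro k; simp [fsum]
  | cons b l ih =>
    intro k
    simp only [fsum, Finset.sum_add_distrib]
    exact add_nonneg (phiS_psd S hS x hx off (d-k) k b) (ih (k+1))
lemma asum_psd (S : Finset E9) (hS : ∀ x ∈ S, ‖x‖ = 1) (l : List ℕ) :
    ∀ k, 0 ≤ ∑ x ∈ S, ∑ y ∈ S, asum (inner ℝ x y) l k := by
  induction l with
  | nil => intro k; simp [asum]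
  | cons b l ih =>
    intro k
    simp only [asum, Finset.sum_add_distrib, ← Finset.mul_sum]
    exact add_nonneg (mul_nonneg (by positivity) (mul_nonneg (by positivity) (psd9 S hS k))) (ih (k+1))
lemma phiS_symm (off : ℕ) (x y : ℝ) (e : ℕ) (b : List (List ℕ)) : phiS off x y e b = phiS off y x e b := by
  induction b with
  | nil => rfl
  | cons c cs ih => simp only [phiS, ih, mul_comm]
lemma fsum_symm (off d : ℕ) (u v t : ℝ) (l : List (List (List ℕ))) : ∀ k, fsum off d u v t l k = fsum off d v u t l k := by
  induction l with
  | nil => intro k; rfl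
  | cons b l ih => intro k; simp only [fsum, ih, phiS_symm off ((2*u+2)/3), mul_comm u v, mul_comm (1-u^2)]
lemma phi0_symm (off d : ℕ) (u v : ℝ) (b : List (List ℕ)) : ∀ l, phi0 off d u v b l = phi0 off d v u b l := by
  induction b with
  | nil => intro l; simp [phi0]
  | cons c cs ih =>
    intro l
    cases l with
    | nil => simp [phi0]
    | cons q qs => simp only [phi0, ih qs, mul_comm]
lemma phi0_eq (off d : ℕ) (u v : ℝ) (hu : u ≠ 1) (hv : v ≠ 1) (b : List (List ℕ)) :
    ∀ l : List ℕ, b.length = l.length → phi0 off d u v b l = phiS off ((2*u+2)/3) ((2*v+2)/3) d b := by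
  induction b with
  | nil => intro l _; simp [phi0, phiS]
  | cons c cs ih =>
    intro l hl
    cases l with
    | nil => simp at hl
    | cons q qs => simp only [phi0, phiS, ph0, if_neg hu, if_neg hv, ih qs (by simpa using hl)]
lemma phi0_one (off d : ℕ) (u : ℝ) (hu : u ≠ 1) (b : List (List ℕ)) :
    ∀ l : List ℕ, phi0 off d 1 u b l = dsum off ((2*u+2)/3) d b l := by
  induction b with
  | nil => intro l; simp [phi0, dsum]
  | cons c cs ih =>
    intro l
    cases l with
    | nil => simp [phi0, dsum]
    | cons q qs => simp only [phi0, dsum, ph0, if_neg hu, if_true, ih qs]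
def dZ (off : ℕ) : List (List ℕ) → List ℕ → ℤ
  | _ :: cs, q :: qs => ((q:ℤ) - off)*((q:ℤ) - off) + dZ off cs qs
  | _, _ => 0
lemma phi0_one_one (off d : ℕ) (b : List (List ℕ)) :
    ∀ l : List ℕ, phi0 off d 1 1 b l = dZ off b l := by
  induction b with
  | nil => intro l; simp [phi0, dZ]
  | cons c cs ih =>
    intro l
    cases l with
    | nil => simp [phi0, dZ]
    | cons q qs => simp only [phi0, dZ, ph0, if_true, ih qs]; push_cast; rfl
lemma geg_zero (k : ℕ) : geg 8 (0:ℝ) 0 (k+1) = 0 := by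
  induction k using Nat.twoStepInduction with
  | zero => simp [geg]
  | one => simp [geg]
  | more k h1 h2 => rw [geg]; simp
lemma fsum_zero (off d : ℕ) (u v t : ℝ) (h1 : t = u * v) (h2 : (1-u^2)*(1-v^2) = 0) (l : List (List (List ℕ))) :
    ∀ k, fsum off d u v t l (k+1) = 0 := by
  induction l with
  | nil => intro k; rfl
  | cons b l ih => intro k; subst h1; simp only [fsum, ih, h2, sub_self, geg_zero]; simp
def aN : List ℕ → ℕ → ℕ → ℕ
  | [], _, _ => 0
  | b :: l, k, g => b * g + aN l (k+1) (g*(2*(k+7)))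
lemma geg_one (k : ℕ) : geg 9 (1:ℝ) 1 (k+1) = (k+7) * geg 9 (1:ℝ) 1 k := by
  induction k with
  | zero => simp [geg]
  | succ k ih =>
    rw [geg, ih]; push_cast; ring
lemma asum_one (l : List ℕ) : ∀ k g : ℕ, (g:ℝ) = 2^k * geg 9 (1:ℝ) 1 k → asum 1 l k = aN l k g := by
  induction l with
  | nil => intro k g _; simp [asum, aN]
  | cons b l ih =>
    intro k g hg
    simp only [asum, aN]
    rw [ih (k+1) (g*(2*(k+7))) (by push_cast; rw [hg, geg_one]; ring), ← hg]; push_cast; ring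

theorem final_of (off Λ W d : ℕ) (D0 : List (List ℕ)) (D : List (List (List ℕ))) (dl al : List ℕ)
    (hlen : D0.length = dl.length) (hΛ : 0 < Λ) (hW : 0 < W)
    (hp : ∀ u ∈ Set.Icc (-1:ℝ) (1/2), pairR off Λ W d D0 D dl al u ≤ 0)
    (ht : ∀ u ∈ Set.Icc (-1:ℝ) (1/2), ∀ v ∈ Set.Icc (-1:ℝ) (1/2), ∀ t ∈ Set.Icc (-1:ℝ) (1/2),
      0 ≤ 1+2*u*v*t-u^2-v^2-t^2 → tri off d (D0 :: D) u v t ≤ 0)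
    (hb : (aN al 0 1 : ℤ) + Λ * dZ off D0 dl < 364 * W * Λ)
    (S : Finset E9) (hS : ∀ x ∈ S, ‖x‖ = 1) (hd : ∀ x ∈ S, ∀ y ∈ S, x ≠ y → 1 ≤ dist x y) : S.card ≤ 364 := by
  have hL : (0:ℝ) < Λ := by exact_mod_cast hΛ
  have ne1 : ∀ u ∈ Set.Icc (-1:ℝ) (1/2), u ≠ 1 := by
    rintro u ⟨_, h⟩ rfl; norm_num at h
  have key : ∀ u ∈ Set.Icc (-1:ℝ) (1/2), ∀ v ∈ Set.Icc (-1:ℝ) (1/2), ∀ t,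
      fF off d D0 D dl u v t = fsum off d u v t (D0 :: D) 0 := by
    intro u hu v hv t
    simp only [fF, fsum, phi0_eq off d u v (ne1 u hu) (ne1 v hv) D0 dl hlen, geg]
    simp
  refine three_point S hS hd (fF off d D0 D dl) (fun u => asum u al 0 / Λ) W (by exact_mod_cast hW) ?_ ?_ ?_ ?_ ?_ ?_
  · intro x hx
    simp only [fF, Finset.sum_add_distrib]
    exact add_nonneg (phi0_psd S hS x (hS x hx) off d D0 dl) (fsum_psd S hS x (hS x hx) off d D 1)
  · intro u v t
    simp only [fF]; rw [phi0_symm, fsum_symm]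
  · simp only [← Finset.sum_div]
    exact div_nonneg (asum_psd S hS al 0) hL.le
  · intro u hu
    have h := hp u hu
    rw [pairR] at h
    have h1 : fF off d D0 D dl 1 u u = dsum off ((2*u+2)/3) d D0 dl := by
      rw [fF, phi0_one _ _ _ (ne1 u hu), fsum_zero off d 1 u u (by ring) (by ring), add_zero]
    rw [key u hu u hu, h1]
    have : asum u al 0 / Λ + (fsum off d u u 1 (D0 :: D) 0 + 2 * dsum off ((2*u+2)/3) d D0 dl + W) ≤ 0 := by
      have := div_nonpos_of_nonpos_of_nonneg h hL.le
      rwa [add_div, mul_div_cancel_left₀ _ hL.ne'] at this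
    linarith
  · intro u hu v hv t htt hdet
    rw [key u hu v hv, key u hu t htt, key v hv t htt]
    exact ht u hu v hv t htt hdet
  · have h1 : fF off d D0 D dl 1 1 1 = dZ off D0 dl := by
      rw [fF, phi0_one_one, fsum_zero off d 1 1 1 (by ring) (by ring), add_zero]
    have h2 := asum_one al 0 1 (by simp [geg])
    simp only [h1, h2]
    have h3 : (aN al 0 1 : ℝ) + Λ * dZ off D0 dl < 364 * W * Λ := by exact_mod_cast hb
    have : ((aN al 0 1 : ℝ) + Λ * dZ off D0 dl) / Λ < 364 * W := by rwa [div_lt_iff₀ hL]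
    rw [add_div, mul_div_cancel_left₀ _ hL.ne'] at this
    linarith
end Kiss9

namespace Kiss9
open Finset MvPolynomial

noncomputable def OD2 : Ops ℕ := ⟨Nat.max, Nat.max, fun a b => Nat.sub (Nat.add a b) 1, fun n => cond (Nat.beq n 0) 0 1,
  fun x k => force x k⟩
lemma rel_D2 (i : Fin 3) : Rel OP OD2 (fun p e => p = 0 ∨ degreeOf i p < e) where
  add := by
    rintro a b c d h1 h2
    show a + c = 0 ∨ degreeOf i (a + c) < max b d
    rcases h1 with rfl | h1
    · rcases h2 with rfl | h2
      · simp
      · right; rw [zero_add]; exact lt_max_of_lt_right h2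
    · rcases h2 with rfl | h2
      · right; rw [add_zero]; exact lt_max_of_lt_left h1
      · right; exact lt_of_le_of_lt (degreeOf_add_le i a c) (max_lt_max h1 h2)
  sub := by
    rintro a b c d h1 h2
    show a - c = 0 ∨ degreeOf i (a - c) < max b d
    rcases h1 with rfl | h1
    · rcases h2 with rfl | h2
      · simp
      · right
        refine lt_of_le_of_lt (degreeOf_sub_le i 0 c) ?_
        simp only [degreeOf_zero, Nat.zero_le, sup_of_le_right]; exact lt_max_of_lt_right h2
    · rcases h2 with rfl | h2
      · right; rw [sub_zero]; exact lt_max_of_lt_left h1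
      · right; exact lt_of_le_of_lt (degreeOf_sub_le i a c) (max_lt_max h1 h2)
  mul := by
    rintro a b c d h1 h2
    show a * c = 0 ∨ degreeOf i (a * c) < b + d - 1
    rcases h1 with rfl | h1
    · simp
    · rcases h2 with rfl | h2
      · simp
      · right; have := degreeOf_mul_le i a c; omega
  lit := by
    intro n
    show ((n:ℕ) : P3) = 0 ∨ degreeOf i ((n:ℕ) : P3) < cond (Nat.beq n 0) 0 1
    cases n with
    | zero => simp
    | succ n =>
      right
      have e1 : ((n+1 : ℕ) : P3) = C ((n+1:ℕ) : ℤ) := by simp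
      rw [e1, degreeOf_C]; exact Nat.one_pos
  seq := fun _ _ => rfl
  seq' := fun _ _ => force_eq _ _

noncomputable def OL (Mo ma : ℕ) : Ops ℕ :=
  ⟨fun a b => Nat.land (Nat.add a b) ma, fun a b => Nat.land (Nat.add a (Nat.sub Mo b)) ma,
   fun a b => Nat.land (Nat.mul a b) ma, fun n => Nat.land n ma, fun x k => force x k⟩
lemma OL_eq (K : ℕ) : OL (2 ^ K) (2 ^ K - 1) = OM (2 ^ K) := by
  have h : ∀ a : ℕ, Nat.land a (2 ^ K - 1) = Nat.mod a (2 ^ K) := fun a => Nat.and_two_pow_sub_one_eq_mod a K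
  unfold OL OM
  simp only [h]

/-- exponent vector -/
noncomputable def ex (i j k : ℕ) : Fin 3 →₀ ℕ := Finsupp.equivFunOnFinite.symm ![i, j, k]
noncomputable def cf (p : P3) (i j k : ℕ) : ℤ := coeff (ex i j k) p
lemma ex_inj {i j k i' j' k' : ℕ} (h : ex i j k = ex i' j' k') : i = i' ∧ j = j' ∧ k = k' := by
  have := Finsupp.equivFunOnFinite.symm.injective h
  exact ⟨congrFun this 0, congrFun this 1, congrFun this 2⟩
lemma ex_self (m : Fin 3 →₀ ℕ) : ex (m 0) (m 1) (m 2) = m := by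
  ext a; fin_cases a <;> rfl

lemma poly_sum {R : Type} [CommRing R] (p : P3) (n0 n1 n2 : ℕ) (h0 : p = 0 ∨ degreeOf 0 p < n0)
    (h1 : p = 0 ∨ degreeOf 1 p < n1) (h2 : p = 0 ∨ degreeOf 2 p < n2) (q : Fin 3 → R) :
    aeval q p = ∑ k ∈ range n2, ∑ j ∈ range n1, ∑ i ∈ range n0, (cf p i j k : R) * (q 0 ^ i * q 1 ^ j * q 2 ^ k) := by
  classical
  rcases h0 with rfl | h0
  · simp [cf]
  rcases h1 with rfl | h1
  · simp [cf]
  rcases h2 with rfl | h2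
  · simp [cf]
  have hs : ∀ m ∈ p.support, (m 2, m 1, m 0) ∈ range n2 ×ˢ (range n1 ×ˢ range n0) := by
    intro m hm
    have a := monomial_le_degreeOf 0 hm
    have b := monomial_le_degreeOf 1 hm
    have c := monomial_le_degreeOf 2 hm
    simp only [mem_product, mem_range]; omega
  rw [aeval_def, eval₂_eq']
  have e1 : ∑ k ∈ range n2, ∑ j ∈ range n1, ∑ i ∈ range n0, (cf p i j k : R) * (q 0 ^ i * q 1 ^ j * q 2 ^ k)
     = ∑ t ∈ range n2 ×ˢ (range n1 ×ˢ range n0), (cf p t.2.2 t.2.1 t.1 : R) * (q 0 ^ t.2.2 * q 1 ^ t.2.1 * q 2 ^ t.1) := by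
    rw [sum_product]
    exact sum_congr rfl fun k _ => by rw [sum_product]
  rw [e1]
  refine sum_of_injOn (fun m => (m 2, m 1, m 0)) ?_ (fun m hm => hs m hm) ?_ ?_
  · intro m _ m' _ h
    simp only [Prod.mk.injEq] at h
    rw [← ex_self m, ← ex_self m', h.1, h.2.1, h.2.2]
  · rintro ⟨k, j, i⟩ _ hn
    have : cf p i j k = 0 := by
      by_contra hc
      apply hn
      refine ⟨ex i j k, ?_, rfl⟩
      simpa [cf, mem_support_iff] using hc
    simp [this]
  · intro m _
    show _ = (cf p (m 0) (m 1) (m 2) : R) * (q 0 ^ m 0 * q 1 ^ m 1 * q 2 ^ m 2)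
    rw [cf, ex_self, Fin.prod_univ_three]
    simp

lemma pack_dim (w a : ℕ) (ha : 0 < a) (F : ℕ → ℕ → ℕ) (b : ℕ) :
    pack (w*a) b (fun j => pack w a (fun i => F i j)) = pack w (a*b) (fun I => F (I % a) (I / a)) := by
  induction b with
  | zero => simp [pack]
  | succ b ih =>
    rw [mul_add, mul_one, pack_append w (a*b) a, ← ih]
    conv_lhs => rw [pack, sum_range_succ]
    rw [pack]
    congr 1
    rw [mul_comm, mul_assoc]
    congr 1
    apply pack_congr
    intro i hi
    rw [Nat.mul_add_mod, Nat.mod_eq_of_lt hi, Nat.mul_add_div ha, Nat.div_eq_of_lt hi, add_zero]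

noncomputable def lp (sh ma ws : ℕ) (g : ℕ → ℕ → ℕ) (m : ℕ) : ℕ → ℕ → ℕ :=
  Nat.rec (motive := fun _ => ℕ → ℕ → ℕ) (fun _ _ => 0)
   (fun _ ih i Y => force (g i (Nat.land Y ma)) fun a => force (Nat.shiftRight Y sh) fun Y' =>
     force (Nat.add i 1) fun i' => force (ih i' Y') fun r => Nat.add a (Nat.shiftLeft r ws)) m
lemma lp_eq (sh ws : ℕ) (g : ℕ → ℕ → ℕ) (m : ℕ) : ∀ (i : ℕ) (y : ℕ → ℕ), (∀ j < m, y j < 2 ^ sh) →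
    lp sh (2 ^ sh - 1) ws g m i (pack sh m y) = pack ws m (fun j => g (i + j) (y j)) := by
  induction m with
  | zero => intro i y _; simp [lp, pack]
  | succ m ih =>
    intro i y hy
    change (force (g i (Nat.land (pack sh (m+1) y) (2 ^ sh - 1))) fun a => force (Nat.shiftRight (pack sh (m+1) y) sh) fun Y' =>
     force (Nat.add i 1) fun i' => force (lp sh (2 ^ sh - 1) ws g m i' Y') fun r => Nat.add a (Nat.shiftLeft r ws)) = _
    simp only [force_eq]
    have h1 : Nat.land (pack sh (m+1) y) (2 ^ sh - 1) = y 0 := by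
      have : Nat.land (pack sh (m+1) y) (2 ^ sh - 1) = (pack sh (m+1) y) % 2 ^ sh := Nat.and_two_pow_sub_one_eq_mod _ _
      rw [this, pack_succ, Nat.mul_add_mod, Nat.mod_eq_of_lt (hy 0 (by omega))]
    have h2 : Nat.shiftRight (pack sh (m+1) y) sh = pack sh m (fun j => y (j+1)) := by
      have : Nat.shiftRight (pack sh (m+1) y) sh = (pack sh (m+1) y) / 2 ^ sh := Nat.shiftRight_eq_div_pow _ _
      rw [this, pack_succ, Nat.mul_add_div (by positivity), Nat.div_eq_of_lt (hy 0 (by omega)), add_zero]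
    rw [h1, h2]
    have h3 := ih (Nat.add i 1) (fun j => y (j+1)) (fun j hj => hy _ (by omega))
    rw [h3, pack_succ ws m]
    have h4 : ∀ a r : ℕ, Nat.add a (Nat.shiftLeft r ws) = 2 ^ ws * r + a := by
      intro a r
      have : Nat.shiftLeft r ws = r * 2 ^ ws := Nat.shiftLeft_eq _ _
      rw [this]; show a + r * 2 ^ ws = _; ring
    rw [h4]
    congr 2
    apply pack_congr
    intro j _
    show g (i + 1 + j) _ = g (i + (j + 1)) _
    congr 1; omega

noncomputable def dig (K hB bad top S v : ℕ) : ℕ :=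
  force (Nat.div (Nat.sub (Nat.add v (Nat.mul K S)) hB) S) fun f => cond (Nat.ble f top) f bad
noncomputable def rootN (β w K hB bad top Sc n0 n1 n2 : ℕ) (b0 b1 b2 : ℕ → ℕ) (Y : ℕ) : ℕ :=
  force (β*n0) fun s1 => force (s1*n1) fun s2 => force (w*n0) fun w1 => force (w1*n1) fun w2 =>
  force (2 ^ β - 1) fun m0 => force (2 ^ s1 - 1) fun m1 => force (2 ^ s2 - 1) fun m2 =>
  lp s2 m2 w2 (fun k Yk => force (Nat.mul (b2 k) Sc) fun t2 =>
   lp s1 m1 w1 (fun j Yj => force (Nat.mul (b1 j) t2) fun t1 =>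
    lp β m0 w (fun i v => force (Nat.mul (b0 i) t1) fun s => dig K hB bad top s v) n0 0 Yj) n1 0 Yk) n2 0 Y

lemma rootN_eq (β w K hB bad top Sc n0 n1 n2 : ℕ) (b0 b1 b2 : ℕ → ℕ) (h0 : 0 < n0) (h1 : 0 < n1)
    (F : ℕ → ℕ → ℕ → ℕ) (hF : ∀ i < n0, ∀ j < n1, ∀ k < n2, F i j k < 2 ^ β) :
    rootN β w K hB bad top Sc n0 n1 n2 b0 b1 b2 (pack β (n0*n1*n2) (fun I => F (I % n0) (I / n0 % n1) (I / n0 / n1)))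
    = pack w (n0*n1*n2) (fun I => dig K hB bad top (b0 (I % n0) * (b1 (I / n0 % n1) * (b2 (I / n0 / n1) * Sc)))
        (F (I % n0) (I / n0 % n1) (I / n0 / n1))) := by
  have P : ∀ (u : ℕ) (G : ℕ → ℕ → ℕ → ℕ), pack u (n0*n1*n2) (fun I => G (I % n0) (I / n0 % n1) (I / n0 / n1)) =
     pack (u*n0*n1) n2 (fun k => pack (u*n0) n1 (fun j => pack u n0 (fun i => G i j k))) := by
    intro u G
    rw [pack_dim (u*n0) n1 h1 (fun j k => pack u n0 (fun i => G i j k)) n2,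
      pack_dim u n0 h0 (fun i J => G i (J % n1) (J / n1)) (n1*n2), mul_assoc]
  rw [P β F, P w (fun i j k => dig K hB bad top (b0 i * (b1 j * (b2 k * Sc))) (F i j k))]
  simp only [rootN, force_eq]
  have b1' : ∀ j < n1, ∀ k < n2, pack β n0 (fun i => F i j k) < 2 ^ (β*n0) := fun j hj k hk =>
    pack_lt _ _ _ fun i hi => hF i hi j hj k hk
  rw [lp_eq (β*n0*n1) (w*n0*n1)]
  · apply pack_congr
    intro k hk
    rw [lp_eq (β*n0) (w*n0)]
    · apply pack_congr
      intro j hj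
      rw [lp_eq β w]
      · apply pack_congr
        intro i hi
        simp only [zero_add]
        rfl
      · exact fun i hi => hF i hi j hj k hk
    · exact fun j hj => b1' j hj k hk
  · intro k hk
    exact pack_lt _ _ _ fun j hj => b1' j hj k hk
end Kiss9

namespace Kiss9
open Finset MvPolynomial

noncomputable def Pp (p : P3) (n0 n1 n2 Sc : ℕ) (x y z : ℝ) : ℝ :=
  (∑ k ∈ range n2, ∑ j ∈ range n1, ∑ i ∈ range n0, (cf p i j k : ℝ) *
    ((x ^ i * (1-x) ^ (n0-1-i)) * (y ^ j * (1-y) ^ (n1-1-j)) * (z ^ k * (1-z) ^ (n2-1-k)))) / Sc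
lemma Pp_eq (p : P3) (n0 n1 n2 Sc : ℕ) (h0 : p = 0 ∨ degreeOf 0 p < n0)
    (h1 : p = 0 ∨ degreeOf 1 p < n1) (h2 : p = 0 ∨ degreeOf 2 p < n2) (x y z : ℝ) (hx : x < 1) (hy : y < 1) (hz : z < 1) :
    Pp p n0 n1 n2 Sc x y z = ((1-x)^(n0-1) * (1-y)^(n1-1) * (1-z)^(n2-1)) * aeval ![x/(1-x), y/(1-y), z/(1-z)] p / Sc := by
  rw [poly_sum p n0 n1 n2 h0 h1 h2, Pp]
  congr 1
  rw [mul_sum]; refine sum_congr rfl fun k hk => ?_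
  rw [mul_sum]; refine sum_congr rfl fun j hj => ?_
  rw [mul_sum]; refine sum_congr rfl fun i hi => ?_
  have key : ∀ (x : ℝ) (n i : ℕ), x < 1 → i < n → x ^ i * (1-x) ^ (n-1-i) = (1-x)^(n-1) * (x/(1-x))^i := by
    intro x n i hx hi
    have : (1 - x) ≠ 0 := by linarith
    rw [show n - 1 = (n-1-i) + i by omega, pow_add, div_pow]
    field_simp
    rw [show n - 1 - i + i - i = n - 1 - i by omega]
  rw [key x n0 i hx (mem_range.1 hi), key y n1 j hy (mem_range.1 hj), key z n2 k hz (mem_range.1 hk)]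
  simp only [Matrix.cons_val_zero, Matrix.cons_val_one, Matrix.cons_val]
  ring
lemma Pp_cont (p : P3) (n0 n1 n2 Sc : ℕ) : Continuous fun t : ℝ × ℝ × ℝ => Pp p n0 n1 n2 Sc t.1 t.2.1 t.2.2 := by
  unfold Pp; fun_prop

lemma pack_sum3 (β n0 n1 n2 : ℕ) (F : ℕ → ℕ → ℕ → ℕ) (h0 : 0 < n0) (h1 : 0 < n1) :
    pack β (n0*n1*n2) (fun I => F (I % n0) (I / n0 % n1) (I / n0 / n1)) =
      ∑ k ∈ range n2, ∑ j ∈ range n1, ∑ i ∈ range n0, F i j k * ((2^β)^i * (2^(β*n0))^j * (2^(β*n0*n1))^k) := by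
  have e := pack_dim (β*n0) n1 h1 (fun j k => pack β n0 (fun i => F i j k)) n2
  rw [pack_dim β n0 h0 (fun i J => F i (J % n1) (J / n1)) (n1*n2), ← mul_assoc] at e
  rw [← e]
  unfold pack
  refine sum_congr rfl fun k _ => ?_
  rw [sum_mul]; refine sum_congr rfl fun j _ => ?_
  rw [sum_mul, sum_mul]; refine sum_congr rfl fun i _ => ?_
  rw [← pow_mul, ← pow_mul, ← pow_mul]; ring

lemma digits_eq (p : P3) (β M n0 n1 n2 Z : ℕ) (h0 : 0 < n0) (h1 : 0 < n1) (hβ : 0 < β) (hM : Maj p M) (hMB : M < 2 ^ (β-1))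
    (d0 : p = 0 ∨ degreeOf 0 p < n0) (d1 : p = 0 ∨ degreeOf 1 p < n1) (d2 : p = 0 ∨ degreeOf 2 p < n2)
    (hZ : ((Z : ℤ) : ZMod (2^(β*(n0*n1*n2)))) = ((eval ![2^β, 2^(β*n0), 2^(β*n0*n1)] p : ℤ) : ZMod (2^(β*(n0*n1*n2))))) :
    (Z + 2^(β-1) * ones β (n0*n1*n2)) % 2^(β*(n0*n1*n2)) =
     pack β (n0*n1*n2) (fun I => (fun i j k => (cf p i j k + 2^(β-1)).toNat) (I % n0) (I / n0 % n1) (I / n0 / n1)) := by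
  have hb : ∀ i j k, 0 ≤ cf p i j k + 2^(β-1) ∧ (cf p i j k + 2^(β-1)).toNat < 2^β := by
    intro i j k
    have a := maj_coeff hM (ex i j k)
    have b : (M:ℤ) < 2^(β-1) := by exact_mod_cast hMB
    have c : (2:ℤ)^β = 2 * 2^(β-1) := by rw [← pow_succ']; congr 1; omega
    have e := abs_le.1 a
    change -(M:ℤ) ≤ cf p i j k ∧ cf p i j k ≤ M at e
    refine ⟨by linarith, ?_⟩
    zify
    rw [Int.toNat_of_nonneg (by linarith), c]; linarith
  have hlt := pack_lt β (n0*n1*n2) (fun I => (fun i j k => (cf p i j k + 2^(β-1)).toNat) (I % n0) (I / n0 % n1) (I / n0 / n1))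
    (fun I _ => (hb _ _ _).2)
  rw [← Nat.mod_eq_of_lt hlt]
  change Nat.ModEq _ _ _
  rw [← ZMod.natCast_eq_natCast_iff]
  have e1 : ((pack β (n0*n1*n2) (fun I => (fun i j k => (cf p i j k + 2^(β-1)).toNat) (I % n0) (I / n0 % n1) (I / n0 / n1)) : ℕ) : ℤ)
     = eval ![2^β, 2^(β*n0), 2^(β*n0*n1)] p + 2^(β-1) * (ones β (n0*n1*n2) : ℕ) := by
    rw [pack_sum3 β n0 n1 n2 (fun i j k => (cf p i j k + 2^(β-1)).toNat) h0 h1, ones_eq _ _ hβ, pack_sum3 β n0 n1 n2 (fun _ _ _ => 1) h0 h1]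
    have := poly_sum (R := ℤ) p n0 n1 n2 d0 d1 d2 ![2^β, 2^(β*n0), 2^(β*n0*n1)]
    rw [← coe_aeval_eq_eval]
    change _ = aeval _ p + _
    rw [this]
    push_cast
    rw [mul_sum, ← sum_add_distrib]; refine sum_congr rfl fun k _ => ?_
    rw [mul_sum, ← sum_add_distrib]; refine sum_congr rfl fun j _ => ?_
    rw [mul_sum, ← sum_add_distrib]; refine sum_congr rfl fun i _ => ?_
    rw [Int.toNat_of_nonneg (hb i j k).1]
    ring
  have e2 := congrArg (fun t : ℤ => (t : ZMod (2^(β*(n0*n1*n2))))) e1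
  simp only [Int.cast_add, ← hZ] at e2
  simp only [Int.cast_natCast] at e2
  rw [e2]
  push_cast
  ring

lemma aux_fld (c A B C S x1 x2 y1 y2 z1 z2 t : ℝ) (hA : A ≠ 0) (hB : B ≠ 0) (hC : C ≠ 0) (hS : S ≠ 0) :
    A * x1 * x2 * (B * y1 * y2) * (C * z1 * z2) * (c / (A * (B * (C * S))) + t) =
     c * (x1 * x2 * (y1 * y2) * (z1 * z2)) / S + A * x1 * x2 * (B * y1 * y2) * (C * z1 * z2) * t := by
  field_simp

lemma root_rep (p : P3) (β w kk M Sc n0 n1 n2 Z : ℕ) (b0 b1 b2 : ℕ → ℕ) (h0 : 0 < n0) (h1 : 0 < n1) (h2 : 0 < n2)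
    (hβ : 0 < β) (hSc : 0 < Sc) (hM : Maj p M) (hMB : M < 2 ^ (β-1))
    (d0 : p = 0 ∨ degreeOf 0 p < n0) (d1 : p = 0 ∨ degreeOf 1 p < n1) (d2 : p = 0 ∨ degreeOf 2 p < n2)
    (c0 : ∀ i < n0, b0 i = (n0-1).choose i) (c1 : ∀ i < n1, b1 i = (n1-1).choose i) (c2 : ∀ i < n2, b2 i = (n2-1).choose i)
    (hZ : ((Z : ℤ) : ZMod (2^(β*(n0*n1*n2)))) = ((eval ![2^β, 2^(β*n0), 2^(β*n0*n1)] p : ℤ) : ZMod (2^(β*(n0*n1*n2)))))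
    (X : ℕ) (hXe : X = rootN β w (2^kk+1) (2^(β-1)) (2^(w*(n0*n1*n2))) (2^(kk+1)-1) Sc n0 n1 n2 b0 b1 b2
      ((Z + 2^(β-1) * ones β (n0*n1*n2)) % 2^(β*(n0*n1*n2))))
    (hX : X < 2^(w*(n0*n1*n2))) : Rep w kk n0 n1 n2 (Pp p n0 n1 n2 Sc) X := by
  have hb : ∀ i j k, 0 ≤ cf p i j k + 2^(β-1) ∧ (cf p i j k + 2^(β-1)).toNat < 2^β := by
    intro i j k
    have a := maj_coeff hM (ex i j k)
    have b : (M:ℤ) < 2^(β-1) := by exact_mod_cast hMB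
    have c : (2:ℤ)^β = 2 * 2^(β-1) := by rw [← pow_succ']; congr 1; omega
    have e := abs_le.1 a
    change -(M:ℤ) ≤ cf p i j k ∧ cf p i j k ≤ M at e
    refine ⟨by linarith, ?_⟩
    zify
    rw [Int.toNat_of_nonneg (by linarith), c]; linarith
  rw [digits_eq p β M n0 n1 n2 Z h0 h1 hβ hM hMB d0 d1 d2 hZ,
    rootN_eq _ _ _ _ _ _ _ _ _ _ _ _ _ h0 h1 (fun i j k => (cf p i j k + 2^(β-1)).toNat) (fun i _ j _ k _ => (hb i j k).2)] at hXe
  set f : ℕ → ℕ := fun I => dig (2^kk+1) (2^(β-1)) (2^(w*(n0*n1*n2))) (2^(kk+1)-1) (b0 (I % n0) * (b1 (I / n0 % n1) * (b2 (I / n0 / n1) * Sc)))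
        ((cf p (I % n0) (I / n0 % n1) (I / n0 / n1) + 2^(β-1)).toNat) with hf
  have hdig : ∀ I < n0*n1*n2, f I ≤ 2^(kk+1)-1 ∧
      f I = (((cf p (I % n0) (I / n0 % n1) (I / n0 / n1) + 2^(β-1)).toNat + (2^kk+1) *
        (b0 (I % n0) * (b1 (I / n0 % n1) * (b2 (I / n0 / n1) * Sc)))) - 2^(β-1)) /
         (b0 (I % n0) * (b1 (I / n0 % n1) * (b2 (I / n0 / n1) * Sc))) := by
    intro I hI
    have hle : f I ≤ X := by
      rw [hXe, pack]
      refine le_trans ?_ (single_le_sum (f := fun i => f i * 2 ^ (w * i)) (fun _ _ => Nat.zero_le _) (mem_range.2 hI))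
      exact Nat.le_mul_of_pos_right _ (by positivity)
    have hlt : f I < 2^(w*(n0*n1*n2)) := lt_of_le_of_lt hle hX
    simp only [hf, dig, force_eq] at hlt ⊢
    cases g : (Nat.ble (Nat.div (Nat.sub (Nat.add ((cf p (I % n0) (I / n0 % n1) (I / n0 / n1) + 2^(β-1)).toNat) (Nat.mul (2^kk+1)
        (b0 (I % n0) * (b1 (I / n0 % n1) * (b2 (I / n0 / n1) * Sc))))) (2^(β-1)))
         (b0 (I % n0) * (b1 (I / n0 % n1) * (b2 (I / n0 / n1) * Sc)))) (2^(kk+1)-1)) <;> simp only [g, cond_true, cond_false] at hlt ⊢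
    · simp at hlt
    · exact ⟨Nat.le_of_ble_eq_true g, rfl⟩
  refine ⟨f, hXe, fun I hI => (hdig I hI).1, ?_⟩
  intro x hx y hy z hz
  have hev : ev n0 n1 n2 (fun I => (cf p (I % n0) (I / n0 % n1) (I / n0 / n1) : ℝ) /
       (((n0-1).choose (I % n0) : ℝ) * (((n1-1).choose (I / n0 % n1) : ℝ) * (((n2-1).choose (I / n0 / n1) : ℝ) * Sc))) + 2^kk) x y z
      = Pp p n0 n1 n2 Sc x y z + 2^kk := by
    have := ev_const h0 h1 h2 ((2:ℝ)^kk) x y z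
    rw [show Pp p n0 n1 n2 Sc x y z + (2:ℝ)^kk = Pp p n0 n1 n2 Sc x y z + ev n0 n1 n2 (fun _ => (2:ℝ)^kk) x y z by rw [this]]
    unfold ev Pp
    rw [sum_div, ← sum_add_distrib]; refine sum_congr rfl fun k hk => ?_
    rw [sum_div, ← sum_add_distrib]; refine sum_congr rfl fun j hj => ?_
    rw [sum_div, ← sum_add_distrib]; refine sum_congr rfl fun i hi => ?_
    have hi' := mem_range.1 hi
    have hj' := mem_range.1 hj
    have hk' := mem_range.1 hk
    have e0 : (i + n0 * (j + n1 * k)) % n0 = i := by rw [Nat.add_mul_mod_self_left, Nat.mod_eq_of_lt hi']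
    have e1 : (i + n0 * (j + n1 * k)) / n0 = j + n1 * k := by
      rw [Nat.add_mul_div_left _ _ h0, Nat.div_eq_of_lt hi', zero_add]
    have e2 : (j + n1 * k) % n1 = j := by rw [Nat.add_mul_mod_self_left, Nat.mod_eq_of_lt hj']
    have e3 : (j + n1 * k) / n1 = k := by rw [Nat.add_mul_div_left _ _ h1, Nat.div_eq_of_lt hj', zero_add]
    simp only [e0, e1, e2, e3]
    have p0 : ((n0-1).choose i : ℝ) ≠ 0 := by exact_mod_cast (Nat.choose_pos (by omega)).ne'
    have p1 : ((n1-1).choose j : ℝ) ≠ 0 := by exact_mod_cast (Nat.choose_pos (by omega)).ne'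
    have p2 : ((n2-1).choose k : ℝ) ≠ 0 := by exact_mod_cast (Nat.choose_pos (by omega)).ne'
    have p3 : (Sc : ℝ) ≠ 0 := by exact_mod_cast hSc.ne'
    unfold Bw
    exact aux_fld _ _ _ _ _ _ _ _ _ _ _ _ p0 p1 p2 p3
  rw [← hev]
  apply ev_mono hx hy hz
  intro I hI
  have l0 : I % n0 < n0 := Nat.mod_lt _ h0
  have l1 : I / n0 % n1 < n1 := Nat.mod_lt _ h1
  have l2 : I / n0 / n1 < n2 := by
    rw [Nat.div_div_eq_div_mul]; exact Nat.div_lt_of_lt_mul hI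
  obtain ⟨_, hf2⟩ := hdig I hI
  rw [c0 _ l0, c1 _ l1, c2 _ l2] at hf2
  obtain ⟨q1, q2⟩ := hb (I % n0) (I / n0 % n1) (I / n0 / n1)
  generalize hc : cf p (I % n0) (I / n0 % n1) (I / n0 / n1) = c at *
  have hS : 0 < (n0-1).choose (I % n0) * ((n1-1).choose (I / n0 % n1) * ((n2-1).choose (I / n0 / n1) * Sc)) := by
    have := Nat.choose_pos (show I % n0 ≤ n0 - 1 by omega)
    have := Nat.choose_pos (show I / n0 % n1 ≤ n1 - 1 by omega)
    have := Nat.choose_pos (show I / n0 / n1 ≤ n2 - 1 by omega)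
    positivity
  have e4 : (((n0-1).choose (I % n0) : ℝ) * (((n1-1).choose (I / n0 % n1) : ℝ) * (((n2-1).choose (I / n0 / n1) : ℝ) * Sc)))
    = (((n0-1).choose (I % n0) * ((n1-1).choose (I / n0 % n1) * ((n2-1).choose (I / n0 / n1) * Sc)) : ℕ) : ℝ) := by push_cast; ring
  rw [e4]
  generalize (n0-1).choose (I % n0) * ((n1-1).choose (I / n0 % n1) * ((n2-1).choose (I / n0 / n1) * Sc)) = S at *
  have hS' : (0:ℝ) < S := by exact_mod_cast hS
  have e5 : c + (2^kk+1) * (S:ℤ) < S * ((f I : ℤ) + 1) := by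
    have a := Nat.lt_mul_div_succ (((c + 2^(β-1)).toNat + (2^kk+1) * S) - 2^(β-1)) hS
    rw [← hf2] at a
    have b : (((c + 2^(β-1)).toNat + (2^kk+1) * S : ℕ) : ℤ) - ((2^(β-1) : ℕ) : ℤ) < S * ((f I : ℤ) + 1) := by
      generalize (c + 2^(β-1)).toNat + (2^kk+1) * S = A at *
      generalize 2^(β-1) = Bq at *
      have a' : A - Bq < S * (f I + 1) := a
      have e7 : ((S * (f I + 1) : ℕ) : ℤ) = S * ((f I : ℤ) + 1) := by push_cast; ring
      rw [← e7]
      omega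
    rw [Nat.cast_add, Int.toNat_of_nonneg q1] at b
    push_cast at b
    linarith
  have e6 : (c:ℝ) + (2^kk+1) * S < S * ((f I : ℝ) + 1) := by exact_mod_cast e5
  rw [div_add' _ _ _ hS'.ne', div_le_iff₀ hS']
  nlinarith
end Kiss9

namespace Kiss9
open Finset

inductive Tr where
  | s (l r : Tr)
  | f (a m : ℕ)
  | o (n : ℕ)
  | e (n : ℕ)
  | k

lemma ev_lin {n0 n1 n2 : ℕ} (f g : ℕ → ℝ) (a b x y z : ℝ) :
    ev n0 n1 n2 (fun i => a * f i + b * g i) x y z = a * ev n0 n1 n2 f x y z + b * ev n0 n1 n2 g x y z := by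
  unfold ev
  simp only [mul_sum, ← sum_add_distrib]
  refine sum_congr rfl fun k _ => sum_congr rfl fun j _ => sum_congr rfl fun i _ => by ring

lemma leaf_sound2 {w kk n0 n1 n2 : ℕ} (hw : kk + 2 ≤ w) (h0 : 0 < n0) (h1 : 0 < n1) (h2 : 0 < n2)
    {P P' : ℝ → ℝ → ℝ → ℝ} {X Y a m : ℕ} (h : Rep w kk n0 n1 n2 P X) (h' : Rep w kk n0 n1 n2 P' Y)
    (ham : a + m ≤ 2 ^ (w - kk - 2)) (c : ℝ) (hc1 : c * 2 ^ (w - kk - 2) < 1) (hc0 : 0 < c)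
    (hX : Nat.land (a * X + m * Y + (2 ^ (w-1) - (a + m) * 2 ^ kk) * ones w (n0*n1*n2)) (2 ^ (w-1) * ones w (n0*n1*n2)) = 0) :
    ∀ x ∈ Set.Icc (0:ℝ) 1, ∀ y ∈ Set.Icc (0:ℝ) 1, ∀ z ∈ Set.Icc (0:ℝ) 1, min (P x y z) (P' x y z) + c < 0 := by
  obtain ⟨f, rfl, hf, hP⟩ := h
  obtain ⟨g, rfl, hg, hP'⟩ := h'
  have hc : (a + m) * 2 ^ kk ≤ 2 ^ (w-2) := by
    calc _ ≤ 2 ^ (w - kk - 2) * 2 ^ kk := Nat.mul_le_mul_right _ ham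
      _ = _ := by rw [← pow_add]; congr 1; omega
  have hw1 : 2 ^ (w-1) = 2 * 2 ^ (w-2) := by rw [← pow_succ']; congr 1; omega
  have hw2 : 2 ^ w = 4 * 2 ^ (w-2) := by rw [show 4 = 2^2 by rfl, ← pow_add]; congr 1; omega
  have hx1 : ∀ i < n0*n1*n2, a * f i + m * g i ≤ 2 * ((a+m) * 2 ^ kk) := by
    intro i hi
    have e : 2^(kk+1) = 2 * 2^kk := by rw [pow_succ']
    have a1 := hf i hi
    have a2 := hg i hi
    calc a * f i + m * g i ≤ a * (2 * 2^kk) + m * (2*2^kk) :=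
          Nat.add_le_add (Nat.mul_le_mul_left _ (by omega)) (Nat.mul_le_mul_left _ (by omega))
      _ = _ := by ring
  rw [ones_eq _ _ (by omega), pack_mul, pack_mul, pack_mul, pack_mul, pack_add, pack_add] at hX
  have hX' : pack w (n0*n1*n2) (fun i => a * f i + m * g i + (2 ^ (w-1) - (a + m) * 2 ^ kk) * 1) &&&
     pack w (n0*n1*n2) (fun _ => 2 ^ (w-1) * 1) = 0 := hX
  have hp : 0 < 2 ^ (w-2) := by positivity
  rw [pack_and _ _ _ _ (fun i hi => by have := hx1 i hi; omega) (fun i _ => by omega)] at hX'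
  have h3 := pack_eq_zero hX'
  by_cases hz : a + m = 0
  · exfalso
    obtain ⟨rfl, rfl⟩ : a = 0 ∧ m = 0 := by omega
    have := h3 0 (by positivity)
    simp at this
  have h4 : ∀ i < n0*n1*n2, a * f i + m * g i + 1 ≤ (a + m) * 2 ^ kk := by
    intro i hi
    have q := h3 i hi
    have b := hx1 i hi
    simp only [mul_one, Nat.and_two_pow] at q
    generalize a * f i + m * g i = A at *
    generalize (a+m) * 2 ^ kk = Bq at *
    by_contra hcon
    have : (A + (2 ^ (w-1) - Bq)).testBit (w-1) = true := by
      rw [Nat.testBit_eq_decide_div_mod_eq]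
      have : (A + (2 ^ (w-1) - Bq)) / 2 ^ (w-1) = 1 := by
        rw [Nat.div_eq_iff (by positivity)]
        omega
      simp [this]
    rw [this] at q; simp at q
  intro x hx y hy z hz
  have u1 := hP x hx y hy z hz
  have u2 := hP' x hx y hy z hz
  have h5 : ev n0 n1 n2 (fun i => (a:ℝ) * (f i : ℝ) + (m:ℝ) * (g i : ℝ)) x y z ≤ ev n0 n1 n2 (fun _ => (a + m : ℝ) * (2:ℝ) ^ kk - 1) x y z :=
    ev_mono hx hy hz fun i hi => by
      have : ((a * f i + m * g i + 1 : ℕ) : ℝ) ≤ (((a+m) * 2 ^ kk : ℕ) : ℝ) := by exact_mod_cast h4 i hi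
      push_cast at this; linarith
  rw [ev_const h0 h1 h2, ev_lin] at h5
  have v1 := mul_le_mul_of_nonneg_left u1 (Nat.cast_nonneg (α := ℝ) a)
  have v2 := mul_le_mul_of_nonneg_left u2 (Nat.cast_nonneg (α := ℝ) m)
  by_contra hcon
  have hcon := not_lt.1 hcon
  have g1 : 0 ≤ P x y z + c := hcon.trans (by gcongr; exact min_le_left _ _)
  have g2 : 0 ≤ P' x y z + c := hcon.trans (by gcongr; exact min_le_right _ _)
  have g3 : (a + m : ℝ) ≤ 2 ^ (w - kk - 2) := by exact_mod_cast ham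
  have g4 := mul_le_mul_of_nonneg_left g3 hc0.le
  have w1 := mul_nonneg (Nat.cast_nonneg (α := ℝ) a) g1
  have w2 := mul_nonneg (Nat.cast_nonneg (α := ℝ) m) g2
  linarith

noncomputable def go2 (C : Ctx) (on hi half cap kp : ℕ) (t : Tr) : ℕ → ℕ → Bx → Bool :=
  Tr.rec (motive := fun _ => ℕ → ℕ → Bx → Bool)
   (fun _ _ ihl ihr X Y B => cond (evOk B)
     (doH (selAx B C.A0 C.A1 C.A2) false X fun X0 => doH (selAx B C.A0 C.A1 C.A2) false Y fun Y0 =>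
      forceB (child false B) fun B0 => cond (ihl X0 Y0 B0)
       (doH (selAx B C.A0 C.A1 C.A2) true X fun X0 => doH (selAx B C.A0 C.A1 C.A2) true Y fun Y0 =>
        forceB (child true B) fun B0 => ihr X0 Y0 B0) false) false)
   (fun a m X Y _ => cond (Nat.ble (Nat.add a m) cap)
     (Nat.beq (Nat.land (Nat.add (Nat.add (Nat.mul a X) (Nat.mul m Y)) (Nat.mul (Nat.sub half (Nat.mul (Nat.add a m) kp)) on)) hi) 0) false)
   (fun n X _ B => go C n X B)
   (fun n _ Y B => go C n Y B)
   (fun _ _ B => skipB B) t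

lemma good_mono {Q Q' : ℝ → ℝ → ℝ → ℝ} (h : ∀ x y z, Q' x y z ≤ Q x y z) {wd B} (hG : Good Q wd B) : Good Q' wd B :=
  fun x hx y hy z hz hwd => lt_of_le_of_lt (h _ _ _) (hG x hx y hy z hz hwd)

lemma go2_sound {w kk n0 n1 n2 : ℕ} (h0 : 0 < n0) (h1 : 0 < n1) (h2 : 0 < n2) (hw : kk + 2 ≤ w)
    (w0 : n0 + kk ≤ w) (w1 : n1 + kk ≤ w) (w2 : n2 + kk ≤ w) (Q Q' : ℝ → ℝ → ℝ → ℝ)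
    (c : ℝ) (hc1 : c * 2 ^ (w - kk - 2) < 1) (hc0 : 0 < c) (t : Tr) :
    ∀ (X Y : ℕ) (B : Bx), Rep w kk n0 n1 n2 (PB Q B) X → Rep w kk n0 n1 n2 (PB Q' B) Y →
     go2 (ctxOf w kk n0 n1 n2 true) (ones w (n0*n1*n2)) (2 ^ (w-1) * ones w (n0*n1*n2)) (2 ^ (w-1)) (2 ^ (w - kk - 2)) (2 ^ kk) t X Y B = true →
       Good (fun x y z => min (Q x y z) (Q' x y z) + c) true B := by
  have hc : c < 1 := by
    have : (1:ℝ) ≤ 2 ^ (w - kk - 2) := one_le_pow₀ (by norm_num)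
    nlinarith
  induction t with
  | s l r ihl ihr =>
    intro X Y B hR hR' h
    change cond (evOk B) (doH (selAx B (ctxOf w kk n0 n1 n2 true).A0 (ctxOf w kk n0 n1 n2 true).A1 (ctxOf w kk n0 n1 n2 true).A2) false X fun X0 => doH (selAx B (ctxOf w kk n0 n1 n2 true).A0 (ctxOf w kk n0 n1 n2 true).A1 (ctxOf w kk n0 n1 n2 true).A2) false Y fun Y0 =>
      forceB (child false B) fun B0 => cond (go2 (ctxOf w kk n0 n1 n2 true) (ones w (n0*n1*n2)) (2 ^ (w-1) * ones w (n0*n1*n2)) (2 ^ (w-1)) (2 ^ (w - kk - 2)) (2 ^ kk) l X0 Y0 B0)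
       (doH (selAx B (ctxOf w kk n0 n1 n2 true).A0 (ctxOf w kk n0 n1 n2 true).A1 (ctxOf w kk n0 n1 n2 true).A2) true X fun X0 => doH (selAx B (ctxOf w kk n0 n1 n2 true).A0 (ctxOf w kk n0 n1 n2 true).A1 (ctxOf w kk n0 n1 n2 true).A2) true Y fun Y0 =>
        forceB (child true B) fun B0 => go2 (ctxOf w kk n0 n1 n2 true) (ones w (n0*n1*n2)) (2 ^ (w-1) * ones w (n0*n1*n2)) (2 ^ (w-1)) (2 ^ (w - kk - 2)) (2 ^ kk) r X0 Y0 B0) false) false = true at h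
    cases g3 : evOk B <;> rw [g3] at h
    · simp at h
    · rw [cond_true] at h
      simp only [doH_eq, forceB_eq] at h
      rw [Bool.cond_false_right, Bool.and_eq_true] at h
      refine comb _ true B g3 fun b => ?_
      cases b
      · exact ihl _ _ _ (child_rep h0 h1 h2 w0 w1 w2 Q true B g3 X false hR) (child_rep h0 h1 h2 w0 w1 w2 Q' true B g3 Y false hR') h.1
      · exact ihr _ _ _ (child_rep h0 h1 h2 w0 w1 w2 Q true B g3 X true hR) (child_rep h0 h1 h2 w0 w1 w2 Q' true B g3 Y true hR') h.2
  | f a m =>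
    intro X Y B hR hR' h
    change cond (Nat.ble (Nat.add a m) (2 ^ (w - kk - 2))) _ false = true at h
    rw [Bool.cond_false_right, Bool.and_eq_true] at h
    intro x hx y hy z hz _
    exact leaf_sound2 hw h0 h1 h2 hR hR' (Nat.le_of_ble_eq_true h.1) c hc1 hc0 (Nat.eq_of_beq_eq_true h.2) x hx y hy z hz
  | o n =>
    intro X Y B hR hR' h
    exact good_mono (fun _ _ _ => by gcongr; exact min_le_left _ _) (go_sound h0 h1 h2 w0 w1 w2 Q true c hc n X B hR h)
  | e n =>
    intro X Y B hR hR' h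
    exact good_mono (fun _ _ _ => by gcongr; exact min_le_right _ _) (go_sound h0 h1 h2 w0 w1 w2 Q' true c hc n Y B hR' h)
  | k =>
    intro X Y B hR hR' h
    change skipB B = true at h
    intro x hx y hy z hz hwd
    exfalso
    obtain ⟨k1, k2⟩ := hwd rfl
    have e2 : ∀ p q : ℕ, Nat.add p q = p + q := fun _ _ => rfl
    have p0 : (0:ℝ) ≤ B.h0 * x := mul_nonneg (by positivity) hx.1
    have p1 : (0:ℝ) ≤ B.h1 * y := mul_nonneg (by positivity) hy.1
    have q1 : (B.h1 * y:ℝ) ≤ B.h1 := mul_le_of_le_one_right (by positivity) hy.2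
    have q2 : (B.h2 * z:ℝ) ≤ B.h2 := mul_le_of_le_one_right (by positivity) hz.2
    unfold skipB at h
    cases g5 : (Nat.ble (Nat.add B.a1 B.h1) B.a0) <;> rw [g5] at h
    · have := Nat.le_of_ble_eq_true h
      rw [e2] at this
      have : ((B.a2 + B.h2 : ℕ) : ℝ) ≤ B.a1 := by exact_mod_cast this
      push_cast at this; linarith
    · have := Nat.le_of_ble_eq_true g5
      rw [e2] at this
      have : ((B.a1 + B.h1 : ℕ) : ℝ) ≤ B.a0 := by exact_mod_cast this
      push_cast at this; linarith
end Kiss9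

namespace Kiss9
open Finset MvPolynomial

noncomputable def bt (T i : ℕ) : ℕ := Nat.land (Nat.shiftRight T (Nat.mul 32 i)) 4294967295
noncomputable def rootOf (β w kk Sc n0 n1 n2 Z : ℕ) : ℕ :=
  force (Nat.mul (Nat.mul n0 n1) n2) fun N => force (Nat.pow 2 (Nat.mul β N)) fun Mo =>
  force (Nat.pow 2 (Nat.sub β 1)) fun hB =>
  force (Nat.pow 2 (Nat.mul w N)) fun bad => force (Nat.add (Nat.pow 2 kk) 1) fun K =>
  force (Nat.sub (Nat.pow 2 (Nat.add kk 1)) 1) fun top =>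
  force (Nat.pow 4294967297 (Nat.sub n0 1)) fun T0 => force (Nat.pow 4294967297 (Nat.sub n1 1)) fun T1 =>
  force (Nat.pow 4294967297 (Nat.sub n2 1)) fun T2 =>
  force (Nat.mod (Nat.add Z (Nat.mul hB (ones β N))) Mo) fun Y =>
   rootN β w K hB bad top Sc n0 n1 n2 (bt T0) (bt T1) (bt T2) Y

def BT (n : ℕ) : Prop := ∀ i < n, bt (4294967297 ^ (n-1)) i = (n-1).choose i

abbrev Prg := ∀ (α : Type), Ops α → α → α → α → α
def Par (F : Prg) : Prop := ∀ {α β : Type} (O : Ops α) (O' : Ops β) (R : α → β → Prop), Rel O O' R →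
  ∀ q r s q' r' s', R q q' → R r r' → R s s' → R (F _ O q r s) (F _ O' q' r' s')

noncomputable def chkF (F : Prg) (β n0 n1 n2 : ℕ) : Bool :=
  cond (Nat.ble (Nat.add (F _ OB 1 1 1) 1) (Nat.pow 2 (Nat.sub β 1)))
   (cond (Nat.ble (F _ OD2 2 1 1) n0) (cond (Nat.ble (F _ OD2 1 2 1) n1) (Nat.ble (F _ OD2 1 1 2) n2) false) false) false
noncomputable def ZF (F : Prg) (β n0 n1 n2 : ℕ) : ℕ :=
  force (Nat.mul (Nat.mul n0 n1) n2) fun N => force (Nat.pow 2 (Nat.mul β N)) fun Mo => force (Nat.sub Mo 1) fun ma =>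
  force (Nat.mod (Nat.pow 2 β) Mo) fun q0 => force (Nat.mod (Nat.pow 2 (Nat.mul β n0)) Mo) fun q1 =>
  force (Nat.mod (Nat.pow 2 (Nat.mul (Nat.mul β n0) n1)) Mo) fun q2 => F _ (OL Mo ma) q0 q1 q2
noncomputable def poly (F : Prg) : P3 := F _ OP (X 0) (X 1) (X 2)

lemma deg_X (i j : Fin 3) (h : j ≠ i) : (X j : P3) = 0 ∨ degreeOf i (X j : P3) < 1 := by
  right; rw [degreeOf_X_of_ne h.symm]; exact Nat.one_pos
lemma deg_X' (i : Fin 3) : (X i : P3) = 0 ∨ degreeOf i (X i : P3) < 2 := by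
  right; rw [degreeOf_X]; simp

lemma prg_rep (F : Prg) (hF : Par F) (β w kk Sc n0 n1 n2 : ℕ) (h0 : 0 < n0) (h1 : 0 < n1) (h2 : 0 < n2)
    (hβ : 0 < β) (hSc : 0 < Sc) (b0 : BT n0) (b1 : BT n1) (b2 : BT n2) (hc : chkF F β n0 n1 n2 = true)
    (hX : rootOf β w kk Sc n0 n1 n2 (ZF F β n0 n1 n2) < 2 ^ (w * (n0*n1*n2))) :
    (poly F = 0 ∨ degreeOf 0 (poly F) < n0) ∧ (poly F = 0 ∨ degreeOf 1 (poly F) < n1) ∧ (poly F = 0 ∨ degreeOf 2 (poly F) < n2) ∧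
    Rep w kk n0 n1 n2 (Pp (poly F) n0 n1 n2 Sc) (rootOf β w kk Sc n0 n1 n2 (ZF F β n0 n1 n2)) := by
  simp only [chkF, Bool.cond_false_right, Bool.and_eq_true] at hc
  obtain ⟨c1, c2, c3, c4⟩ := hc
  have c1 : F _ OB 1 1 1 < 2 ^ (β-1) := Nat.le_of_ble_eq_true c1
  have d0 := hF OP OD2 _ (rel_D2 0) _ _ _ _ _ _ (deg_X' 0) (deg_X 0 1 (by decide)) (deg_X 0 2 (by decide))
  have d1 := hF OP OD2 _ (rel_D2 1) _ _ _ _ _ _ (deg_X 1 0 (by decide)) (deg_X' 1) (deg_X 1 2 (by decide))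
  have d2 := hF OP OD2 _ (rel_D2 2) _ _ _ _ _ _ (deg_X 2 0 (by decide)) (deg_X 2 1 (by decide)) (deg_X' 2)
  have d0 : poly F = 0 ∨ degreeOf 0 (poly F) < n0 := d0.imp id (fun h => lt_of_lt_of_le h (Nat.le_of_ble_eq_true c2))
  have d1 : poly F = 0 ∨ degreeOf 1 (poly F) < n1 := d1.imp id (fun h => lt_of_lt_of_le h (Nat.le_of_ble_eq_true c3))
  have d2 : poly F = 0 ∨ degreeOf 2 (poly F) < n2 := d2.imp id (fun h => lt_of_lt_of_le h (Nat.le_of_ble_eq_true c4))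
  refine ⟨d0, d1, d2, ?_⟩
  have hM : Maj (poly F) (F _ OB 1 1 1) := hF OP OB _ rel_B _ _ _ _ _ _ (maj_X 0) (maj_X 1) (maj_X 2)
  have hZ0 : ZF F β n0 n1 n2 = F _ (OL (2 ^ (β*(n0*n1*n2))) (2 ^ (β*(n0*n1*n2)) - 1)) ((2^β) % 2 ^ (β*(n0*n1*n2)))
      ((2^(β*n0)) % 2 ^ (β*(n0*n1*n2))) ((2^(β*n0*n1)) % 2 ^ (β*(n0*n1*n2))) := by
    simp only [ZF, force_eq]; rfl
  rw [OL_eq] at hZ0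
  have hpos : 0 < 2 ^ (β*(n0*n1*n2)) := by positivity
  have inp : ∀ (i : Fin 3) (a : ℕ) (e : (![2^β, 2^(β*n0), 2^(β*n0*n1)] : Fin 3 → ℤ) i = (a : ℤ)),
      a % 2 ^ (β*(n0*n1*n2)) < 2 ^ (β*(n0*n1*n2)) ∧ (((a % 2 ^ (β*(n0*n1*n2)) : ℕ) : ℤ) : ZMod (2 ^ (β*(n0*n1*n2)))) =
       ((eval (![2^β, 2^(β*n0), 2^(β*n0*n1)] : Fin 3 → ℤ) (X i : P3) : ℤ) : ZMod (2 ^ (β*(n0*n1*n2)))) := by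
    intro i a e
    refine ⟨Nat.mod_lt _ hpos, ?_⟩
    rw [eval_X, e, Int.cast_natCast, Int.cast_natCast, ZMod.natCast_mod]
  have hZ := hF OP (OM (2 ^ (β*(n0*n1*n2)))) _ (rel_M _ hpos ![2^β, 2^(β*n0), 2^(β*n0*n1)]) _ _ _ _ _ _
    (inp 0 (2^β) (by simp)) (inp 1 (2^(β*n0)) (by simp)) (inp 2 (2^(β*n0*n1)) (by simp))
  rw [← hZ0] at hZ
  exact root_rep (poly F) β w kk (F _ OB 1 1 1) Sc n0 n1 n2 _ _ _ _ h0 h1 h2 hβ hSc hM c1 d0 d1 d2 b0 b1 b2 hZ.2 _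
    (by simp only [rootOf, force_eq]; rfl) hX

noncomputable def Qs (p : P3) (n0 n1 n2 Sc H0 H1 H2 : ℕ) : ℝ → ℝ → ℝ → ℝ := fun x y z => Pp p n0 n1 n2 Sc (x/H0) (y/H1) (z/H2)
lemma PB_Qs (p : P3) (n0 n1 n2 Sc H0 H1 H2 : ℕ) (h0 : 0 < H0) (h1 : 0 < H1) (h2 : 0 < H2) :
    PB (Qs p n0 n1 n2 Sc H0 H1 H2) ⟨0, H0, 0, H1, 0, H2⟩ = Pp p n0 n1 n2 Sc := by
  have a0 : (H0:ℝ) ≠ 0 := by exact_mod_cast h0.ne'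
  have a1 : (H1:ℝ) ≠ 0 := by exact_mod_cast h1.ne'
  have a2 : (H2:ℝ) ≠ 0 := by exact_mod_cast h2.ne'
  funext x y z
  simp only [PB, Qs, Nat.cast_zero, zero_add]
  rw [mul_div_cancel_left₀ _ a0, mul_div_cancel_left₀ _ a1, mul_div_cancel_left₀ _ a2]

/-- the one-variable check -/
noncomputable def chk1 (F : Prg) (β w kk Sc n H fuel : ℕ) : Bool :=
  force (rootOf β w kk Sc n 1 1 (ZF F β n 1 1)) fun X => cond (Nat.ble (Nat.add X 1) (Nat.pow 2 (Nat.mul w n)))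
   (withCtx w kk n 1 1 false fun C => go C fuel X ⟨0, H, 0, 1, 0, 1⟩) false

lemma chk1_sound (F : Prg) (hF : Par F) (β w kk Sc n H fuel : ℕ) (hn : 0 < n) (hβ : 0 < β) (hSc : 0 < Sc) (hH : 0 < H)
    (b0 : BT n) (b1 : BT 1) (w0 : n + kk ≤ w) (hc : chkF F β n 1 1 = true) (hk : chk1 F β w kk Sc n H fuel = true) :
    ∀ x ∈ Set.Ico (0:ℝ) 1, (1-x)^(n-1) * F _ OR (x/(1-x)) 0 0 < 0 := by
  simp only [chk1, force_eq, withCtx_eq, Bool.cond_false_right, Bool.and_eq_true] at hk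
  obtain ⟨k1, k2⟩ := hk
  have k1 := Nat.le_of_ble_eq_true k1
  obtain ⟨d0, d1, d2, hR⟩ := prg_rep F hF β w kk Sc n 1 1 hn one_pos one_pos hβ hSc b0 b1 b1 hc (by
    rw [show n * 1 * 1 = n by ring]; exact k1)
  rw [← PB_Qs (poly F) n 1 1 Sc H 1 1 hH one_pos one_pos] at hR
  have hG := go_sound hn one_pos one_pos w0 (by omega) (by omega) _ false 0 (by norm_num) fuel _ _ hR k2
  intro x hx
  have h := hG x ⟨hx.1, hx.2.le⟩ 0 ⟨le_refl _, zero_le_one⟩ 0 ⟨le_refl _, zero_le_one⟩ (by simp)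
  have e := congrFun (congrFun (congrFun (PB_Qs (poly F) n 1 1 Sc H 1 1 hH one_pos one_pos) x) 0) 0
  simp only [PB] at e
  have hS' : (0:ℝ) < Sc := by exact_mod_cast hSc
  simp only [add_zero, e] at h
  rw [Pp_eq _ _ _ _ _ d0 d1 d2 _ _ _ hx.2 one_pos one_pos] at h
  have er := hF OP OR _ (rel_R ![x/(1-x), 0/(1-0), 0/(1-0)]) (X 0) (X 1) (X 2) (x/(1-x)) 0 0 (by simp) (by simp) (by simp)
  rw [poly, er] at h
  have := (div_neg_iff.1 h)
  rcases this with h | h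
  · linarith [h.2]
  · have := h.1
    simpa using this

/-- the three-variable check -/
noncomputable def chk3 (F G : Prg) (β w kk Sc n H : ℕ) (t : Tr) : Bool :=
  force (rootOf β w kk Sc n n n (ZF F β n n n)) fun X => force (rootOf β w kk 1 n n n (ZF G β n n n)) fun Y =>
  force (Nat.mul (Nat.mul n n) n) fun N => force (Nat.pow 2 (Nat.mul w N)) fun U =>
  cond (Nat.ble (Nat.add X 1) U) (cond (Nat.ble (Nat.add Y 1) U)
   (withCtx w kk n n n true fun C => force (ones w N) fun on => force (Nat.pow 2 (Nat.sub w 1)) fun half =>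
    force (Nat.mul half on) fun hi => force (Nat.pow 2 (Nat.sub (Nat.sub w kk) 2)) fun cap => force (Nat.pow 2 kk) fun kp =>
     go2 C on hi half cap kp t X Y ⟨0, H, 0, H, 0, H⟩) false) false

lemma chk3_sound (F G : Prg) (hF : Par F) (hG : Par G) (β w kk Sc n H : ℕ) (t : Tr) (hn : 0 < n) (hβ : 0 < β) (hSc : 0 < Sc) (hH : 0 < H)
    (b0 : BT n) (w0 : n + kk ≤ w) (hw : kk + 2 ≤ w) (hc : chkF F β n n n = true) (hc' : chkF G β n n n = true)
    (hk : chk3 F G β w kk Sc n H t = true) : ∃ c > 0,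
    ∀ x ∈ Set.Ico (0:ℝ) 1, ∀ y ∈ Set.Ico (0:ℝ) 1, ∀ z ∈ Set.Ico (0:ℝ) 1, x < y → y < z →
     ((1-x)*(1-y)*(1-z))^(n-1) * F _ OR (x/(1-x)) (y/(1-y)) (z/(1-z)) ≤ -c ∨
     ((1-x)*(1-y)*(1-z))^(n-1) * G _ OR (x/(1-x)) (y/(1-y)) (z/(1-z)) ≤ -c := by
  simp only [chk3, force_eq, withCtx_eq, Bool.cond_false_right, Bool.and_eq_true] at hk
  obtain ⟨k1, k2, k3⟩ := hk
  have k1 := Nat.le_of_ble_eq_true k1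
  have k2 := Nat.le_of_ble_eq_true k2
  obtain ⟨d0, d1, d2, hR⟩ := prg_rep F hF β w kk Sc n n n hn hn hn hβ hSc b0 b0 b0 hc k1
  obtain ⟨d0', d1', d2', hR'⟩ := prg_rep G hG β w kk 1 n n n hn hn hn hβ one_pos b0 b0 b0 hc' k2
  rw [← PB_Qs (poly F) n n n Sc H H H hH hH hH] at hR
  rw [← PB_Qs (poly G) n n n 1 H H H hH hH hH] at hR'
  set c : ℝ := 1 / (2 * 2 ^ (w - kk - 2)) with hcdef
  have hc0 : 0 < c := by positivity
  have hc1 : c * 2 ^ (w - kk - 2) < 1 := by rw [hcdef]; field_simp; norm_num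
  have hGd := go2_sound hn hn hn hw w0 w0 w0 _ _ c hc1 hc0 t _ _ _ hR hR' k3
  have hS' : (1:ℝ) ≤ Sc := by exact_mod_cast hSc
  have hH' : (0:ℝ) < H := by exact_mod_cast hH
  refine ⟨c, hc0, ?_⟩
  intro x hx y hy z hz hxy hyz
  have h := hGd x ⟨hx.1, hx.2.le⟩ y ⟨hy.1, hy.2.le⟩ z ⟨hz.1, hz.2.le⟩ (by
    intro _
    simp only [Nat.cast_zero, zero_add]
    exact ⟨mul_lt_mul_of_pos_left hxy hH', mul_lt_mul_of_pos_left hyz hH'⟩)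
  have e := congrFun (congrFun (congrFun (PB_Qs (poly F) n n n Sc H H H hH hH hH) x) y) z
  have e' := congrFun (congrFun (congrFun (PB_Qs (poly G) n n n 1 H H H hH hH hH) x) y) z
  simp only [PB] at e e'
  simp only [e, e'] at h
  rw [Pp_eq _ _ _ _ _ d0 d1 d2 _ _ _ hx.2 hy.2 hz.2, Pp_eq _ _ _ _ _ d0' d1' d2' _ _ _ hx.2 hy.2 hz.2] at h
  have er := hF OP OR _ (rel_R ![x/(1-x), y/(1-y), z/(1-z)]) (X 0) (X 1) (X 2) (x/(1-x)) (y/(1-y)) (z/(1-z)) (by simp) (by simp) (by simp)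
  have er' := hG OP OR _ (rel_R ![x/(1-x), y/(1-y), z/(1-z)]) (X 0) (X 1) (X 2) (x/(1-x)) (y/(1-y)) (z/(1-z)) (by simp) (by simp) (by simp)
  rw [poly, poly, er, er', ← mul_pow, ← mul_pow] at h
  rw [← lt_neg_iff_add_neg] at h
  rcases min_lt_iff.1 h with h | h
  · left
    rw [div_lt_iff₀ (by linarith)] at h
    nlinarith
  · right
    rw [Nat.cast_one, div_one] at h
    exact h.le
end Kiss9

namespace Kiss9
def off : ℕ := 4951760157141521099596496896
def dD0 : List (List ℕ) :=
  [[4951662857283538921135786467, 4951285653990138459785007020, 4952914997528040091396861477, 4933156982114429231167981572,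
  5087459622435941607499116984, 4513731719190854149464051682, 5697167583513836443233990804, 4177291800897100745801434801, 5418646432862638556853722547,
  4793092322466112350521088103, 4974117389569583125646016654, 4951366248497470619666181394, 4951352738917871850476562753, 4951735386299360232867179203,
  4951758003412539389822128812], [4951669918313308726860752245, 4952056174838078393562779363, 4940533437628138835012367720,
  5058365577652317807169929525, 4461240282473714785989801415, 6187742427530542015762442161, 3214169597562872521967824690, 6283145636579066634999446830,
  4444549935080379730454384084, 5027881017803000323605159564, 4945222956257024085327277329, 4951481604512470549390066478, 4951504457929420707514823847,
  4951808422178259411125712179, 4951765091108462809804906871], [4951758908747908280321036750, 4950104831226609427959275238,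
  4967953653728676445081616212, 4885325428668454744015642142, 4998938170424969234731374465, 5540380802491243761534168259, 2643369951269700104387720164,
  8878320127915084704253995559, 1391505489139386042328194197, 6748185468907836398668170489, 4448787077595240349004391166, 5027091197310927939035184467,
  4946355780785563425321042325, 4951874438292199630261802853], [4951590251602104626638523372, 4949844617647052836499949442,
  4956401096003618532268859957, 4956844140843708881789794115, 5172064798602498505629392604, 3515452627415183977210657338, 8593772964434663145869591818,
  127975844152683223062533154, 8581684402550321439845428623, 3358330124193910757706829689, 5349871846967193491057267592, 4902351760111873725411464950,
  4954157398384631455410210989], [4951615163493335821124931265, 4952364491864391858058576081, 4944010441734757346795551862,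
  5014229686067872437056149247, 4531864744220105448047301293, 6578075574129673174912663866, 1615741602646940389798399840, 8712183605942423819323732779,
  2471837615650140334092408697, 5902077946423932934945936364, 4755243090647953921441545821, 4971467716944354560828684468],
  [4951885225086776452347255776, 4952656213881865421020516105, 4942338864587401364654239938, 5014420239373739456619858319, 4745124278513126934082044447,
  5160956467651875103618400977, 5188306088034860360794421575, 4218402391686168728177515713, 5585720303427264848095838216, 4706520365964159057713501602,
  4987868796468298337425799284], [4951761926295322359315104475, 4951779869156621291706973658, 4941435779572156895328651546,
  5076255245519387565129200277, 4397465275980151415090997144, 6175953730083962272484721698, 3474927586270670881056410834, 5926572023133002251733208128,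
  4621780078443108856101266960, 4996964301793018664243570101], [4951706279591537369793838851, 4951853401353445861974102503,
  4961747728637723473157943261, 4844005151807429431057823090, 5425258333155006834894330621, 3934255181112611420995233751, 6033156375017742190495898004,
  4333109188150258105808499847, 5112607226872187372135529871], [4951810768352397769079528104, 4951584250701007449139561519,
  4950810450054628061671304544, 4989633891824261444235955835, 4782401579457037041861974768, 5235605924937711572834360860, 4720023089810537691471421839,
  5024169643741120528807879914], [4951868457614778329136418123, 4953342175767045947033280823, 4948919525778758461820258110,
  4923581620657420225545701342, 5073452193823120559703450257, 4752836063764481307993533448, 5042334793842723982077241018],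
  [4951743705243329049650098802, 4951630801511402007019453334, 4950854801689352567538135689, 4957319322177133495060422372, 4937519929261179716859802387,
  4967302843984585248106718104], [4951703993669896072999010156, 4951385518905429627250582414, 4952991144323494906489998600,
  4949001980180315072627693025, 4959245407110656938180630135], [4951661315930994091891550008, 4951402550831303585343122857,
  4951766666443096226087523277, 4956970708158830594056240875], [4951711194794685371482943446, 4951413576567728336933588260,
  4953431682187902298898472237], [4951758457995901514589480500, 4951775593021919901438167407], [4951761224223617136921550860]]
def dD : List (List (List ℕ)) :=
  [[[4951780757756662211338679880, 4951811102748461464031275723, 4950704735146938136694907637, 4954976870362562975380816001,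
  4941470844074522421192409472, 4964269935233486966113009254, 4938337114152904258782541450, 4981812547662942307910835904, 4919671527631566671369002802,
  4969782290877297652323331238, 4946109745821045605697746034, 4952408642229264523605034635, 4951779742314859005377368204, 4951762608939295252654518228],
  [4951707973708531847090908467, 4951149648465306606791987288, 4954828814268814425572960628, 4941838173172285022526196528, 4937610865500953180575210686,
  5108831910540385957466213111, 4594525171954568111915705425, 5316246668162838535875617534, 4761476858091489454253666729, 4999124570609981671798380927,
  4948292193270709268875377440, 4951376919395821706578899733, 4951815334303493203193942068], [4951727496627187121889659827,
  4951807831004387250658433317, 4962831659428699646902321472, 4867061841777226112603983630, 5178763978667588719312951309, 4708706802846371868514472815,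
  4965980417670583025285553693, 5135874677735788046201638227, 4781680438555655343745666776, 5020976651626069961687027936, 4938241356380995320692879186,
  4952848006439986799514652890], [4951738043671294720650391413, 4951031323333221435153433803, 4957435981145182872493746899,
  4906333126778386050818072215, 5161791077259262208319627429, 4407120454018527034890654291, 5758785343946219789233827497, 4259986149491970404509291785,
  5286321751616242957194866346, 4865645844387093821802674442, 4961487478297728851858868128], [4951763461732210353290786005,
  4951453071890438450879297213, 4948169315966604053259266259, 4991305887991895328100964108, 4786034052893497838736945321, 5306250000689538217756600510,
  4521725576100828708919240452, 5252309352281318377462165201, 4838941371359280891850923977, 4969006618935259578754010788],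
  [4951839805839467336869232757, 4950670061001528336187206109, 4965365390323564079274863925, 4868535996008248910459962446, 5244840748578629150806426718,
  4382187971497960376267764916, 5523458521156549177865650729, 4670843378292997655650520701, 5005456062684098800854564327],
  [4951792305824693075595336138, 4952258339450347688140828131, 4946511102157762530911156532, 4988573791723057376851269420, 4841455882138615111675438352,
  5107431275426379864966597708, 4831911800578920007514157081, 4988508848509157371241548403], [4951782135169467948237076700,
  4952752705904454949608635272, 4954447677986792717842669936, 4919976879982591019608111886, 5032613294397218185992393375, 4871943697490091577789560609,
  4979736802373013582262362121], [4951740242689533314541968530, 4951409498189928763215551258, 4951405642070357233517181088,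
  4956631482038483544974599900, 4940945562642180950926695162, 4961787145004041102416116955], [4951763978991775058570757025,
  4951939169051340719925944071, 4951740071062689756807716584, 4950592601687069002718144039, 4955454855926204963950976296],
  [4951743296057517553753433480, 4951702395899127950556545609, 4951442183434542031968603417, 4952959491932711917738066296],
  [4951748394552341668297105186, 4951571175023243541850533183, 4952112517267868929181511187], [4951769276689033415448559018,
  4951845668110689912690028534], [4951761375261898215401067889]], [[4951760032113280205636881282, 4951599548165436372061093601,
  4954509673653387725567658783, 4936100482868001567786841319, 4997140242257643771929904392, 4881597780228158322184016108, 5016436521600934805141996312,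
  4915241736196443540780879726, 4964119855278892028029839515, 4949179733778355367304750306, 4952046855403989894425507701, 4951760848455915158055514603,
  4951760931830179717516936130], [4951749483947152028606536188, 4952143902878992206886528312, 4947467123697526146781816494,
  4978060901278818772354109787, 4864257204598244356226430251, 5117318853864255331170775941, 4770877698733670215557613751, 5066399179913892689588824518,
  4910163927912563060204835458, 4959882085892928459311355780, 4951035272477588939746236656, 4951782856807223057196272647],
  [4951756384837790601507343726, 4952112570037975831442746109, 4948461213411147372686435945, 4965651411023660441667086931, 4927392936234645353797420155,
  4962147566490170163944736779, 4972627748212976102836504968, 4922052169340936492873583775, 4966867907090157751321368302, 4948543349148513642502984382,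
  4952024706529966545270306440], [4951777920600847908311595349, 4951705370546984650848445204, 4949347709232403863204820417,
  4966368100384128441736860121, 4916642522911926846429233301, 4998569392262734891004212729, 4909164613849081252044794181, 4977105175952263375819206344,
  4943362004037138219466318221, 4952943546531126716332257062], [4951775216763938686500818507, 4951600059624013834056877925,
  4955759567809262377710811856, 4930499218584362165808970809, 5007619579034922579154049816, 4874777232044949720456756356, 5006683218700834556557433039,
  4931697921689470922630787615, 4954795837605909522053727404], [4951757314578113721244807836, 4952003081892143159185876135,
  4949910617324564794073944230, 4960910186891148406720706728, 4928201166273229710386388396, 4983233166200802926238471113, 4931179432725291803697025057,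
  4957675916189851144097986616], [4951741309628302559130504553, 4951841330160686445247346941, 4953974506583000246029252033,
  4939128796881077378230576193, 4975406490570776721476336698, 4934052038829857421546450774, 4956258164154492178235643891],
  [4951764968814129125756052299, 4951618990169341786139600624, 4951538212384255397507144052, 4953890102137662512116490345, 4947350018543458779620769956,
  4954587919600561787332386409], [4951758176226382738426687327, 4951729752793025730203239547, 4951855988836413105139663189,
  4951405893555163423504238721, 4952189390619504615117009204], [4951760427674067022802715797, 4951809564751101124913744059,
  4951667860388345493208141174, 4951998286863810677493332766], [4951762331010434221895337934, 4951758531958214019103291716,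
  4951823784651962973622059309], [4951760134257195896091158920, 4951769485796475444560245198], [4951760567498660250654375210]],
  [[4951760932233284718740841347, 4951768056101199765808824158, 4951385683811530122861071847, 4953626512547899181529836879,
  4947405072898340394716724866, 4957143101416204550101928631, 4947899859518422500253775416, 4953394323929839435580967497, 4951393765825596391116885518,
  4951797409037837029757397060, 4951761023535540591153388552, 4951760391647743865644536451], [4951760251518127463753678652,
  4951867864086370652439731831, 4950657340779500006970450937, 4955261051376364959616407113, 4947587042088010337924838570, 4952261516307143493467626155,
  4954465178899867495374163348, 4949465240812043075939062280, 4952527735442152309492116768, 4951647104820911289309469014, 4951765910538445428108167429],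
  [4951763387494663384037161104, 4951776130201065261627205331, 4951256923467340193521201609, 4954131843041154646759370574, 4946441421127044821181599523,
  4958764440359304529730897770, 4945932244365905880256474759, 4954568318372796211620357686, 4951086652097901729502858001, 4951819654400799818180948787],
  [4951758141813586501192784156, 4951736016645791389714321348, 4952226981869147333832286258, 4949480513647963985231486942, 4956695508812236854067150859,
  4946425730684677788019324301, 4954902139961797430251705074, 4950855616614915039705331151, 4951838840065011156206399513],
  [4951752045262147112425578044, 4951897955647507181545903891, 4950723501997378632320994574, 4955676542762275082482640061, 4943779224628378681874506641,
  4959966036954292922766218483, 4947742828934088298022930444, 4952531574982044562458249768], [4951760016574871607905889729,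
  4951708230594203968108195176, 4952338851605934413127618635, 4949839194228997195520247852, 4954456003745926195989875354, 4950020963239177517171046636,
  4952134474950176853005605410], [4951763546605030207326105707, 4951754103714981708374975989, 4951591749063154259810699532,
  4952467993134538596963370542, 4950864245968849154197527075, 4952164662263323037330031988], [4951759608094922985216501104,
  4951757148420900671611537945, 4951803721565476480676987569, 4951617428693026897702328673, 4951913484392123822038729702],
  [4951760215073618898384262617, 4951763472563040824690184555, 4951751477744584052319847465, 4951784721884938589520896042],
  [4951761488794085273368522376, 4951752062834836262076573880, 4951786799584340951090392966], [4951759995567950575673275986,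
  4951761596472436419877416398], [4951760274657085618364460691]], [[4951759775404676406081281932, 4951758645878921679859257397,
  4951795825117568744266662004, 4951650386072969825904811440, 4951915336850804181428729813, 4951634753888583211111755111, 4951825193528963052749524454,
  4951734892278688260878350002, 4951764388927883172585597070, 4951760283858075878092455677, 4951760203799590215728301273],
  [4951761731993271031965477881, 4951745435605408517509927270, 4951839697939336200540308989, 4951515077653629195359522348, 4952145854313988686703079092,
  4951518898528647592584523707, 4951779684188251697465774332, 4951795500022989844841231482, 4951750071568699049772418316, 4951760780104005257886990391],
  [4951761289438477583254387156, 4951724265831342599395605298, 4952000863257035523076584462, 4951087307341045030435836020, 4952701792122589733582352149,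
  4951042322404566640394175107, 4952062521135997793768047045, 4951696418559922933775215334, 4951765467666884753224041116],
  [4951759006962276030505932017, 4951781585317215854551354181, 4951621206142185556324789131, 4952165068113132025691858443, 4951176581569559312985857454,
  4952172926228293345428608722, 4951622549229219197965511916, 4951775439919112654216845375], [4951760383989343467903857513,
  4951743150211925101063778345, 4951883225773582427533631436, 4951429884462514017549166725, 4952148041223129433451214264, 4951556575125961233839050505,
  4951805097748399835446862223], [4951760038448366407185317867, 4951764326478425412314131771, 4951736069641018927810794504,
  4951813016082052652254229672, 4951715268782272692395125764, 4951775070738776299161910878], [4951760095668992464784228846,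
  4951759491573869792836074497, 4951765955317361691871225898, 4951749277653858420533614322, 4951766924865178328120797536],
  [4951759950808664990787055977, 4951762140918324917288243345, 4951755275696018672116102904, 4951765345203114701515937871],
  [4951760327177595751088244170, 4951759227573885629683709499, 4951761724096607154932183957], [4951760126395340226200269184,
  4951760276463655651701315531], [4951760168200133046116684281]], [[4951759939534431949611571782, 4951761559614210032179282910,
  4951758137286167103243391270, 4951755293518961767711673037, 4951772690871440011154942017, 4951750151492580838542152161, 4951763021234838376771304038,
  4951759974412594741165156339, 4951760172915843324690929074, 4951760160609508815969868009], [4951760733110561170459632963,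
  4951751724983370415906762395, 4951799564191510282802910496, 4951674196335232840193233581, 4951856833437905245136193951, 4951701006292320382249918029,
  4951779350202815276692831049, 4951757284221115870163325960, 4951760290670386841902447370], [4951759732062489678730957328,
  4951765385866040737724347640, 4951736418515476564744236487, 4951811000775403456106849119, 4951705661124096911722720527, 4951788565984209425372583350,
  4951753582804604642685094163, 4951760619456559251366268419], [4951760347616678012083655275, 4951758664709339086944058606,
  4951767078974930650961870719, 4951743054603979252481220679, 4951781760501690466877950571, 4951748703108376581458748338, 4951762339175075381369900245],
  [4951760131550446723700593968, 4951760843036095511363440331, 4951757167701602156674281249, 4951765115500821487442084272, 4951757117992670287961411621,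
  4951760819427973853435185118], [4951760182943296252281500342, 4951759779245582508278621765, 4951761578587790340677427886,
  4951758234876873244299708875, 4951761067764223449951598389], [4951760125252799117028460370, 4951760316523955553613857783,
  4951759907798373874116093978, 4951760262655329157779826239], [4951760177830840685563540045, 4951760073760280571099545500,
  4951760264981905851583275837], [4951760153703773779794619822, 4951760166379726930932365707], [4951760157857703410878582499]],
  [[4951760071549087196239217564, 4951760872705976942507010977, 4951757862091743156426952189, 4951763784156536158633299660,
  4951757325387266139941835696, 4951761217550300101695240494, 4951760007319178867172539937, 4951760164724533988075715829, 4951760157312693872406037618],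
  [4951760148940523763723918407, 4951760236684909497239248662, 4951759873749289891847312656, 4951760634253562495634748021, 4951759757183329846775407410,
  4951760317630875389697611300, 4951760128967335172863882375, 4951760158871838894641441643], [4951760163599957270783829457,
  4951760096359797868333285166, 4951760372243922519270853686, 4951759795807870307302361554, 4951760446982373373650628719, 4951760057130880762685064938,
  4951760168037883351432940413], [4951760155857793872973525184, 4951760166422422018974204097, 4951760130959386729248272392,
  4951760195265006634838564032, 4951760130528923829763342907, 4951760164033055128165498045], [4951760159997451463909622497,
  4951760136220512593577183847, 4951760207142030079620076624, 4951760111978179798791029400, 4951760170533895971963560114],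
  [4951760154963767782886663564, 4951760167616467271339534446, 4951760141131943163945269645, 4951760166311870042736739618],
  [4951760157602510616181798308, 4951760155193515015730506943, 4951760159294814840840949036], [4951760156682232691698242128,
  4951760158079937313819782961], [4951760157175969814565868122]], [[4951760150206369939161159966, 4951760188244229540720928656,
  4951760090496580809026880442, 4951760233517307481893217626, 4951760112329421377690520672, 4951760172237798644550250510, 4951760154386212738373847691,
  4951760157172723746505346631], [4951760158369435727399960869, 4951760149160233934901001101, 4951760176870127402251994927,
  4951760133455535839957651483, 4951760171697181889623100706, 4951760152812378524128430838, 4951760157635200661031495052],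
  [4951760157141373045896827574, 4951760158101986767267047033, 4951760153848521115624996868, 4951760161120843980296370126, 4951760155028855820193836377,
  4951760157567674295253326700], [4951760157429250017991477112, 4951760156085207424748045358, 4951760158790226210121069986,
  4951760155798102779644594445, 4951760157555369673821840829], [4951760157080603509507369283, 4951760157655004516368042491,
  4951760156257642425920694071, 4951760157508148176310497004], [4951760157221427984027278344, 4951760156892494105988250236,
  4951760157310704044356235368], [4951760157091513945575465408, 4951760157228932445307343283], [4951760157147451303513192564]],
  [[4951760157251902525359096982, 4951760156277462077591449106, 4951760158802606500806097702, 4951760155887624116406310214,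
  4951760157600382313876058065, 4951760157061407193968454949, 4951760157144578381252746352], [4951760157123426416331155211,
  4951760157245570766793969617, 4951760156930498185033859715, 4951760157328434001985220837, 4951760157068356133796175540, 4951760157151760487209582904],
  [4951760157149382069250939500, 4951760157102347980499098905, 4951760157210142123706643784, 4951760157093825073562621605,
  4951760157152148578826364713], [4951760157133574119009724385, 4951760157172259637434409121, 4951760157107078997769183740,
  4951760157152066273275765571], [4951760157145441328027264471, 4951760157130228659967600127, 4951760157147458888661333765],
  [4951760157139475178043562041, 4951760157144298198236081314], [4951760157142122964669046301]], [[4951760157141855356352817225,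
  4951760157141318398898344230, 4951760157142258634269736256, 4951760157140813015131070003, 4951760157141519232579042159, 4951760157141558964403252021],
  [4951760157142459887423421634, 4951760157137444936585926475, 4951760157147416366320520745, 4951760157138249480847500183,
  4951760157142113547320366094], [4951760157140855230989335094, 4951760157143585745780500649, 4951760157139755139600792450,
  4951760157141958574760580129], [4951760157141724864214136378, 4951760157140710045479615419, 4951760157142033827263284859],
  [4951760157141322316218332207, 4951760157141780433240390905], [4951760157141626612972459016]], [[4951760157141511439802201505,
  4951760157141520082198456933, 4951760157141517856948691279, 4951760157141519596998863781, 4951760157141523424397744807],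
  [4951760157141477946763386216, 4951760157141659608568454094, 4951760157141395453256573669, 4951760157141553165591924669],
  [4951760157141548189678377316, 4951760157141454376585698434, 4951760157141549269483411446], [4951760157141513808519999336,
  4951760157141532794051076012], [4951760157141526246215086734]], [[4951760157141521334616977379, 4951760157141521553170712338,
  4951760157141520619545200121, 4951760157141521311505550513], [4951760157141521833665102037, 4951760157141519865425025128,
  4951760157141521880327973031], [4951760157141520278197103132, 4951760157141522347568880873], [4951760157141521540586113174]],
  [[4951760157141521106648554617, 4951760157141521055166443110, 4951760157141521119292059918], [4951760157141521052171482738,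
  4951760157141521127876578654], [4951760157141521115522138109]], [[4951760157141521098050592055, 4951760157141521100618029303],
  [4951760157141521100799238759]], [[4951760157141521099621918730]]]
def dDl : List ℕ :=
  [4952362431545902742593828515, 4951760157141521099596496896, 4951760157141521099596496896, 4951760157141521099596496896, 4951760157141521099596496896,
  4951760157141521099596496896, 4951760157141521099596496896, 4951760157141521099596496896, 4951760157141521099596496896, 4951760157141521099596496896,
  4951760157141521099596496896, 4951760157141521099596496896, 4951760157141521099596496896, 4951760157141521099596496896, 4951760157141521099596496896,
  4951760157141521099596496896]
def dAl : List ℕ :=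
  [0, 135387275617386639775000000000000000000000000000000000000000, 8373910104218947523080357142857142857142857142857142857143,
  339577828533317735595238095238095238095238095238095238095, 55744388750431622877728174603174603174603174603174603175,
  937546901702856551897321428571428571428571428571428571, 28766299543766405645931036556036556036556036556036556,
  2851102438452928399544610482110482110482110482110, 5222852492134656730563015440247583104725961869, 1457120334151871428457179945275183370421465660,
  31153796225449988404880154670891278034135177, 10516549089614222378448292813062158300253538, 10011466197873216467203630245116370816651,
  912363955498693438891595882128183316202, 5937521956946060366499700369091681446, 801162056793848896039434470428251042,
  4413115709591787085364413517630951, 322432144775812662271044214123119, 1763814665415178847934292546433, 125960859575074664201932700156,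
  667829001854828674529227345, 38896882377280966195643058, 241151132620393260936532, 13103301014563321050206, 69956769472992064975, 2993288077452194028,
  16842421681802061, 705999738253561, 4090328246150]
def tree : Tr :=
  (.s (.s (.s (.o 19) (.s (.s (.s (.o 7) (.s (.s (.o 1) (.s (.o 1) (.s (.s (.s (.o 1) (.s (.f 1 1) (.o 1))) (.s (.o 1) (.s (.s (.s (.o 1) (.s (.f 1 1)
  (.o 1))) (.s (.o 1) (.s (.f 8 1) (.o 1)))) (.o 1)))) (.o 2)))) (.o 5))) (.s (.s (.s (.o 1) (.s (.s (.s (.o 1) (.s (.f 1 2) (.s (.e 1) (.f 2 1)))) (.o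
  1)) (.s (.s (.o 1) (.s (.s (.f 256 216) (.o 1)) (.o 2))) (.o 5)))) (.o 9)) (.o 14))) (.o 12))) (.s .k (.s (.s (.s (.s (.s (.s (.s (.s (.s (.s (.e 1)
  (.s (.f 16 18) (.s .k (.s (.f 16 20) (.o 1))))) (.s (.s (.s (.e 1) (.s (.e 1) (.f 1 2))) (.s (.s (.e 1) (.s (.f 16 39) (.s (.s (.e 1) (.f 1 2)) (.s
  (.e 1) (.f 16 25))))) (.s (.e 1) (.s (.s (.s (.e 1) (.f 1 1)) (.f 16 21)) (.s (.s (.f 16 30) (.f 1 1)) (.s (.f 16 22) (.o 1))))))) (.s (.s (.f 16 14)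
  (.o 1)) (.s (.s (.f 1 1) (.o 1)) (.o 1))))) (.s .k (.s (.s (.s (.s (.e 1) (.s (.s (.s (.e 1) (.s (.f 16 28) (.s .k (.f 16 25)))) (.s (.s (.f 256 550)
  (.s (.s (.e 1) (.f 1 2)) (.s (.e 1) (.f 16 27)))) (.s (.f 16 23) (.f 16 20)))) (.s .k (.s (.s (.s (.s (.e 1) (.s (.f 16 28) (.f 16 26))) (.s (.f 16
  30) (.f 16 24))) (.s .k (.s (.s (.f 16 28) (.f 16 26)) (.o 1)))) (.o 1))))) (.s (.s (.s (.e 1) (.s (.e 1) (.s (.f 1 2) (.f 16 30)))) (.s (.s (.e 1)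
  (.s (.f 16 37) (.s (.f 1 2) (.f 256 458)))) (.s (.e 1) (.s (.s (.f 16 28) (.f 16 24)) (.s (.f 16 24) (.f 16 20)))))) (.s (.s (.s (.s (.s (.s (.e 1)
  (.f 16 26)) (.f 256 408)) (.s (.s (.f 1 2) (.f 16 22)) (.s (.f 16 26) (.o 1)))) (.o 1)) (.s (.s (.f 16 20) (.f 1 1)) (.o 1))) (.s (.s (.s (.s (.s (.f
  256 427) (.o 1)) (.f 16 20)) (.s (.s (.f 16 23) (.o 1)) (.o 1))) (.o 1)) (.o 1))))) (.s .k (.s (.s (.s (.s (.e 1) (.s (.s (.f 256 460) (.f 16 25)) (.s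
  .k (.f 16 21)))) (.s (.f 1 2) (.s (.s (.f 16 21) (.f 1 1)) (.f 1 1)))) (.s .k (.s (.f 16 24) (.f 2 1)))) (.o 1)))) (.o 1)))) (.o 1)) (.s (.s (.s (.s
  (.s (.s (.s (.e 1) (.f 1 1)) (.s (.f 1 1) (.o 1))) (.s (.s (.s (.f 1 2) (.s (.f 1 2) (.s (.e 1) (.f 1 1)))) (.f 16 9)) (.s (.s (.s (.f 1 1) (.f 16 9))
  (.s (.s (.f 1 1) (.f 2 1)) (.s (.f 16 11) (.o 1)))) (.o 1)))) (.o 1)) (.s (.s (.s (.s (.s (.o 1) (.s (.f 4 1) (.f 8 1))) (.o 1)) (.o 2)) (.s (.s (.s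
  (.s (.f 4 1) (.f 256 21)) (.s (.s (.f 4 1) (.o 1)) (.s (.f 256 21) (.o 1)))) (.o 1)) (.s (.s (.o 1) (.s (.f 256 1) (.o 1))) (.o 1)))) (.o 3))) (.s (.s
  (.s (.s (.s (.s (.s (.s (.e 1) (.s (.f 16 23) (.f 16 20))) (.s (.f 1 2) (.f 16 12))) (.s (.s (.f 1 2) (.s (.f 16 17) (.f 1 1))) (.s (.f 16 20) (.o
  1)))) (.o 1)) (.s (.s (.s (.s (.f 1 1) (.o 1)) (.s (.f 2 1) (.o 1))) (.s (.s (.f 16 11) (.o 1)) (.s (.f 16 5) (.o 1)))) (.o 1))) (.s (.s (.s (.s (.s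
  (.f 16 23) (.f 2 1)) (.s (.f 16 13) (.o 1))) (.s (.s (.f 1 1) (.o 1)) (.f 256 88))) (.o 1)) (.s (.s (.s (.f 256 78) (.o 1)) (.o 1)) (.o 1)))) (.o 1))
  (.s (.s (.s (.s (.s (.s (.s (.f 256 50) (.o 1)) (.s (.s (.f 256 13) (.o 1)) (.o 1))) (.s (.f 16 1) (.o 1))) (.o 1)) (.o 4)) (.o 5)) (.o 1)))) (.o 6)))
  (.s .k (.s (.s (.s (.s (.s (.s (.s (.s (.s (.f 16 6) (.o 1)) (.o 1)) (.o 1)) (.o 1)) (.o 5)) (.o 2)) (.o 4)) (.o 5)) (.o 10)))) (.o 9)) (.s (.s (.s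
  (.o 10) (.s (.s (.o 2) (.s (.o 1) (.s (.f 1 4) (.s (.f 16 9) (.s (.f 1 2) (.f 1 2)))))) (.o 5))) (.s (.o 5) (.s (.s (.s (.o 1) (.f 1 4)) (.s (.o 1)
  (.e 1))) (.s (.s (.o 1) (.s (.f 1 1) (.o 1))) (.o 2))))) (.o 10))) (.s .k (.s (.s (.o 2) (.e 2)) (.o 2)))) (.o 16)))) (.o 23))
end Kiss9

namespace Kiss9
lemma pair_gen (off Λ W d n : ℕ) (D0 : List (List ℕ)) (D : List (List (List ℕ))) (dl al : List ℕ) (hn : n = 2*d)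
    (hD : shortL d (D0 :: D) 0 = true) (hal : al.length = 2*d+1)
    (h : ∀ x ∈ Set.Ico (0:ℝ) 1, (1-x)^n * pairP OR off Λ W d D0 D dl al (x/(1-x)) < 0)
    (u : ℝ) (hu : u ∈ Set.Icc (-1:ℝ) (1/2)) : pairR off Λ W d D0 D dl al u ≤ 0 := by
  subst hn
  have h1 : ∀ x ∈ Set.Ico (0:ℝ) 1, pairR off Λ W d D0 D dl al ((3*x-2)/2) ≤ 0 := by
    intro x hx
    rw [← pairP_eq off Λ W d D0 D dl al hD hal x hx.2]
    exact (h x hx).le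
  have hc : Continuous fun x : ℝ => pairR off Λ W d D0 D dl al ((3*x-2)/2) :=
    (pairR_cont off Λ W d D0 D dl al).comp (f := fun x : ℝ => (3*x-2)/2) (by fun_prop)
  have h2 : Set.Icc (0:ℝ) 1 ⊆ {x | pairR off Λ W d D0 D dl al ((3*x-2)/2) ≤ 0} := by
    rw [← closure_Ico (zero_ne_one (α := ℝ))]
    exact closure_minimal h1 (isClosed_le hc continuous_const)
  have h3 := @h2 ((2*u+2)/3) ⟨by linarith [hu.1], by linarith [hu.2]⟩
  have e : (3*((2*u+2)/3)-2)/2 = u := by ring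
  simpa only [Set.mem_ofPred_eq, e] using h3

lemma tri_cont (off d : ℕ) (D : List (List (List ℕ))) {f g h : ℝ → ℝ} (hf : Continuous f) (hg : Continuous g) (hh : Continuous h) :
    Continuous fun x => tri off d D (f x) (g x) (h x) := by
  have a : ∀ {f g h : ℝ → ℝ}, Continuous f → Continuous g → Continuous h → Continuous fun x => fsum off d (f x) (g x) (h x) D 0 := by
    intro f g h hf hg hh
    exact (fsum_cont off d D 0).comp (f := fun x => (f x, g x, h x)) (by fun_prop)
  exact ((a hf hg hh).add (a hf hh hg)).add (a hg hh hf)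

lemma tri_sorted_gen (off d e Sd n : ℕ) (D : List (List (List ℕ))) (hn : n = d) (hne : n = e+2) (hD : shortL d D 0 = true)
    (h : ∃ c > 0, ∀ x ∈ Set.Ico (0:ℝ) 1, ∀ y ∈ Set.Ico (0:ℝ) 1, ∀ z ∈ Set.Ico (0:ℝ) 1, x < y → y < z →
     ((1-x)*(1-y)*(1-z))^n * triP OR off D (x/(1-x)) (y/(1-y)) (z/(1-z)) ≤ -c ∨
     ((1-x)*(1-y)*(1-z))^n * detP OR e Sd (x/(1-x)) (y/(1-y)) (z/(1-z)) ≤ -c)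
    (u v t : ℝ) (hu : -1 ≤ u) (huv : u ≤ v) (hvt : v ≤ t) (ht : t ≤ 1/2)
    (hd : 0 ≤ 1+2*u*v*t-u^2-v^2-t^2) : tri off d D u v t ≤ 0 := by
  obtain ⟨c, hc, h⟩ := h
  set X : ℝ → ℝ := fun ε => (1-ε)*((2*u+2)/3)+ε*(1/4) with hX
  set Y : ℝ → ℝ := fun ε => (1-ε)*((2*v+2)/3)+ε*(1/2) with hY
  set Z : ℝ → ℝ := fun ε => (1-ε)*((2*t+2)/3)+ε*(3/4) with hZ
  have cX : Continuous X := by fun_prop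
  have cY : Continuous Y := by fun_prop
  have cZ : Continuous Z := by fun_prop
  set A : ℝ → ℝ := fun ε => tri off d D ((3*X ε-2)/2) ((3*Y ε-2)/2) ((3*Z ε-2)/2) with hA
  set B : ℝ → ℝ := fun ε => 4 * (Sd:ℝ) * (1+2*((3*X ε-2)/2)*((3*Y ε-2)/2)*((3*Z ε-2)/2)-((3*X ε-2)/2)^2-((3*Y ε-2)/2)^2-((3*Z ε-2)/2)^2) with hB
  have cA : Continuous A := tri_cont off d D (by fun_prop) (by fun_prop) (by fun_prop)
  have cB : Continuous B := by fun_prop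
  have h1 : Set.Ioo (0:ℝ) 1 ⊆ {ε | A ε ≤ -c} ∪ {ε | B ε ≤ -c} := by
    intro ε he
    have e0 := he.1
    have e1 : 0 < 1 - ε := by linarith [he.2]
    have bX : 0 ≤ (2*u+2)/3 := by linarith
    have bXY : (2*u+2)/3 ≤ (2*v+2)/3 := by linarith
    have bYZ : (2*v+2)/3 ≤ (2*t+2)/3 := by linarith
    have bZ : (2*t+2)/3 ≤ 1 := by linarith
    have x0 : 0 ≤ X ε := by simp only [hX]; positivity
    have xy : X ε < Y ε := by
      simp only [hX, hY]; have := mul_le_mul_of_nonneg_left bXY e1.le; linarith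
    have yz : Y ε < Z ε := by
      simp only [hZ, hY]; have := mul_le_mul_of_nonneg_left bYZ e1.le; linarith
    have z1 : Z ε < 1 := by
      simp only [hZ]; have := mul_le_mul_of_nonneg_left bZ e1.le; linarith
    have hh := h (X ε) ⟨x0, by linarith⟩ (Y ε) ⟨by linarith, by linarith⟩ (Z ε) ⟨by linarith, z1⟩ xy yz
    have e1 : ((1-X ε)*(1-Y ε)*(1-Z ε))^n * triP OR off D (X ε/(1-X ε)) (Y ε/(1-Y ε)) (Z ε/(1-Z ε)) = A ε := by
      rw [hn]; exact triP_eq off d D hD (X ε) (Y ε) (Z ε) (by linarith) (by linarith) z1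
    have e2 : ((1-X ε)*(1-Y ε)*(1-Z ε))^n * detP OR e Sd (X ε/(1-X ε)) (Y ε/(1-Y ε)) (Z ε/(1-Z ε)) = B ε := by
      rw [hne]; exact detP_eq e Sd (X ε) (Y ε) (Z ε) (by linarith) (by linarith) z1
    rw [e1, e2] at hh
    exact hh
  have h2 : Set.Icc (0:ℝ) 1 ⊆ {ε | A ε ≤ -c} ∪ {ε | B ε ≤ -c} := by
    rw [← closure_Ioo (zero_ne_one (α := ℝ))]
    exact closure_minimal h1 ((isClosed_le cA continuous_const).union (isClosed_le cB continuous_const))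
  have h3 := @h2 (0) ⟨le_refl _, zero_le_one⟩
  have eX : (3*X 0-2)/2 = u := by simp only [hX]; ring
  have eY : (3*Y 0-2)/2 = v := by simp only [hY]; ring
  have eZ : (3*Z 0-2)/2 = t := by simp only [hZ]; ring
  rcases h3 with h3 | h3
  · have h3 : A 0 ≤ -c := h3
    simp only [hA, eX, eY, eZ] at h3
    linarith
  · have h3 : B 0 ≤ -c := h3
    simp only [hB, eX, eY, eZ] at h3
    have : 0 ≤ 4 * (Sd:ℝ) * (1+2*u*v*t-u^2-v^2-t^2) := mul_nonneg (by positivity) hd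
    linarith

lemma tri_swap (off d : ℕ) (D : List (List (List ℕ))) (u v t : ℝ) : tri off d D u v t = tri off d D v u t := by
  simp only [tri]; rw [fsum_symm off d u v t]; ring
lemma tri_swap' (off d : ℕ) (D : List (List (List ℕ))) (u v t : ℝ) : tri off d D u v t = tri off d D u t v := by
  simp only [tri]; rw [fsum_symm off d v t u]; ring

lemma tri_gen (off d : ℕ) (D : List (List (List ℕ)))
    (hs : ∀ u v t : ℝ, -1 ≤ u → u ≤ v → v ≤ t → t ≤ 1/2 → 0 ≤ 1+2*u*v*t-u^2-v^2-t^2 → tri off d D u v t ≤ 0)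
    (u : ℝ) (hu : u ∈ Set.Icc (-1:ℝ) (1/2)) (v : ℝ) (hv : v ∈ Set.Icc (-1:ℝ) (1/2)) (t : ℝ) (ht : t ∈ Set.Icc (-1:ℝ) (1/2))
    (hd : 0 ≤ 1+2*u*v*t-u^2-v^2-t^2) : tri off d D u v t ≤ 0 := by
  rcases le_total u v with a | a <;> rcases le_total v t with b | b <;> rcases le_total u t with c | c
  · exact hs u v t hu.1 a b ht.2 hd
  · exact hs u v t hu.1 a b ht.2 hd
  · rw [tri_swap']; exact hs u t v hu.1 c b hv.2 (by linarith)
  · rw [tri_swap', tri_swap]; exact hs t u v ht.1 c a hv.2 (by linarith)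
  · rw [tri_swap]; exact hs v u t hv.1 a c ht.2 (by linarith)
  · rw [tri_swap, tri_swap']; exact hs v t u hv.1 b c hu.2 (by linarith)
  · rw [tri_swap', tri_swap, tri_swap']; exact hs t v u ht.1 b a hu.2 (by linarith)
  · rw [tri_swap', tri_swap, tri_swap']; exact hs t v u ht.1 b a hu.2 (by linarith)
end Kiss9

namespace Kiss9
def prT : Prg := fun _ O q r s => triP O off (dD0 :: dD) q r s
def prG : Prg := fun _ O q r s => detP O 12 8388608 q r s
def prP : Prg := fun _ O q _ _ => pairP O off (10^16) (10^45) 14 dD0 dD dDl dAl q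
lemma par_T : Par prT := fun _ _ _ h _ _ _ _ _ _ hq hr hs => triP_rel h off (dD0 :: dD) hq hr hs
lemma par_G : Par prG := fun _ _ _ h _ _ _ _ _ _ hq hr hs => detP_rel h 12 8388608 hq hr hs
lemma par_P : Par prP := fun _ _ _ h _ _ _ _ _ _ hq _ _ => pairP_rel h off (10^16) (10^45) 14 dD0 dD dDl dAl hq
lemma BT_15 : BT 15 := by unfold BT; decide +kernel
lemma BT_29 : BT 29 := by unfold BT; decide +kernel
lemma BT_1 : BT 1 := by unfold BT; decide +kernel
lemma short_D : shortL 14 (dD0 :: dD) 0 = true := by decide +kernel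
lemma len_al : dAl.length = 2*14+1 := by decide +kernel
lemma len_dl : dD0.length = dDl.length := by decide +kernel
lemma chk_b : (aN dAl 0 1 : ℤ) + ((10^16 : ℕ) : ℤ) * dZ off dD0 dDl < 364 * ((10^45 : ℕ) : ℤ) * ((10^16 : ℕ) : ℤ) := by decide +kernel
lemma chk_P : chkF prP 360 29 1 1 = true := by decide +kernel
lemma chk_G : chkF prG 328 15 15 15 = true := by decide +kernel
lemma chk_T : chkF prT 328 15 15 15 = true := by decide +kernel
lemma chk_pair : chk1 prP 360 96 60 (2^156) 29 4096 8 = true := by decide +kernel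
lemma chk_triple : chk3 prT prG 328 64 49 (2^123) 15 4096 tree = true := by decide +kernel

end Kiss9

namespace Kiss9
lemma pair_le : ∀ u ∈ Set.Icc (-1:ℝ) (1/2), pairR off (10^16) (10^45) 14 dD0 dD dDl dAl u ≤ 0 :=
  pair_gen off (10^16) (10^45) 14 (29-1) dD0 dD dDl dAl (by norm_num) short_D len_al
   (chk1_sound prP par_P 360 96 60 (2^156) 29 4096 8 (by norm_num) (by norm_num) (by positivity) (by norm_num)
    BT_29 BT_1 (by norm_num) chk_P chk_pair)

lemma tri_le : ∀ u ∈ Set.Icc (-1:ℝ) (1/2), ∀ v ∈ Set.Icc (-1:ℝ) (1/2), ∀ t ∈ Set.Icc (-1:ℝ) (1/2),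
      0 ≤ 1+2*u*v*t-u^2-v^2-t^2 → tri off 14 (dD0 :: dD) u v t ≤ 0 :=
  tri_gen off 14 (dD0 :: dD) (tri_sorted_gen off 14 12 8388608 (15-1) (dD0 :: dD) (by norm_num) (by norm_num) short_D
   (chk3_sound prT prG par_T par_G 328 64 49 (2^123) 15 4096 tree (by norm_num) (by norm_num) (by positivity)
    (by norm_num) BT_15 (by norm_num) (by norm_num) chk_T chk_G chk_triple))
end Kiss9

theorem kissing_number_dim9_le_364 (S : Finset (EuclideanSpace ℝ (Fin 9)))
    (hnorm : ∀ x ∈ S, ‖x‖ = 1)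
    (hdist : ∀ x ∈ S, ∀ y ∈ S, x ≠ y → 1 ≤ dist x y) :
    S.card ≤ 364 :=
  Kiss9.final_of Kiss9.off (10^16) (10^45) 14 Kiss9.dD0 Kiss9.dD Kiss9.dDl Kiss9.dAl Kiss9.len_dl (by norm_num) (by norm_num)
    Kiss9.pair_le Kiss9.tri_le Kiss9.chk_b S hnorm hdist
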